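/- arXiv:1210.1563 — 11 statements merged into one kernel-verified Lean document; each statement's English description precedes it below -/
import Mathlib

section
/- The series Σ_{j≥1} (1 − τ² c_{0j}/c_j)² converges; equivalently, λ^{-2} Σ_{j≥1} c_{0j}² l_j⁴ c_{1j}^{-2} < ∞. (Hence the operator T = I − τ² C^{-1/2} C₀ C^{-1/2} is Hilbert–Schmidt, which is condition (iii) of the Feldman–Hajek theorem in the proof of Theorem 3.2, and together with conditions (i),(ii) implies the posterior N(m,C) is equivalent to the prior N(0,τ²C₀).) -/
/-- Prior covariance eigenvalues `c_{0j} = j^{-2α}`. -/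
noncomputable def priorEig (α : ℝ) (j : ℕ) : ℝ := (j : ℝ) ^ (-(2 * α))

/-- Noise covariance eigenvalues `c_{1j} = j^{-2β}`. -/
noncomputable def noiseEig (β : ℝ) (j : ℕ) : ℝ := (j : ℝ) ^ (-(2 * β))

/-- Posterior covariance eigenvalues
`c_j = τ² λ c_{0j} c_{1j} / (c_{0j} l_j² + λ c_{1j})`. -/
noncomputable def postEig (τ lam α β : ℝ) (l : ℕ → ℝ) (j : ℕ) : ℝ :=
  τ ^ 2 * lam * priorEig α j * noiseEig β j /
    (priorEig α j * (l j) ^ 2 + lam * noiseEig β j)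

theorem summable_rpow_mul_exp_neg_mul_rpow (p : ℝ) {c b : ℝ} (hc : 0 < c) (hb : 0 < b) :
    Summable (fun n : ℕ => (n : ℝ) ^ p * Real.exp (-c * (n : ℝ) ^ b)) := by
  have hlim : Filter.Tendsto
      (fun n : ℕ => ((n : ℝ) ^ b) ^ ((p + 2) / b) * Real.exp (-c * (n : ℝ) ^ b))
      Filter.atTop (nhds 0) :=
    (tendsto_rpow_mul_exp_neg_mul_atTop_nhds_zero ((p + 2) / b) c hc).comp
      ((tendsto_rpow_atTop hb).comp tendsto_natCast_atTop_atTop)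
  refine summable_of_isBigO_nat (g := fun n : ℕ => (n : ℝ) ^ (-2 : ℝ))
    (Real.summable_nat_rpow.2 (by norm_num)) (Asymptotics.IsBigO.of_bound 1 ?_)
  filter_upwards [hlim.eventually_le_const one_pos, Filter.eventually_gt_atTop 0] with n hn hn0
  have hpos : (0 : ℝ) < n := Nat.cast_pos.2 hn0
  rw [← Real.rpow_mul hpos.le, mul_div_cancel₀ _ hb.ne'] at hn
  rw [Real.norm_of_nonneg (by positivity), Real.norm_of_nonneg (by positivity), one_mul]
  calc (n : ℝ) ^ p * Real.exp (-c * (n : ℝ) ^ b)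
      = (n : ℝ) ^ (-2 : ℝ) * ((n : ℝ) ^ (p + 2) * Real.exp (-c * (n : ℝ) ^ b)) := by
        rw [← mul_assoc, ← Real.rpow_add hpos]
        ring_nf
    _ ≤ (n : ℝ) ^ (-2 : ℝ) := mul_le_of_le_one_right (by positivity) hn

theorem one_sub_priorEig_div_postEig {τ lam : ℝ} (hτ : τ ≠ 0) (hlam : lam ≠ 0) (α β : ℝ)
    (l : ℕ → ℝ) {j : ℕ} (hj : 0 < j) :
    1 - τ ^ 2 * priorEig α j / postEig τ lam α β l j =
      -(lam⁻¹ * (j : ℝ) ^ (2 * β - 2 * α) * l j ^ 2) := by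
  have hpos : (0 : ℝ) < j := Nat.cast_pos.2 hj
  have h0 : priorEig α j ≠ 0 := (Real.rpow_pos_of_pos hpos _).ne'
  have h1 : noiseEig β j ≠ 0 := (Real.rpow_pos_of_pos hpos _).ne'
  have hratio : (j : ℝ) ^ (2 * β - 2 * α) = priorEig α j / noiseEig β j := by
    rw [priorEig, noiseEig, ← Real.rpow_sub hpos]
    ring_nf
  rw [hratio, postEig, div_div_eq_mul_div]
  field_simp
  ring

/-- Condition (iii) in the proof of Theorem 3.2: the series
`Σ_{j≥1} (1 − τ² c_{0j}/c_j)²` converges, hence the operator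
`T = I − τ² C^{-1/2} C₀ C^{-1/2}` is Hilbert–Schmidt. -/
theorem feldman_hajek_condition_iii
    (s b α β τ lam : ℝ) (hs : 0 < s) (hb : 0 < b)
    (hα : 1 / 2 < α) (hβ : 0 ≤ β) (hτ : 0 < τ) (hlam : 0 < lam)
    (l : ℕ → ℝ) (m M : ℝ) (hm : 0 < m) (hmM : m ≤ M)
    (hl : ∀ j : ℕ, 1 ≤ j →
      m * Real.exp (-s * (j : ℝ) ^ b) ≤ l j ∧ l j ≤ M * Real.exp (-s * (j : ℝ) ^ b)) :
    Summable (fun j : ℕ =>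
      (1 - τ ^ 2 * priorEig α (j + 1) / postEig τ lam α β l (j + 1)) ^ 2) := by
  have hsum := (((summable_rpow_mul_exp_neg_mul_rpow (4 * β - 4 * α)
    (by positivity : 0 < 4 * s) hb).mul_left (lam⁻¹ ^ 2 * M ^ 4)).comp_injective
      (add_left_injective 1))
  refine Summable.of_nonneg_of_le (fun _ => sq_nonneg _) (fun j => ?_) hsum
  rw [one_sub_priorEig_div_postEig hτ.ne' hlam.ne' α β l j.succ_pos]
  simp only [Function.comp_apply]
  obtain ⟨hlow, hupp⟩ := hl (j + 1) j.succ_pos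
  have hpos : (0 : ℝ) < (j + 1 : ℕ) := Nat.cast_pos.2 j.succ_pos
  generalize ((j + 1 : ℕ) : ℝ) = x at *
  have hl0 : 0 ≤ l (j + 1) := (by positivity : 0 ≤ m * Real.exp (-s * x ^ b)).trans hlow
  have hpow : x ^ (4 * β - 4 * α) = (x ^ (2 * β - 2 * α)) ^ 2 := by
    rw [← Real.rpow_mul_natCast hpos.le]
    push_cast
    ring_nf
  have hexp : Real.exp (-(4 * s) * x ^ b) = Real.exp (-s * x ^ b) ^ 4 := by
    rw [← Real.exp_nat_mul]
    push_cast
    ring_nf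
  calc (-(lam⁻¹ * x ^ (2 * β - 2 * α) * l (j + 1) ^ 2)) ^ 2
      = lam⁻¹ ^ 2 * (x ^ (2 * β - 2 * α)) ^ 2 * l (j + 1) ^ 4 := by ring
    _ ≤ lam⁻¹ ^ 2 * (x ^ (2 * β - 2 * α)) ^ 2 * (M * Real.exp (-s * x ^ b)) ^ 4 := by gcongr
    _ = lam⁻¹ ^ 2 * M ^ 4 * (x ^ (4 * β - 4 * α) * Real.exp (-(4 * s) * x ^ b)) := by
      rw [hpow, hexp]
      ring
end

section
/- Suppose 0 < b < 1. Define the noise contribution to the mean integrated squared error N(λ) = λ^{-2} Σ_{j≥1} l_j² j^{2β−4α} (1 + λ^{-1} l_j² j^{2β−2α})^{-2}. Then N(λ) ≲ λ^{-1} (ln λ^{-1/(2s)})^{-(2α+b−1)/b} as λ → 0⁺, i.e. there exist constants M > 0 and λ₀ > 0 such that N(λ) ≤ M λ^{-1} ((1/(2s)) ln(1/λ))^{-(2α+b−1)/b} for all 0 < λ < λ₀. [Part of Theorem 4.1, case b < 1.] -/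
/-- The noise contribution to the MISE:
`N(λ) = λ⁻² Σ_{j≥1} l_j² j^{2β−4α} (1 + λ⁻¹ l_j² j^{2β−2α})⁻²`. -/
noncomputable def noiseMISE (α β : ℝ) (l : ℕ → ℝ) (lam : ℝ) : ℝ :=
  lam⁻¹ ^ 2 * ∑' j : ℕ,
    (l (j + 1)) ^ 2 * ((j : ℝ) + 1) ^ (2 * β - 4 * α) /
      (1 + lam⁻¹ * (l (j + 1)) ^ 2 * ((j : ℝ) + 1) ^ (2 * β - 2 * α)) ^ 2

/-- The model weight `exp(-2 s x ^ b) x ^ γ`. -/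
noncomputable def expWeight (s b γ x : ℝ) : ℝ := Real.exp (-2 * s * x ^ b) * x ^ γ

theorem expWeight_pos (s b γ : ℝ) {x : ℝ} (hx : 0 < x) : 0 < expWeight s b γ x := by
  unfold expWeight; positivity

theorem add_one_rpow_sub_rpow_ge {b x : ℝ} (hb : 0 < b) (hb1 : b < 1) (hx : 1 ≤ x) :
    b / 2 * (x ^ b / x) ≤ (x + 1) ^ b - x ^ b := by
  have hx0 : 0 < x := by linarith
  have bern : (1 + -(1 / (x + 1))) ^ b ≤ 1 + b * -(1 / (x + 1)) := by
    refine rpow_one_add_le_one_add_mul_self ?_ hb.le hb1.le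
    rw [neg_le_neg_iff, div_le_one (by linarith)]
    linarith
  have hfac : x = (x + 1) * (1 + -(1 / (x + 1))) := by field_simp; ring
  have hnn : 0 ≤ 1 + -(1 / (x + 1)) := by
    have : 1 / (x + 1) ≤ 1 := by rw [div_le_one (by linarith)]; linarith
    linarith
  have hpow : x ^ b = (x + 1) ^ b * (1 + -(1 / (x + 1))) ^ b := by
    rw [← Real.mul_rpow (by linarith) hnn, ← hfac]
  have hle : x ^ b ≤ (x + 1) ^ b * (1 + b * -(1 / (x + 1))) := by
    nth_rewrite 1 [hpow]
    gcongr
  have hmono : x ^ b ≤ (x + 1) ^ b := by gcongr; linarith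
  have hdiv : x ^ b / (2 * x) ≤ (x + 1) ^ b / (x + 1) := by
    gcongr; linarith
  calc b / 2 * (x ^ b / x) = b * (x ^ b / (2 * x)) := by field_simp
    _ ≤ b * ((x + 1) ^ b / (x + 1)) := by gcongr
    _ = (x + 1) ^ b - (x + 1) ^ b * (1 + b * -(1 / (x + 1))) := by ring
    _ ≤ _ := by linarith

theorem expWeight_add_one_le {s b γ x : ℝ} (hs : 0 < s) (hb : 0 < b) (hb1 : b < 1)
    (hx : 1 ≤ x) (hγ : 2 * |γ| ≤ s * b * x ^ b) :
    expWeight s b γ (x + 1) ≤ expWeight s b γ x * Real.exp (-(s * b / 2 * (x ^ b / x))) := by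
  have hx0 : 0 < x := by linarith
  unfold expWeight
  rw [Real.rpow_def_of_pos hx0 γ, Real.rpow_def_of_pos (by linarith : 0 < x + 1) γ,
    ← Real.exp_add, ← Real.exp_add, ← Real.exp_add, Real.exp_le_exp]
  have hinc := mul_le_mul_of_nonneg_left (add_one_rpow_sub_rpow_ge hb hb1 hx) hs.le
  have hlog : Real.log (x + 1) - Real.log x ≤ 1 / x := by
    rw [← Real.log_div (by linarith) hx0.ne']
    refine (Real.log_le_sub_one_of_pos (by positivity)).trans_eq ?_
    field_simp; ring
  have hlog0 : 0 ≤ Real.log (x + 1) - Real.log x := by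
    have := Real.log_le_log hx0 (by linarith : x ≤ x + 1)
    linarith
  have hγlog : γ * (Real.log (x + 1) - Real.log x) ≤ s * b / 2 * (x ^ b / x) :=
    calc γ * (Real.log (x + 1) - Real.log x) ≤ |γ| * (1 / x) :=
          mul_le_mul (le_abs_self γ) hlog hlog0 (abs_nonneg γ)
      _ ≤ (s * b * x ^ b / 2) * (1 / x) := by gcongr; linarith
      _ = _ := by ring
  nlinarith

theorem expWeight_mul_le_sub {s b γ x : ℝ} (hs : 0 < s) (hb : 0 < b) (hb1 : b < 1)
    (hx : 1 ≤ x) (hγ : 2 * |γ| ≤ s * b * x ^ b) :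
    expWeight s b γ x * (x ^ b / x) ≤
      (2 / (s * b) + 1) * (expWeight s b γ x - expWeight s b γ (x + 1)) := by
  have hx0 : 0 < x := by linarith
  have hc := expWeight_pos s b γ hx0
  have hle := expWeight_add_one_le hs hb hb1 hx hγ
  set q := x ^ b / x with hq
  have hq0 : 0 < q := by positivity
  have hq1 : q ≤ 1 := by
    rw [hq, div_le_one hx0]
    simpa using Real.rpow_le_rpow_of_exponent_le hx hb1.le
  set z := s * b / 2 * q with hz
  have hz0 : 0 < z := by positivity
  have hexp : Real.exp (-z) * (1 + z) ≤ 1 := by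
    calc Real.exp (-z) * (1 + z) ≤ Real.exp (-z) * Real.exp z := by
          gcongr; linarith [Real.add_one_le_exp z]
      _ = 1 := by rw [← Real.exp_add]; simp
  have hkey : q ≤ (2 / (s * b) + 1) * (1 - Real.exp (-z)) := by
    have h1 : z / (1 + z) ≤ 1 - Real.exp (-z) := by
      rw [div_le_iff₀ (by linarith)]; linarith
    have h2 : q ≤ (2 / (s * b) + 1) * (z / (1 + z)) := by
      rw [← mul_div_assoc, le_div_iff₀ (by linarith)]
      have h3 : (2 / (s * b) + 1) * z = q + z := by rw [hz]; field_simp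
      rw [h3]; nlinarith
    exact h2.trans (by gcongr)
  calc expWeight s b γ x * q
      ≤ expWeight s b γ x * ((2 / (s * b) + 1) * (1 - Real.exp (-z))) := by gcongr
    _ = (2 / (s * b) + 1) * (expWeight s b γ x - expWeight s b γ x * Real.exp (-z)) := by ring
    _ ≤ _ := by gcongr

theorem mul_sub_div_sq_le {t c d : ℝ} (ht : 0 < t) (hd : 0 < d) (hdc : d ≤ c) :
    t * (c - d) / (t + c) ^ 2 ≤ t / (t + d) - t / (t + c) := by
  have hc : 0 < c := by linarith
  calc t * (c - d) / (t + c) ^ 2 ≤ t * (c - d) / ((t + d) * (t + c)) := by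
        have : 0 ≤ c - d := by linarith
        gcongr
        nlinarith
    _ = _ := by field_simp; ring

theorem mul_div_sq_le_of_mem_Icc {t c v A B : ℝ} (ht : 0 < t) (hc : 0 < c) (hA : 0 < A)
    (hAv : A * c ≤ v) (hvB : v ≤ B * c) :
    t * v / (t + v) ^ 2 ≤ B / (min 1 A) ^ 2 * (t * c / (t + c) ^ 2) := by
  set k := min 1 A with hk
  have hk0 : 0 < k := lt_min one_pos hA
  have hkv : k * (t + c) ≤ t + v := by
    have h1 : k * t ≤ 1 * t := by gcongr; exact min_le_left _ _
    have h2 : k * c ≤ A * c := by gcongr; exact min_le_right _ _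
    linarith
  have hBc : 0 < B * c := by nlinarith [mul_pos hA hc]
  calc t * v / (t + v) ^ 2 ≤ t * (B * c) / (k * (t + c)) ^ 2 := by gcongr
    _ = _ := by field_simp

theorem mul_div_add_sq_le_div {t c : ℝ} (ht : 0 < t) (hc : 0 < c) :
    t * c / (t + c) ^ 2 ≤ t / c := by
  rw [div_le_div_iff₀ (by positivity) hc]
  nlinarith [mul_pos ht hc, mul_pos ht ht, mul_pos (mul_pos ht ht) hc, pow_pos ht 3]

/-- Bound on a term of the model series at or above half the critical scale. -/
theorem rpow_mul_le_of_le_rpow {s b α γ x t L : ℝ} (hs : 0 < s) (hb : 0 < b) (hb1 : b < 1)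
    (hα : 1 / 2 < α) (hx : 1 ≤ x) (hγ : 2 * |γ| ≤ s * b * x ^ b) (ht : 0 < t) (hL : 0 < L)
    (hxL : L / 2 ≤ x ^ b) :
    x ^ (-(2 * α)) * (t * expWeight s b γ x / (t + expWeight s b γ x) ^ 2) ≤
      2 ^ ((2 * α + b - 1) / b) * (2 / (s * b) + 1) * L ^ (-(2 * α + b - 1) / b) *
        (t / (t + expWeight s b γ (x + 1)) - t / (t + expWeight s b γ x)) := by
  have hx0 : 0 < x := by linarith
  have hc := expWeight_pos s b γ hx0
  have hd := expWeight_pos s b γ (by linarith : 0 < x + 1)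
  have hsub := expWeight_mul_le_sub hs hb hb1 hx hγ
  have hdc : expWeight s b γ (x + 1) ≤ expWeight s b γ x := by
    have : 0 < (2 / (s * b) + 1) := by positivity
    have h0 : 0 ≤ expWeight s b γ x * (x ^ b / x) := by positivity
    nlinarith
  have htel := mul_sub_div_sq_le ht hd hdc
  set c := expWeight s b γ x
  set d := expWeight s b γ (x + 1)
  have hsplit : x ^ (-(2 * α)) = (x ^ b) ^ (-(2 * α + b - 1) / b) * (x ^ b / x) := by
    rw [← Real.rpow_mul hx0.le, mul_div_cancel₀ _ hb.ne']
    nth_rewrite 4 [← Real.rpow_one x]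
    rw [← Real.rpow_sub hx0, ← Real.rpow_add hx0]
    congr 1; ring
  have hpow : (x ^ b) ^ (-(2 * α + b - 1) / b) ≤
      2 ^ ((2 * α + b - 1) / b) * L ^ (-(2 * α + b - 1) / b) := by
    calc (x ^ b) ^ (-(2 * α + b - 1) / b) ≤ (L / 2) ^ (-(2 * α + b - 1) / b) :=
          Real.rpow_le_rpow_of_nonpos (by positivity) hxL
            (div_nonpos_of_nonpos_of_nonneg (by linarith) hb.le)
      _ = _ := by
          rw [Real.div_rpow hL.le two_pos.le, neg_div, Real.rpow_neg two_pos.le]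
          field_simp
  calc x ^ (-(2 * α)) * (t * c / (t + c) ^ 2)
      = (x ^ b) ^ (-(2 * α + b - 1) / b) * (t * (c * (x ^ b / x)) / (t + c) ^ 2) := by
        rw [hsplit]; ring
    _ ≤ (2 ^ ((2 * α + b - 1) / b) * L ^ (-(2 * α + b - 1) / b)) *
        (t * ((2 / (s * b) + 1) * (c - d)) / (t + c) ^ 2) := by gcongr
    _ = 2 ^ ((2 * α + b - 1) / b) * (2 / (s * b) + 1) * L ^ (-(2 * α + b - 1) / b) *
        (t * (c - d) / (t + c) ^ 2) := by ring
    _ ≤ _ := by gcongr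

/-- Bound on a term of the model series below half the critical scale. -/
theorem rpow_mul_le_of_rpow_le {s b α β x L : ℝ} (hs : 0 < s) (hb : 0 < b)
    (hβ : 0 ≤ β) (hx : 1 ≤ x) (hL : 0 < L) (hxL : x ^ b ≤ L / 2)
    (hexp : Real.exp (-s * L) ≤ L ^ (-(2 * α + b - 1) / b - 2 / b)) :
    x ^ (-(2 * α)) * (Real.exp (-2 * s * L) * expWeight s b (2 * β - 2 * α) x /
        (Real.exp (-2 * s * L) + expWeight s b (2 * β - 2 * α) x) ^ 2) ≤
      L ^ (-(2 * α + b - 1) / b) * (1 / x ^ 2) := by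
  have hx0 : 0 < x := by linarith
  have hc := expWeight_pos s b (2 * β - 2 * α) hx0
  have hx2 : x ^ 2 ≤ L ^ (2 / b) :=
    calc x ^ 2 = (x ^ b) ^ (2 / b) := by
          rw [← Real.rpow_mul hx0.le, mul_div_cancel₀ _ hb.ne']; norm_num
      _ ≤ L ^ (2 / b) := by gcongr; linarith
  calc _ ≤ x ^ (-(2 * α)) * (Real.exp (-2 * s * L) / expWeight s b (2 * β - 2 * α) x) := by
        refine mul_le_mul_of_nonneg_left ?_ (by positivity)
        exact mul_div_add_sq_le_div (Real.exp_pos _) hc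
    _ = Real.exp (-2 * s * L + 2 * s * x ^ b) * x ^ (-(2 * β)) := by
        have : x ^ (-(2 * β)) = x ^ (-(2 * α)) / x ^ (2 * β - 2 * α) := by
          rw [← Real.rpow_sub hx0]; congr 1; ring
        rw [this, expWeight, Real.exp_add,
          show -2 * s * x ^ b = -(2 * s * x ^ b) by ring, Real.exp_neg]
        field_simp
    _ ≤ Real.exp (-s * L) * 1 := by
        gcongr
        · nlinarith
        · exact Real.rpow_le_one_of_one_le_of_nonpos hx (by linarith)
    _ ≤ L ^ (-(2 * α + b - 1) / b) / L ^ (2 / b) := by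
        rwa [mul_one, ← Real.rpow_sub hL]
    _ ≤ L ^ (-(2 * α + b - 1) / b) / x ^ 2 := by gcongr
    _ = _ := by ring

/-- Part of Theorem 4.1 (case `0 < b < 1`):
`N(λ) ≲ λ⁻¹ (ln λ^{-1/(2s)})^{-(2α+b−1)/b}` as `λ → 0⁺`. -/
theorem noise_MISE_rate_b_lt_one
    (s b α β : ℝ) (hs : 0 < s) (hb : 0 < b) (hb1 : b < 1)
    (hα : 1 / 2 < α) (hβ : 0 ≤ β)
    (l : ℕ → ℝ) (m M : ℝ) (hm : 0 < m) (hmM : m ≤ M)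
    (hl : ∀ j : ℕ, 1 ≤ j →
      m * Real.exp (-s * (j : ℝ) ^ b) ≤ l j ∧ l j ≤ M * Real.exp (-s * (j : ℝ) ^ b)) :
    ∃ M' lam₀ : ℝ, 0 < M' ∧ 0 < lam₀ ∧
      ∀ lam : ℝ, 0 < lam → lam < lam₀ →
        noiseMISE α β l lam
          ≤ M' * lam⁻¹ * ((1 / (2 * s)) * Real.log (1 / lam)) ^ (-(2 * α + b - 1) / b) := by
  -- beyond `j₀` the weight is decreasing at the rate used for telescoping
  obtain ⟨j₀, hj₀⟩ : ∃ j₀ : ℕ, ∀ n : ℕ, j₀ ≤ n →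
      2 * |2 * β - 2 * α| ≤ s * b * (n : ℝ) ^ b := by
    have h : Filter.Tendsto (fun n : ℕ => s * b * (n : ℝ) ^ b) Filter.atTop Filter.atTop :=
      ((tendsto_rpow_atTop hb).comp tendsto_natCast_atTop_atTop).const_mul_atTop (mul_pos hs hb)
    exact Filter.eventually_atTop.1 (h.eventually_ge_atTop _)
  obtain ⟨L₀, hL₀⟩ : ∃ L₀ : ℝ, ∀ L : ℝ, L₀ ≤ L →
      Real.exp (-s * L) ≤ L ^ (-(2 * α + b - 1) / b - 2 / b) := by
    have h := (isLittleO_exp_neg_mul_rpow_atTop hs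
      (-(2 * α + b - 1) / b - 2 / b)).bound one_pos
    refine Filter.eventually_atTop.1 ?_
    filter_upwards [h, Filter.eventually_gt_atTop 0] with L hL hLpos
    rwa [one_mul, Real.norm_of_nonneg (Real.exp_pos _).le,
      Real.norm_of_nonneg (Real.rpow_nonneg hLpos.le _)] at hL
  set L₁ : ℝ := max 1 (max L₀ (2 * (j₀ : ℝ) ^ b)) with hL₁
  set C : ℝ := 2 ^ ((2 * α + b - 1) / b) * (2 / (s * b) + 1) + 1 with hC
  set K : ℝ := M ^ 2 / (min 1 (m ^ 2)) ^ 2 with hK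
  set S : ℝ := ∑' j : ℕ, 1 / ((j : ℝ) + 1) ^ 2 with hS
  have hM : 0 < M := by linarith
  have hK0 : 0 < K := by
    have : 0 < min 1 (m ^ 2) := lt_min one_pos (by positivity)
    positivity
  have hC0 : 0 < C := by positivity
  have hS0 : 0 ≤ S := tsum_nonneg fun j => by positivity
  refine ⟨K * C * (S + 1), Real.exp (-2 * s * L₁), by positivity, Real.exp_pos _, ?_⟩
  intro lam hlam hlt
  set L : ℝ := 1 / (2 * s) * Real.log (1 / lam) with hL
  have hlamL : lam = Real.exp (-2 * s * L) := by
    have : -2 * s * L = Real.log lam := by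
      rw [hL, one_div lam, Real.log_inv]; field_simp
    rw [this, Real.exp_log hlam]
  have hLL : L₁ ≤ L := by
    rw [hlamL, Real.exp_lt_exp] at hlt
    nlinarith
  have hL1 : 1 ≤ L := (le_max_left _ _).trans hLL
  have hLpos : 0 < L := by linarith
  have hLexp := hL₀ L (((le_max_left _ _).trans (le_max_right _ _)).trans hLL)
  have hLj : (j₀ : ℝ) ^ b ≤ L / 2 := by
    have := ((le_max_right _ _).trans (le_max_right _ _)).trans hLL
    linarith
  set c : ℝ → ℝ := expWeight s b (2 * β - 2 * α) with hc
  have hcpos : ∀ {x : ℝ}, 0 < x → 0 < c x := fun hx => expWeight_pos _ _ _ hx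
  set T : ℕ → ℝ := fun j => lam / (lam + c ((max j j₀ : ℕ) + 1)) with hT
  have hTnonneg : ∀ j, 0 ≤ T j := fun j => by
    have := hcpos (by positivity : (0 : ℝ) < (max j j₀ : ℕ) + 1)
    positivity
  have hTle : ∀ j, T j ≤ 1 := fun j => by
    have := hcpos (by positivity : (0 : ℝ) < (max j j₀ : ℕ) + 1)
    simp only [hT]
    rw [div_le_one (by positivity)]
    linarith
  have hTmono : ∀ j, T j ≤ T (j + 1) := fun j => by
    rcases lt_or_ge j j₀ with h | h
    · simp only [hT, max_eq_right h.le, max_eq_right (Nat.succ_le_of_lt h), le_refl]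
    · simp only [hT, max_eq_left h, max_eq_left (h.trans (Nat.le_succ j))]
      push_cast
      have hx : (1 : ℝ) ≤ (j : ℝ) + 1 := by linarith [Nat.cast_nonneg (α := ℝ) j]
      have hγ := hj₀ (j + 1) (by omega)
      push_cast at hγ
      have hle := expWeight_add_one_le hs hb hb1 hx hγ
      have hd := hcpos (by positivity : (0 : ℝ) < (j : ℝ) + 1 + 1)
      have hle' : c ((j : ℝ) + 1 + 1) ≤ c ((j : ℝ) + 1) := by
        refine hle.trans (mul_le_of_le_one_right (hcpos (by positivity)).le ?_)
        rw [Real.exp_le_one_iff, neg_nonpos]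
        positivity
      gcongr
  have hmodel : ∀ j : ℕ, ((j : ℝ) + 1) ^ (-(2 * α)) *
      (lam * c ((j : ℝ) + 1) / (lam + c ((j : ℝ) + 1)) ^ 2) ≤
      C * L ^ (-(2 * α + b - 1) / b) * (1 / ((j : ℝ) + 1) ^ 2 + (T (j + 1) - T j)) := by
    intro j
    have hx : (1 : ℝ) ≤ (j : ℝ) + 1 := by linarith [Nat.cast_nonneg (α := ℝ) j]
    have hdiff : 0 ≤ T (j + 1) - T j := by linarith [hTmono j]
    have hR : 0 < L ^ (-(2 * α + b - 1) / b) := by positivity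
    rcases le_or_gt (((j : ℝ) + 1) ^ b) (L / 2) with h | h
    · have := rpow_mul_le_of_rpow_le (α := α) hs hb hβ hx hLpos h hLexp
      rw [← hlamL] at this
      refine this.trans ?_
      have hC1 : 1 ≤ C := by rw [hC]; linarith [show (0 : ℝ) ≤
        2 ^ ((2 * α + b - 1) / b) * (2 / (s * b) + 1) by positivity]
      refine mul_le_mul (le_mul_of_one_le_left hR.le hC1) (by linarith) (by positivity)
        (by positivity)
    · have hj : j₀ ≤ j := by
        by_contra hcon
        have : ((j : ℝ) + 1) ^ b ≤ (j₀ : ℝ) ^ b := by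
          gcongr
          exact_mod_cast Nat.lt_of_not_le hcon
        linarith
      have hγ := hj₀ (j + 1) (by omega)
      push_cast at hγ
      refine (rpow_mul_le_of_le_rpow hs hb hb1 hα hx hγ hlam hLpos h.le).trans ?_
      have hTeq : T (j + 1) - T j =
          lam / (lam + c ((j : ℝ) + 1 + 1)) - lam / (lam + c ((j : ℝ) + 1)) := by
        simp only [hT, max_eq_left hj, max_eq_left (hj.trans (Nat.le_succ j))]
        push_cast
        rfl
      rw [← hTeq]
      gcongr
      · rw [hC]; linarith
      · linarith [show (0 : ℝ) ≤ 1 / ((j : ℝ) + 1) ^ 2 by positivity]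
  have hterm : ∀ j : ℕ, (l (j + 1)) ^ 2 * ((j : ℝ) + 1) ^ (2 * β - 4 * α) /
      (1 + lam⁻¹ * (l (j + 1)) ^ 2 * ((j : ℝ) + 1) ^ (2 * β - 2 * α)) ^ 2 ≤
      lam * K * (C * L ^ (-(2 * α + b - 1) / b) *
        (1 / ((j : ℝ) + 1) ^ 2 + (T (j + 1) - T j))) := by
    intro j
    obtain ⟨hlow, hupp⟩ := hl (j + 1) (by omega)
    push_cast at hlow hupp
    have hx0 : (0 : ℝ) < (j : ℝ) + 1 := by positivity
    set x : ℝ := (j : ℝ) + 1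
    have hlpos : 0 < l (j + 1) := lt_of_lt_of_le (by positivity) hlow
    have hsq : Real.exp (-2 * s * x ^ b) = Real.exp (-s * x ^ b) ^ 2 := by
      rw [← Real.exp_nat_mul]; congr 1; push_cast; ring
    have hv1 : m ^ 2 * c x ≤ l (j + 1) ^ 2 * x ^ (2 * β - 2 * α) := by
      rw [hc, expWeight, hsq, ← mul_assoc, ← mul_pow]
      gcongr
    have hv2 : l (j + 1) ^ 2 * x ^ (2 * β - 2 * α) ≤ M ^ 2 * c x := by
      rw [hc, expWeight, hsq, ← mul_assoc, ← mul_pow]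
      gcongr
    have hcmp := mul_div_sq_le_of_mem_Icc hlam (hcpos hx0) (by positivity) hv1 hv2
    have hpow : x ^ (2 * β - 4 * α) = x ^ (-(2 * α)) * x ^ (2 * β - 2 * α) := by
      rw [← Real.rpow_add hx0]; congr 1; ring
    rw [hpow]
    have hvpos : 0 < l (j + 1) ^ 2 * x ^ (2 * β - 2 * α) := by positivity
    calc _ = lam * (x ^ (-(2 * α)) * (lam * (l (j + 1) ^ 2 * x ^ (2 * β - 2 * α)) /
            (lam + l (j + 1) ^ 2 * x ^ (2 * β - 2 * α)) ^ 2)) := by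
          rw [mul_assoc lam⁻¹, mul_left_comm]
          generalize l (j + 1) ^ 2 * x ^ (2 * β - 2 * α) = v at hvpos ⊢
          field_simp
      _ ≤ lam * (x ^ (-(2 * α)) * (K * (lam * c x / (lam + c x) ^ 2))) := by gcongr
      _ = lam * K * (x ^ (-(2 * α)) * (lam * c x / (lam + c x) ^ 2)) := by ring
      _ ≤ _ := mul_le_mul_of_nonneg_left (hmodel j) (by positivity)
  have hsummable : Summable fun j : ℕ => 1 / ((j : ℝ) + 1) ^ 2 := by
    simpa using (summable_nat_add_iff 1).2 (Real.summable_one_div_nat_pow.2 one_lt_two)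
  have htsum : ∑' j : ℕ, (l (j + 1)) ^ 2 * ((j : ℝ) + 1) ^ (2 * β - 4 * α) /
      (1 + lam⁻¹ * (l (j + 1)) ^ 2 * ((j : ℝ) + 1) ^ (2 * β - 2 * α)) ^ 2 ≤
      lam * K * (C * L ^ (-(2 * α + b - 1) / b) * (S + 1)) := by
    refine Real.tsum_le_of_sum_range_le (fun j => by positivity) fun n => ?_
    refine (Finset.sum_le_sum fun j _ => hterm j).trans ?_
    rw [← Finset.mul_sum, ← Finset.mul_sum, Finset.sum_add_distrib, Finset.sum_range_sub]
    have h1 : ∑ j ∈ Finset.range n, 1 / ((j : ℝ) + 1) ^ 2 ≤ S :=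
      hsummable.sum_le_tsum _ fun j _ => by positivity
    have h2 : T n - T 0 ≤ 1 := by linarith [hTle n, hTnonneg 0]
    gcongr
  unfold noiseMISE
  calc _ ≤ lam⁻¹ ^ 2 * (lam * K * (C * L ^ (-(2 * α + b - 1) / b) * (S + 1))) := by gcongr
    _ = _ := by field_simp
end

section
/- Let γ > 0 and let u† ∈ H^γ. Define the bias contribution to the mean integrated squared error B(λ) = Σ_{j≥1} (u†_j)² (1 + λ^{-1} l_j² j^{2β−2α})^{-2}. Then B(λ) ≲ (ln λ^{-1/(2s)})^{-2γ/b} as λ → 0⁺, i.e. there exist constants M > 0 (depending on s, b, α, β, γ, ‖u†‖_γ and the comparability constants of (l_j)) and λ₀ > 0 such that B(λ) ≤ M ((1/(2s)) ln(1/λ))^{-2γ/b} for all 0 < λ < λ₀. [Part of Theorem 4.1.] -/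
/-- The bias contribution to the MISE:
`B(λ) = Σ_{j≥1} (u†_j)² (1 + λ⁻¹ l_j² j^{2β−2α})⁻²`. -/
noncomputable def biasMISE (α β : ℝ) (l u : ℕ → ℝ) (lam : ℝ) : ℝ :=
  ∑' j : ℕ,
    (u (j + 1)) ^ 2 /
      (1 + lam⁻¹ * (l (j + 1)) ^ 2 * ((j : ℝ) + 1) ^ (2 * β - 2 * α)) ^ 2

open Filter in
/-- An exponential eventually dominates every power, with a positive threshold. -/
theorem exists_pos_forall_rpow_le_exp (p s : ℝ) (hs : 0 < s) :
    ∃ L₀ : ℝ, 0 < L₀ ∧ ∀ L : ℝ, L₀ ≤ L → L ^ p ≤ Real.exp (s * L) := by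
  have h := tendsto_rpow_mul_exp_neg_mul_atTop_nhds_zero p s hs
  obtain ⟨a, ha⟩ := eventually_atTop.1 (h.eventually (ge_mem_nhds zero_lt_one))
  refine ⟨max a 1, by positivity, fun L hL => ?_⟩
  have h1 := ha L ((le_max_left a 1).trans hL)
  rwa [neg_mul, Real.exp_neg, ← div_eq_mul_inv, div_le_one (Real.exp_pos _)] at h1

/-- Below the cutoff `x ^ b < L / 2`, the filter denominator is at least of order
`L ^ (2γ/b)`. -/
theorem rpow_le_filter_of_lt_cutoff
    {s b α β γ m lx x lam L : ℝ} (hs : 0 < s) (hb : 0 < b) (hα : 0 < α)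
    (hβ : 0 ≤ β) (hm : 0 < m) (hx : 1 ≤ x) (hlx : m * Real.exp (-s * x ^ b) ≤ lx)
    (hlam : lam⁻¹ = Real.exp (2 * s * L)) (hL : 0 < L)
    (hexp : L ^ ((2 * α + 2 * γ) / b) ≤ Real.exp (s * L)) (hxL : x ^ b < L / 2) :
    m ^ 2 * L ^ (2 * γ / b) ≤ lam⁻¹ * lx ^ 2 * x ^ (2 * β - 2 * α) := by
  have hx0 : 0 < x := by linarith
  have hsq : m ^ 2 * Real.exp (-(s * L)) ≤ lx ^ 2 := by
    calc m ^ 2 * Real.exp (-(s * L)) ≤ m ^ 2 * Real.exp (2 * (-s * x ^ b)) := by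
          gcongr
          nlinarith
      _ = (m * Real.exp (-s * x ^ b)) ^ 2 := by
          rw [mul_pow, ← Real.exp_nat_mul]
          norm_num
      _ ≤ lx ^ 2 := by gcongr
  have hxα : L ^ (-(2 * α / b)) ≤ x ^ (2 * β - 2 * α) := by
    have h1 : x ^ (2 * α) ≤ L ^ (2 * α / b) := by
      calc x ^ (2 * α) = (x ^ b) ^ (2 * α / b) := by
            rw [← Real.rpow_mul hx0.le]
            congr 1
            field_simp
        _ ≤ L ^ (2 * α / b) := by
            gcongr
            linarith
    calc L ^ (-(2 * α / b)) = (L ^ (2 * α / b))⁻¹ := Real.rpow_neg hL.le _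
      _ ≤ (x ^ (2 * α))⁻¹ := by gcongr
      _ = x ^ (-(2 * α)) := (Real.rpow_neg hx0.le _).symm
      _ ≤ x ^ (2 * β - 2 * α) := Real.rpow_le_rpow_of_exponent_le hx (by linarith)
  calc m ^ 2 * L ^ (2 * γ / b)
      = m ^ 2 * (L ^ ((2 * α + 2 * γ) / b) * L ^ (-(2 * α / b))) := by
        rw [← Real.rpow_add hL]
        congr 2
        ring
    _ ≤ m ^ 2 * (Real.exp (s * L) * L ^ (-(2 * α / b))) := by gcongr
    _ = Real.exp (2 * s * L) * (m ^ 2 * Real.exp (-(s * L))) * L ^ (-(2 * α / b)) := by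
        have : Real.exp (s * L) = Real.exp (2 * s * L) * Real.exp (-(s * L)) := by
          rw [← Real.exp_add]
          congr 1
          ring
        rw [this]
        ring
    _ ≤ lam⁻¹ * lx ^ 2 * x ^ (2 * β - 2 * α) := by
        rw [hlam]
        gcongr

/-- Uniform bound for the squared filter factor in terms of `L = ln λ^{-1/(2s)}`. -/
theorem inv_filter_sq_le
    {s b α β γ m lx x lam L : ℝ} (hs : 0 < s) (hb : 0 < b) (hα : 0 < α)
    (hβ : 0 ≤ β) (hγ : 0 < γ) (hm : 0 < m) (hx : 1 ≤ x)
    (hlx : m * Real.exp (-s * x ^ b) ≤ lx)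
    (hlam : lam⁻¹ = Real.exp (2 * s * L)) (hL : 0 < L)
    (hexp : L ^ ((2 * α + 2 * γ) / b) ≤ Real.exp (s * L)) :
    ((1 + lam⁻¹ * lx ^ 2 * x ^ (2 * β - 2 * α)) ^ 2)⁻¹ ≤
      (2 ^ (2 * γ / b) + (m ^ 2)⁻¹) * L ^ (-(2 * γ) / b) * x ^ (2 * γ) := by
  have hx0 : 0 < x := by linarith
  set A := lam⁻¹ * lx ^ 2 * x ^ (2 * β - 2 * α) with hA
  have hA0 : 0 ≤ A := by
    have : 0 ≤ lam⁻¹ := hlam ▸ (Real.exp_pos _).le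
    positivity
  have hLneg : L ^ (-(2 * γ) / b) = (L ^ (2 * γ / b))⁻¹ := by
    rw [neg_div, Real.rpow_neg hL.le]
  have hLpos : 0 < L ^ (2 * γ / b) := by positivity
  rw [hLneg]
  rcases lt_or_ge (x ^ b) (L / 2) with hxL | hxL
  · have h := rpow_le_filter_of_lt_cutoff hs hb hα hβ hm hx hlx hlam hL hexp hxL
    rw [← hA] at h
    calc ((1 + A) ^ 2)⁻¹ ≤ (m ^ 2 * L ^ (2 * γ / b))⁻¹ := by
          gcongr
          nlinarith
      _ = (0 + (m ^ 2)⁻¹) * (L ^ (2 * γ / b))⁻¹ * 1 := by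
          rw [mul_inv]
          ring
      _ ≤ (2 ^ (2 * γ / b) + (m ^ 2)⁻¹) * (L ^ (2 * γ / b))⁻¹ * x ^ (2 * γ) := by
          gcongr
          · positivity
          · exact Real.one_le_rpow hx (by positivity)
  · have h1 : L ^ (2 * γ / b) ≤ 2 ^ (2 * γ / b) * x ^ (2 * γ) := by
      calc L ^ (2 * γ / b) ≤ (2 * x ^ b) ^ (2 * γ / b) := by
            gcongr
            linarith
        _ = 2 ^ (2 * γ / b) * x ^ (2 * γ) := by
            rw [Real.mul_rpow (by norm_num) (by positivity), ← Real.rpow_mul hx0.le]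
            congr 2
            field_simp
    calc ((1 + A) ^ 2)⁻¹ ≤ 1 := inv_le_one_of_one_le₀ (by nlinarith)
      _ = L ^ (2 * γ / b) * (L ^ (2 * γ / b))⁻¹ := (mul_inv_cancel₀ hLpos.ne').symm
      _ ≤ 2 ^ (2 * γ / b) * x ^ (2 * γ) * (L ^ (2 * γ / b))⁻¹ := by gcongr
      _ = (2 ^ (2 * γ / b) + 0) * (L ^ (2 * γ / b))⁻¹ * x ^ (2 * γ) := by ring
      _ ≤ (2 ^ (2 * γ / b) + (m ^ 2)⁻¹) * (L ^ (2 * γ / b))⁻¹ * x ^ (2 * γ) := by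
          gcongr
          positivity

/-- Part of Theorem 4.1: if `u† ∈ H^γ` with `γ > 0`, then
`B(λ) ≲ (ln λ^{-1/(2s)})^{-2γ/b}` as `λ → 0⁺`. -/
theorem bias_MISE_rate
    (s b α β γ : ℝ) (hs : 0 < s) (hb : 0 < b)
    (hα : 1 / 2 < α) (hβ : 0 ≤ β) (hγ : 0 < γ)
    (l : ℕ → ℝ) (m M : ℝ) (hm : 0 < m) (hmM : m ≤ M)
    (hl : ∀ j : ℕ, 1 ≤ j →
      m * Real.exp (-s * (j : ℝ) ^ b) ≤ l j ∧ l j ≤ M * Real.exp (-s * (j : ℝ) ^ b))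
    (u : ℕ → ℝ)
    (hu : Summable (fun j : ℕ => ((j : ℝ) + 1) ^ (2 * γ) * (u (j + 1)) ^ 2)) :
    ∃ M' lam₀ : ℝ, 0 < M' ∧ 0 < lam₀ ∧
      ∀ lam : ℝ, 0 < lam → lam < lam₀ →
        biasMISE α β l u lam
          ≤ M' * ((1 / (2 * s)) * Real.log (1 / lam)) ^ (-(2 * γ) / b) := by
  obtain ⟨L₀, hL₀, hexp⟩ := exists_pos_forall_rpow_le_exp ((2 * α + 2 * γ) / b) s hs
  set S := ∑' j : ℕ, ((j : ℝ) + 1) ^ (2 * γ) * (u (j + 1)) ^ 2 with hS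
  have hS0 : 0 ≤ S := tsum_nonneg fun j => by positivity
  set K : ℝ := 2 ^ (2 * γ / b) + (m ^ 2)⁻¹ with hK
  have hK0 : 0 < K := by positivity
  refine ⟨K * (S + 1), Real.exp (-(2 * s * L₀)), by positivity, Real.exp_pos _,
    fun lam hlam hlt => ?_⟩
  set L := 1 / (2 * s) * Real.log (1 / lam) with hLdef
  have hlog : Real.log (1 / lam) = 2 * s * L := by
    rw [hLdef]
    field_simp
  have hinv : lam⁻¹ = Real.exp (2 * s * L) := by
    rw [← hlog, Real.exp_log (by positivity), one_div]
  have hLL : L₀ ≤ L := by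
    have h1 : Real.log lam < -(2 * s * L₀) := (Real.log_lt_iff_lt_exp hlam).2 hlt
    rw [one_div, Real.log_inv] at hlog
    nlinarith
  have hL : 0 < L := hL₀.trans_le hLL
  have hterm : ∀ j : ℕ, (u (j + 1)) ^ 2 /
      (1 + lam⁻¹ * (l (j + 1)) ^ 2 * ((j : ℝ) + 1) ^ (2 * β - 2 * α)) ^ 2 ≤
      K * L ^ (-(2 * γ) / b) * (((j : ℝ) + 1) ^ (2 * γ) * (u (j + 1)) ^ 2) := by
    intro j
    have hlj := (hl (j + 1) (by omega)).1
    push_cast at hlj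
    have h := inv_filter_sq_le hs hb (by linarith) hβ hγ hm
      (le_add_of_nonneg_left (Nat.cast_nonneg j)) hlj hinv hL (hexp L hLL)
    calc _ ≤ (u (j + 1)) ^ 2 * (K * L ^ (-(2 * γ) / b) * ((j : ℝ) + 1) ^ (2 * γ)) := by
          rw [div_eq_mul_inv]
          exact mul_le_mul_of_nonneg_left h (sq_nonneg _)
      _ = _ := by ring
  have hsum := hu.mul_left (K * L ^ (-(2 * γ) / b))
  calc biasMISE α β l u lam
      ≤ ∑' j : ℕ, K * L ^ (-(2 * γ) / b) * (((j : ℝ) + 1) ^ (2 * γ) * (u (j + 1)) ^ 2) :=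
        (Summable.of_nonneg_of_le (fun j => by positivity) hterm hsum).tsum_le_tsum hterm hsum
    _ = K * S * L ^ (-(2 * γ) / b) := by
        rw [tsum_mul_left, ← hS]
        ring
    _ ≤ K * (S + 1) * L ^ (-(2 * γ) / b) := by
        gcongr
        linarith
end

section
/- Let γ > 0 and u† ∈ H^γ, and for n > 0, λ > 0 define MISE(n,λ) = (nλ²)^{-1} Σ_{j≥1} l_j² j^{2β−4α} (1 + λ^{-1} l_j² j^{2β−2α})^{-2} + Σ_{j≥1} (u†_j)² (1 + λ^{-1} l_j² j^{2β−2α})^{-2}. Set κ = 2α/b if b ≥ 1 and κ = (2α+b−1)/b if 0 < b < 1. Then there exist constants M > 0 and λ₀ > 0 such that for all n > 0 and all 0 < λ < λ₀, MISE(n,λ) ≤ M [ (nλ)^{-1} ((1/(2s)) ln(1/λ))^{-κ} + ((1/(2s)) ln(1/λ))^{-2γ/b} ]. [Theorem 4.1: bound on the mean integrated squared error of the posterior mean.] -/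
/-- The mean integrated squared error of the posterior mean:
`MISE(n,λ) = (nλ²)⁻¹ Σ_{j≥1} l_j² j^{2β−4α} (1 + λ⁻¹ l_j² j^{2β−2α})⁻²
  + Σ_{j≥1} (u†_j)² (1 + λ⁻¹ l_j² j^{2β−2α})⁻²`. -/
noncomputable def MISE (α β : ℝ) (l u : ℕ → ℝ) (n lam : ℝ) : ℝ :=
  (n * lam ^ 2)⁻¹ * ∑' j : ℕ,
    (l (j + 1)) ^ 2 * ((j : ℝ) + 1) ^ (2 * β - 4 * α) /
      (1 + lam⁻¹ * (l (j + 1)) ^ 2 * ((j : ℝ) + 1) ^ (2 * β - 2 * α)) ^ 2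
  + ∑' j : ℕ,
    (u (j + 1)) ^ 2 /
      (1 + lam⁻¹ * (l (j + 1)) ^ 2 * ((j : ℝ) + 1) ^ (2 * β - 2 * α)) ^ 2

/-- The ratio of the squared singular value to the noise-to-prior level, for an exactly exponential
singular value decay and `λ = exp (-2 s J ^ b)`. -/
noncomputable def decayRatio (s b a J t : ℝ) : ℝ :=
  Real.exp (2 * s * (J ^ b - t ^ b)) * t ^ a

lemma decayRatio_pos {s b a J t : ℝ} (ht : 0 < t) : 0 < decayRatio s b a J t := by
  unfold decayRatio; positivity

lemma exists_rpow_mul_exp_neg_le (q : ℝ) {b c : ℝ} (hb : 0 < b) (hc : 0 < c) :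
    ∃ K : ℝ, 0 < K ∧ ∀ t : ℝ, 1 ≤ t → t ^ q * Real.exp (-(c * t ^ b)) ≤ K := by
  obtain ⟨N, hN⟩ := exists_nat_ge (q / b)
  refine ⟨N.factorial / c ^ N, by positivity, fun t ht => ?_⟩
  have ht0 : 0 < t := by linarith
  have h1 : t ^ q ≤ (t ^ b) ^ N := by
    rw [← Real.rpow_natCast, ← Real.rpow_mul ht0.le]
    apply Real.rpow_le_rpow_of_exponent_le ht
    rw [div_le_iff₀ hb] at hN
    linarith
  have h2 := Real.pow_div_factorial_le_exp (c * t ^ b) (by positivity) N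
  rw [mul_pow, div_le_iff₀ (by positivity)] at h2
  rw [Real.exp_neg, ← div_eq_mul_inv, div_le_div_iff₀ (Real.exp_pos _) (by positivity)]
  nlinarith [pow_pos hc N]

lemma exists_rpow_mul_exp_neg_le_rpow (q p : ℝ) {b c : ℝ} (hb : 0 < b) (hc : 0 < c) :
    ∃ K : ℝ, 0 < K ∧ ∀ t : ℝ, 1 ≤ t → t ^ q * Real.exp (-(c * t ^ b)) ≤ K * t ^ (-p) := by
  obtain ⟨K, hK, h⟩ := exists_rpow_mul_exp_neg_le (q + p) hb hc
  refine ⟨K, hK, fun t ht => ?_⟩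
  have ht0 : 0 < t := by linarith
  have h1 := mul_le_mul_of_nonneg_right (h t ht) (Real.rpow_nonneg ht0.le (-p))
  refine le_trans (le_of_eq ?_) h1
  rw [mul_right_comm, ← Real.rpow_add ht0]
  congr 2; ring

lemma two_rpow_mul_le_rpow {b x y : ℝ} (hb : 0 < b) (hx : 0 ≤ x) (h : 2 * x ≤ y) :
    2 ^ b * x ^ b ≤ y ^ b := by
  rw [← Real.mul_rpow (by norm_num) hx]
  exact Real.rpow_le_rpow (by positivity) h hb.le

lemma one_lt_two_rpow {b : ℝ} (hb : 0 < b) : (1 : ℝ) < 2 ^ b :=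
  Real.one_lt_rpow (by norm_num) hb

lemma exists_inv_decayRatio_le {s b : ℝ} (a p : ℝ) (hs : 0 < s) (hb : 0 < b) :
    ∃ K : ℝ, 0 < K ∧ ∀ J t : ℝ, 1 ≤ t → 2 * t ≤ J →
      (decayRatio s b a J t)⁻¹ ≤ K * J ^ (-p) := by
  have h2b := one_lt_two_rpow hb
  have hc : 0 < 2 * s * (1 - (2 ^ b)⁻¹) := by
    have := inv_lt_one_of_one_lt₀ h2b
    have : 0 < 1 - ((2 : ℝ) ^ b)⁻¹ := by linarith
    positivity
  obtain ⟨K, hK, h⟩ := exists_rpow_mul_exp_neg_le_rpow |a| p hb hc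
  refine ⟨K, hK, fun J t ht hJ => le_trans ?_ (h J (by linarith))⟩
  have ht0 : 0 < t := by linarith
  unfold decayRatio
  rw [mul_inv, ← Real.exp_neg, ← Real.rpow_neg ht0.le, mul_comm]
  have h3 := two_rpow_mul_le_rpow hb ht0.le hJ
  have h4 : t ^ b ≤ (2 ^ b)⁻¹ * J ^ b := by
    rw [inv_mul_eq_div, le_div_iff₀ (by positivity)]; linarith
  refine mul_le_mul ?_ (Real.exp_le_exp.2 ?_) (Real.exp_pos _).le
    (Real.rpow_nonneg (by linarith) _)
  · calc t ^ (-a) ≤ t ^ |a| := Real.rpow_le_rpow_of_exponent_le ht (neg_le_abs a)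
      _ ≤ J ^ |a| := Real.rpow_le_rpow ht0.le (by linarith) (abs_nonneg a)
  · nlinarith

lemma exists_decayRatio_le {s b : ℝ} (a p : ℝ) (hs : 0 < s) (hb : 0 < b) :
    ∃ K : ℝ, 0 < K ∧ ∀ J t : ℝ, 1 ≤ J → 2 * J ≤ t →
      decayRatio s b a J t ≤ K * t ^ (-p) := by
  have h2b := one_lt_two_rpow hb
  have hc : 0 < 2 * s * (1 - (2 ^ b)⁻¹) := by
    have := inv_lt_one_of_one_lt₀ h2b
    have : 0 < 1 - ((2 : ℝ) ^ b)⁻¹ := by linarith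
    positivity
  obtain ⟨K, hK, h⟩ := exists_rpow_mul_exp_neg_le_rpow a p hb hc
  refine ⟨K, hK, fun J t hJ ht => le_trans ?_ (h t (by linarith))⟩
  have ht0 : 0 < t := by linarith
  unfold decayRatio
  rw [mul_comm]
  have h3 := two_rpow_mul_le_rpow hb (by linarith) ht
  have h4 : J ^ b ≤ (2 ^ b)⁻¹ * t ^ b := by
    rw [inv_mul_eq_div, le_div_iff₀ (by positivity)]; linarith
  gcongr
  nlinarith

lemma sum_exp_neg_mul_abs_sub_le {δ : ℝ} (hδ : 0 < δ) (S : Finset ℕ) (i : ℕ) :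
    ∑ j ∈ S, Real.exp (-(δ * |(j : ℝ) - i|)) ≤ 2 * (1 + 1 / δ) := by
  have hr0 : 0 ≤ Real.exp (-δ) := (Real.exp_pos _).le
  have hr1 : Real.exp (-δ) < 1 := Real.exp_lt_one_iff.2 (by linarith)
  have hgeom : (1 - Real.exp (-δ))⁻¹ ≤ 1 + 1 / δ := by
    have h1 : Real.exp (-δ) * (1 + δ) ≤ 1 := by
      rw [Real.exp_neg, inv_mul_le_iff₀ (Real.exp_pos _)]
      linarith [Real.add_one_le_exp δ]
    rw [inv_le_comm₀ (by linarith) (by positivity)]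
    have : (1 + 1 / δ)⁻¹ = δ / (1 + δ) := by field_simp; ring
    rw [this, div_le_iff₀ (by positivity)]
    nlinarith
  have hsum := summable_geometric_of_lt_one hr0 hr1
  have key : ∀ (T : Finset ℕ) (e : ℕ → ℕ), Set.InjOn e T →
      (∀ j ∈ T, |(j : ℝ) - i| = e j) →
      ∑ j ∈ T, Real.exp (-(δ * |(j : ℝ) - i|)) ≤ 1 + 1 / δ := by
    intro T e he hT
    calc ∑ j ∈ T, Real.exp (-(δ * |(j : ℝ) - i|)) = ∑ j ∈ T, Real.exp (-δ) ^ e j := by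
          refine Finset.sum_congr rfl fun j hj => ?_
          rw [hT j hj, ← Real.exp_nat_mul]; congr 1; ring
      _ = ∑ k ∈ T.image e, Real.exp (-δ) ^ k := (Finset.sum_image he).symm
      _ ≤ ∑' k, Real.exp (-δ) ^ k := hsum.sum_le_tsum _ fun k _ => by positivity
      _ = (1 - Real.exp (-δ))⁻¹ := tsum_geometric_of_lt_one hr0 hr1
      _ ≤ 1 + 1 / δ := hgeom
  rw [← Finset.sum_filter_add_sum_filter_not S (fun j => i ≤ j)]
  have hA := key (S.filter (fun j => i ≤ j)) (fun j => j - i)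
    (by
      intro x hx y hy hxy
      simp only [Finset.coe_filter, Set.mem_ofPred_eq] at hx hy hxy
      omega)
    (by
      intro j hj
      have hij : i ≤ j := (Finset.mem_filter.1 hj).2
      rw [Nat.cast_sub hij, abs_of_nonneg]
      have : (i : ℝ) ≤ j := by exact_mod_cast hij
      linarith)
  have hB := key (S.filter (fun j => ¬ i ≤ j)) (fun j => i - j)
    (by
      intro x hx y hy hxy
      simp only [Finset.coe_filter, Set.mem_ofPred_eq] at hx hy hxy
      omega)
    (by
      intro j hj
      have hij : j ≤ i := (not_le.1 (Finset.mem_filter.1 hj).2).le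
      have : (j : ℝ) ≤ i := by exact_mod_cast hij
      rw [Nat.cast_sub hij, abs_of_nonpos (by linarith)]
      ring)
  linarith

/-- A sum of `exp (-|g j|)` over points where `g` is `δ`-separated is `O(1 + 1 / δ)`. -/
lemma sum_exp_neg_abs_le {δ : ℝ} (hδ : 0 < δ) (S : Finset ℕ) (g : ℕ → ℝ)
    (hg : ∀ i ∈ S, ∀ j ∈ S, i ≤ j → δ * ((j : ℝ) - i) ≤ g j - g i) :
    ∑ j ∈ S, Real.exp (-|g j|) ≤ 2 * (1 + 2 / δ) := by
  rcases S.eq_empty_or_nonempty with rfl | hS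
  · simp only [Finset.sum_empty]; positivity
  obtain ⟨i, hi, hmin⟩ := S.exists_min_image (fun j => |g j|) hS
  calc ∑ j ∈ S, Real.exp (-|g j|)
      ≤ ∑ j ∈ S, Real.exp (-(δ / 2 * |(j : ℝ) - i|)) := by
        refine Finset.sum_le_sum fun j hj => ?_
        gcongr
        have hsep : δ * |(j : ℝ) - i| ≤ |g j - g i| := by
          rcases le_total i j with h | h
          · have h' : (i : ℝ) ≤ j := by exact_mod_cast h
            rw [abs_of_nonneg (by linarith)]
            exact (hg i hi j hj h).trans (le_abs_self _)
          · have h' : (j : ℝ) ≤ i := by exact_mod_cast h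
            rw [abs_sub_comm, abs_of_nonneg (by linarith), abs_sub_comm]
            exact (hg j hj i hi h).trans (le_abs_self _)
        have := hmin j hj
        have := abs_sub (g j) (g i)
        linarith
    _ ≤ 2 * (1 + 1 / (δ / 2)) := sum_exp_neg_mul_abs_sub_le (by positivity) S i
    _ = 2 * (1 + 2 / δ) := by field_simp

lemma log_decayRatio {s b a J t : ℝ} (ht : 0 < t) :
    Real.log (decayRatio s b a J t) = 2 * s * (J ^ b - t ^ b) + a * Real.log t := by
  unfold decayRatio
  rw [Real.log_mul (Real.exp_pos _).ne' (Real.rpow_pos_of_pos ht a).ne', Real.log_exp,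
    Real.log_rpow ht]

lemma le_log_decayRatio_sub {s b a J x y : ℝ} (hs : 0 < s) (hx : 0 < x) (hxy : x ≤ y)
    (hlarge : |a| ≤ s * b * x ^ b) :
    s * b * x ^ b * ((y - x) / y) ≤
      Real.log (decayRatio s b a J x) - Real.log (decayRatio s b a J y) := by
  have hy : 0 < y := by linarith
  rw [log_decayRatio hx, log_decayRatio hy]
  have hlog : (y - x) / y ≤ Real.log y - Real.log x := by
    have := Real.one_sub_inv_le_log_of_pos (show 0 < y / x by positivity)
    rw [Real.log_div hy.ne' hx.ne', inv_div] at this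
    rwa [sub_div, div_self hy.ne']
  have hlog0 : 0 ≤ Real.log y - Real.log x := by
    linarith [Real.log_le_log hx hxy]
  have hpow : b * x ^ b * (Real.log y - Real.log x) ≤ y ^ b - x ^ b := by
    have h1 : y ^ b = x ^ b * Real.exp (b * (Real.log y - Real.log x)) := by
      rw [Real.rpow_def_of_pos hy, Real.rpow_def_of_pos hx, ← Real.exp_add]
      congr 1; ring
    have h2 := Real.add_one_le_exp (b * (Real.log y - Real.log x))
    have h3 : 0 < x ^ b := Real.rpow_pos_of_pos hx b
    rw [h1]; nlinarith
  have ha : a * (Real.log y - Real.log x) ≤ s * b * x ^ b * (Real.log y - Real.log x) :=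
    mul_le_mul_of_nonneg_right ((le_abs_self a).trans hlarge) hlog0
  have hfin : s * b * x ^ b * ((y - x) / y) ≤ s * b * x ^ b * (Real.log y - Real.log x) :=
    mul_le_mul_of_nonneg_left hlog ((abs_nonneg a).trans hlarge)
  nlinarith

lemma exp_neg_abs_log_le {r : ℝ} (hr : 0 < r) : Real.exp (-|Real.log r|) ≤ r := by
  conv_rhs => rw [← Real.exp_log hr]
  exact Real.exp_le_exp.2 (neg_abs_le _)

lemma exp_neg_abs_log_le_inv {r : ℝ} (hr : 0 < r) : Real.exp (-|Real.log r|) ≤ r⁻¹ := by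
  conv_rhs => rw [← Real.exp_log hr, ← Real.exp_neg]
  exact Real.exp_le_exp.2 (neg_le_neg (le_abs_self _))

lemma div_one_add_sq_le {x r A B : ℝ} (hr : 0 < r) (hA : 0 < A) (hx : 0 ≤ x) (h1 : A * r ≤ x)
    (h2 : x ≤ B * r) :
    x / (1 + x) ^ 2 ≤ (B + A⁻¹) * Real.exp (-|Real.log r|) := by
  have hB : 0 ≤ B := by
    by_contra! h
    nlinarith
  have hx0 : 0 < x := (mul_pos hA hr).trans_le h1
  rcases le_total 0 (Real.log r) with h | h
  · rw [abs_of_nonneg h, Real.exp_neg, Real.exp_log hr]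
    calc x / (1 + x) ^ 2 ≤ x⁻¹ := by
          rw [div_le_iff₀ (by positivity), inv_mul_eq_div, le_div_iff₀ hx0]; nlinarith
      _ ≤ (A * r)⁻¹ := by gcongr
      _ = A⁻¹ * r⁻¹ := by rw [mul_inv]
      _ ≤ (B + A⁻¹) * r⁻¹ := by gcongr; linarith
  · rw [abs_of_nonpos h, neg_neg, Real.exp_log hr]
    calc x / (1 + x) ^ 2 ≤ x := by
          rw [div_le_iff₀ (by positivity)]; nlinarith [mul_pos hx0 hx0]
      _ ≤ B * r := h2
      _ ≤ (B + A⁻¹) * r := by gcongr; linarith [inv_pos.2 hA]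

/-- The weights away from the crossing point `J` are negligible. -/
lemma exists_exp_neg_abs_log_decayRatio_le {s b : ℝ} (a : ℝ) {p : ℝ} (hp : 0 ≤ p) (hs : 0 < s)
    (hb : 0 < b) :
    ∃ K : ℝ, 0 < K ∧ ∀ J t : ℝ, 1 ≤ J → 1 ≤ t → (2 * t ≤ J ∨ 2 * J ≤ t) →
      Real.exp (-|Real.log (decayRatio s b a J t)|) ≤ K * (J ^ (-p) * t ^ (-2 : ℝ)) := by
  obtain ⟨K₁, hK₁, h₁⟩ := exists_inv_decayRatio_le a (p + 2) hs hb
  obtain ⟨K₂, hK₂, h₂⟩ := exists_decayRatio_le a (p + 2) hs hb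
  refine ⟨K₁ + K₂, by positivity, fun J t hJ ht h => ?_⟩
  have hJ0 : 0 < J := by linarith
  have ht0 : 0 < t := by linarith
  have hr : 0 < decayRatio s b a J t := decayRatio_pos ht0
  rcases h with h | h
  · calc Real.exp (-|Real.log (decayRatio s b a J t)|) ≤ (decayRatio s b a J t)⁻¹ :=
          exp_neg_abs_log_le_inv hr
      _ ≤ K₁ * J ^ (-(p + 2)) := h₁ J t ht h
      _ = K₁ * (J ^ (-p) * J ^ (-2 : ℝ)) := by rw [← Real.rpow_add hJ0]; congr 2; ring
      _ ≤ (K₁ + K₂) * (J ^ (-p) * t ^ (-2 : ℝ)) := by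
          have : J ^ (-2 : ℝ) ≤ t ^ (-2 : ℝ) :=
            Real.rpow_le_rpow_of_nonpos ht0 (by linarith) (by norm_num)
          gcongr
          linarith
  · calc Real.exp (-|Real.log (decayRatio s b a J t)|) ≤ decayRatio s b a J t :=
          exp_neg_abs_log_le hr
      _ ≤ K₂ * t ^ (-(p + 2)) := h₂ J t hJ h
      _ = K₂ * (t ^ (-p) * t ^ (-2 : ℝ)) := by rw [← Real.rpow_add ht0]; congr 2; ring
      _ ≤ (K₁ + K₂) * (J ^ (-p) * t ^ (-2 : ℝ)) := by
          have : t ^ (-p) ≤ J ^ (-p) :=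
            Real.rpow_le_rpow_of_nonpos hJ0 (by linarith) (by linarith)
          gcongr
          linarith

lemma rpow_neg_le_of_half_lt {p J t : ℝ} (hp : 0 ≤ p) (hJ : 0 < J) (h : J < 2 * t) :
    t ^ (-p) ≤ 2 ^ p * J ^ (-p) := by
  have h1 : t ^ (-p) ≤ (J / 2) ^ (-p) :=
    Real.rpow_le_rpow_of_nonpos (by linarith) (by linarith) (by linarith)
  refine h1.trans_eq ?_
  rw [Real.div_rpow hJ.le (by norm_num), Real.rpow_neg (by norm_num : (0 : ℝ) ≤ 2)]
  field_simp

/-- The weighted sum over `J / 2 < j < 2 J` is controlled by the width `1 + J ^ (1 - b)` of the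
window where the ratio is of order one. -/
lemma exists_sum_window_le {s b : ℝ} (a : ℝ) (hs : 0 < s) (hb : 0 < b) :
    ∃ C J₀ : ℝ, 0 < C ∧ ∀ J : ℝ, 1 ≤ J → J₀ ≤ J → ∀ S : Finset ℕ,
      (∀ j ∈ S, J < 2 * ((j : ℝ) + 1) ∧ (j : ℝ) + 1 < 2 * J) →
      ∑ j ∈ S, Real.exp (-|Real.log (decayRatio s b a J ((j : ℝ) + 1))|) ≤
        C * (1 + J ^ (1 - b)) := by
  set d : ℝ := s * b / (2 ^ b * 2) with hd
  have hd0 : 0 < d := by positivity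
  refine ⟨2 + 4 / d, 2 * (|a| / (s * b)) ^ (1 / b), by positivity, fun J hJ hJ₀ S hS => ?_⟩
  have hJ0 : 0 < J := by linarith
  have hsum := sum_exp_neg_abs_le (δ := d * J ^ (b - 1)) (by positivity) S
    (fun j => -Real.log (decayRatio s b a J ((j : ℝ) + 1))) (by
      intro i hi j hj hij
      have hij' : (i : ℝ) ≤ j := by exact_mod_cast hij
      have hi0 : 0 < (i : ℝ) + 1 := by positivity
      have hj0 : 0 < (j : ℝ) + 1 := by positivity
      have hiJ : J ^ b ≤ 2 ^ b * ((i : ℝ) + 1) ^ b := by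
        rw [← Real.mul_rpow (by norm_num) hi0.le]
        exact Real.rpow_le_rpow hJ0.le (hS i hi).1.le hb.le
      have hlarge : |a| ≤ s * b * ((i : ℝ) + 1) ^ b := by
        have h1 : (|a| / (s * b)) ^ (1 / b) ≤ (i : ℝ) + 1 := by linarith [(hS i hi).1]
        have h2 := Real.rpow_le_rpow (by positivity) h1 hb.le
        rw [← Real.rpow_mul (by positivity), one_div_mul_cancel hb.ne', Real.rpow_one,
          div_le_iff₀ (by positivity)] at h2
        linarith
      have hinc := le_log_decayRatio_sub (J := J) hs hi0
        (show (i : ℝ) + 1 ≤ (j : ℝ) + 1 by linarith) hlarge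
      have hδ : d * J ^ (b - 1) ≤ s * b * ((i : ℝ) + 1) ^ b / ((j : ℝ) + 1) := by
        rw [Real.rpow_sub_one hJ0.ne', hd, div_mul_div_comm,
          div_le_div_iff₀ (by positivity) hj0]
        have := (hS j hj).2.le
        calc s * b * J ^ b * ((j : ℝ) + 1)
            ≤ s * b * (2 ^ b * ((i : ℝ) + 1) ^ b) * (2 * J) := by gcongr
          _ = s * b * ((i : ℝ) + 1) ^ b * (2 ^ b * 2 * J) := by ring
      have := mul_le_mul_of_nonneg_right hδ (sub_nonneg.2 hij')
      have heq : s * b * ((i : ℝ) + 1) ^ b / ((j : ℝ) + 1) * ((j : ℝ) - i) =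
          s * b * ((i : ℝ) + 1) ^ b * (((j : ℝ) + 1 - (i + 1)) / ((j : ℝ) + 1)) := by ring
      linarith)
  simp only [abs_neg] at hsum
  refine hsum.trans ?_
  have hinv : 2 / (d * J ^ (b - 1)) = 2 / d * J ^ (1 - b) := by
    rw [← neg_sub b 1, Real.rpow_neg hJ0.le]; field_simp
  rw [hinv]
  have h1 : 0 ≤ 4 / d := by positivity
  have h2 : 0 ≤ J ^ (1 - b) := by positivity
  have h3 : 2 * (2 / d * J ^ (1 - b)) = 4 / d * J ^ (1 - b) := by ring
  linarith

lemma summable_add_one_rpow_neg_two : Summable fun j : ℕ => ((j : ℝ) + 1) ^ (-2 : ℝ) := by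
  have h := (summable_nat_add_iff 1).2 (Real.summable_nat_rpow.2 (by norm_num : (-2 : ℝ) < -1))
  simpa using h

lemma exists_sum_variance_weight_le {s b p : ℝ} (a : ℝ) (hp : 0 ≤ p) (hs : 0 < s) (hb : 0 < b) :
    ∃ C J₀ : ℝ, 0 < C ∧ ∀ J : ℝ, 1 ≤ J → J₀ ≤ J → ∀ N : ℕ,
      ∑ j ∈ Finset.range N, ((j : ℝ) + 1) ^ (-p) *
        Real.exp (-|Real.log (decayRatio s b a J ((j : ℝ) + 1))|) ≤
        C * (J ^ (-p) * (1 + J ^ (1 - b))) := by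
  obtain ⟨C, J₀, hC, hwin⟩ := exists_sum_window_le a hs hb
  obtain ⟨K, hK, hoff⟩ := exists_exp_neg_abs_log_decayRatio_le a hp hs hb
  have hZ := summable_add_one_rpow_neg_two
  set Z : ℝ := ∑' j : ℕ, ((j : ℝ) + 1) ^ (-2 : ℝ)
  have hZ0 : 0 ≤ Z := tsum_nonneg fun j => by positivity
  refine ⟨2 ^ p * C + K * Z, J₀, by positivity, fun J hJ hJ₀ N => ?_⟩
  have hJ0 : 0 < J := by linarith
  rw [← Finset.sum_filter_add_sum_filter_not (Finset.range N)
    (fun j : ℕ => J < 2 * ((j : ℝ) + 1) ∧ (j : ℝ) + 1 < 2 * J)]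
  have hA : ∑ j ∈ (Finset.range N).filter
      (fun j : ℕ => J < 2 * ((j : ℝ) + 1) ∧ (j : ℝ) + 1 < 2 * J), ((j : ℝ) + 1) ^ (-p) *
        Real.exp (-|Real.log (decayRatio s b a J ((j : ℝ) + 1))|) ≤
      2 ^ p * J ^ (-p) * (C * (1 + J ^ (1 - b))) := by
    refine le_trans ?_ (mul_le_mul_of_nonneg_left
      (hwin J hJ hJ₀ ((Finset.range N).filter
        (fun j : ℕ => J < 2 * ((j : ℝ) + 1) ∧ (j : ℝ) + 1 < 2 * J))
        fun j hj => (Finset.mem_filter.1 hj).2) (by positivity))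
    rw [Finset.mul_sum]
    refine Finset.sum_le_sum fun j hj => ?_
    gcongr
    exact rpow_neg_le_of_half_lt hp hJ0 (Finset.mem_filter.1 hj).2.1
  have hB : ∑ j ∈ (Finset.range N).filter
      (fun j : ℕ => ¬ (J < 2 * ((j : ℝ) + 1) ∧ (j : ℝ) + 1 < 2 * J)), ((j : ℝ) + 1) ^ (-p) *
        Real.exp (-|Real.log (decayRatio s b a J ((j : ℝ) + 1))|) ≤
      K * J ^ (-p) * Z := by
    refine le_trans ?_ (mul_le_mul_of_nonneg_left
      (hZ.sum_le_tsum ((Finset.range N).filter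
        (fun j : ℕ => ¬ (J < 2 * ((j : ℝ) + 1) ∧ (j : ℝ) + 1 < 2 * J)))
        fun j _ => by positivity) (by positivity))
    rw [Finset.mul_sum]
    refine Finset.sum_le_sum fun j hj => ?_
    have hj1 : (1 : ℝ) ≤ (j : ℝ) + 1 := by linarith [Nat.cast_nonneg (α := ℝ) j]
    have hout : 2 * ((j : ℝ) + 1) ≤ J ∨ 2 * J ≤ (j : ℝ) + 1 := by
      by_contra! h
      exact (Finset.mem_filter.1 hj).2 h
    calc _ ≤ 1 * Real.exp (-|Real.log (decayRatio s b a J ((j : ℝ) + 1))|) := by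
          gcongr
          exact Real.rpow_le_one_of_one_le_of_nonpos hj1 (by linarith)
      _ ≤ K * (J ^ (-p) * ((j : ℝ) + 1) ^ (-2 : ℝ)) := by
          rw [one_mul]; exact hoff J _ hJ hj1 hout
      _ = K * J ^ (-p) * ((j : ℝ) + 1) ^ (-2 : ℝ) := by ring
  have h1 : K * J ^ (-p) * Z ≤ K * Z * (J ^ (-p) * (1 + J ^ (1 - b))) := by
    have : 0 ≤ K * Z * J ^ (-p) * J ^ (1 - b) := by positivity
    linarith
  calc _ ≤ _ := add_le_add hA (hB.trans h1)
    _ = _ := by ring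

lemma exists_bias_weight_le {s b p A : ℝ} (a : ℝ) (hp : 0 ≤ p) (hs : 0 < s) (hb : 0 < b)
    (hA : 0 < A) :
    ∃ C : ℝ, 0 < C ∧ ∀ J t x : ℝ, 1 ≤ J → 1 ≤ t → A * decayRatio s b a J t ≤ x →
      t ^ (-p) / (1 + x) ^ 2 ≤ C * J ^ (-p) := by
  obtain ⟨K, hK, h⟩ := exists_inv_decayRatio_le a p hs hb
  refine ⟨2 ^ p + A⁻¹ * K, by positivity, fun J t x hJ ht hx => ?_⟩
  have hJ0 : 0 < J := by linarith
  have ht0 : 0 < t := by linarith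
  have hr : 0 < decayRatio s b a J t := decayRatio_pos ht0
  have hx0 : 0 < x := (mul_pos hA hr).trans_le hx
  have hJp : 0 < J ^ (-p) := Real.rpow_pos_of_pos hJ0 _
  rcases lt_or_ge J (2 * t) with h2 | h2
  · calc t ^ (-p) / (1 + x) ^ 2 ≤ t ^ (-p) := div_le_self (by positivity) (by nlinarith)
      _ ≤ 2 ^ p * J ^ (-p) := rpow_neg_le_of_half_lt hp hJ0 h2
      _ ≤ _ := by gcongr; linarith [mul_pos (inv_pos.2 hA) hK]
  · calc t ^ (-p) / (1 + x) ^ 2 ≤ 1 / x := by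
          gcongr
          · exact Real.rpow_le_one_of_one_le_of_nonpos ht (by linarith)
          · nlinarith
      _ ≤ 1 / (A * decayRatio s b a J t) := by gcongr
      _ = A⁻¹ * (decayRatio s b a J t)⁻¹ := by rw [one_div, mul_inv]
      _ ≤ A⁻¹ * (K * J ^ (-p)) := by gcongr; exact h J t ht h2
      _ ≤ _ := by
          have : (0 : ℝ) < 2 ^ p := by positivity
          nlinarith

lemma inv_mul_sq_mul_rpow_mem {s b a m M J t lam y : ℝ} (hm : 0 < m) (ht : 0 < t)
    (hlam : lam = Real.exp (-(2 * s * J ^ b))) (h₁ : m * Real.exp (-s * t ^ b) ≤ y)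
    (h₂ : y ≤ M * Real.exp (-s * t ^ b)) :
    m ^ 2 * decayRatio s b a J t ≤ lam⁻¹ * y ^ 2 * t ^ a ∧
      lam⁻¹ * y ^ 2 * t ^ a ≤ M ^ 2 * decayRatio s b a J t := by
  have heq : ∀ c : ℝ, c ^ 2 * decayRatio s b a J t =
      lam⁻¹ * (c * Real.exp (-s * t ^ b)) ^ 2 * t ^ a := by
    intro c
    unfold decayRatio
    rw [hlam, ← Real.exp_neg, mul_pow, ← Real.exp_nat_mul,
      show 2 * s * (J ^ b - t ^ b) = -(-(2 * s * J ^ b)) + ((2 : ℕ) : ℝ) * (-s * t ^ b) by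
        push_cast; ring, Real.exp_add]
    ring
  have hlam0 : 0 < lam := hlam ▸ Real.exp_pos _
  have hy : 0 ≤ y := (by positivity : 0 ≤ m * Real.exp (-s * t ^ b)).trans h₁
  constructor
  · rw [heq]; gcongr
  · rw [heq]; gcongr

lemma exists_MISE_le
    {s b α β γ : ℝ} (hs : 0 < s) (hb : 0 < b) (hα : 0 ≤ α) (hγ : 0 ≤ γ)
    {l : ℕ → ℝ} {m M : ℝ} (hm : 0 < m)
    (hl : ∀ j : ℕ, 1 ≤ j →
      m * Real.exp (-s * (j : ℝ) ^ b) ≤ l j ∧ l j ≤ M * Real.exp (-s * (j : ℝ) ^ b))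
    {u : ℕ → ℝ}
    (hu : Summable (fun j : ℕ => ((j : ℝ) + 1) ^ (2 * γ) * (u (j + 1)) ^ 2)) :
    ∃ C J₀ : ℝ, 0 < C ∧ ∀ n lam J : ℝ, 1 ≤ J → J₀ ≤ J → 0 < n →
      lam = Real.exp (-(2 * s * J ^ b)) →
        MISE α β l u n lam ≤ C *
          ((n * lam)⁻¹ * (J ^ (-(2 * α)) * (1 + J ^ (1 - b))) + J ^ (-(2 * γ))) := by
  obtain ⟨C₁, J₀, hC₁, hvar⟩ := exists_sum_variance_weight_le (p := 2 * α) (2 * β - 2 * α)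
    (by positivity) hs hb
  obtain ⟨C₂, hC₂, hbias⟩ := exists_bias_weight_le (p := 2 * γ) (2 * β - 2 * α)
    (by positivity) hs hb (pow_pos hm 2)
  set D : ℝ := M ^ 2 + (m ^ 2)⁻¹
  have hD0 : 0 < D := by positivity
  set U : ℝ := ∑' j : ℕ, ((j : ℝ) + 1) ^ (2 * γ) * (u (j + 1)) ^ 2
  have hU0 : 0 ≤ U := tsum_nonneg fun j => by positivity
  refine ⟨D * C₁ + C₂ * U, J₀, by positivity, fun n lam J hJ hJ₀ hn hlam => ?_⟩
  have hlam0 : 0 < lam := hlam ▸ Real.exp_pos _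
  have hJ0 : 0 < J := by linarith
  have hmem : ∀ j : ℕ, m ^ 2 * decayRatio s b (2 * β - 2 * α) J ((j : ℝ) + 1) ≤
      lam⁻¹ * (l (j + 1)) ^ 2 * ((j : ℝ) + 1) ^ (2 * β - 2 * α) ∧
      lam⁻¹ * (l (j + 1)) ^ 2 * ((j : ℝ) + 1) ^ (2 * β - 2 * α) ≤
      M ^ 2 * decayRatio s b (2 * β - 2 * α) J ((j : ℝ) + 1) := by
    intro j
    have h := hl (j + 1) (by omega)
    push_cast at h
    exact inv_mul_sq_mul_rpow_mem hm (by positivity) hlam h.1 h.2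
  have hV : ∑' j : ℕ, (l (j + 1)) ^ 2 * ((j : ℝ) + 1) ^ (2 * β - 4 * α) /
      (1 + lam⁻¹ * (l (j + 1)) ^ 2 * ((j : ℝ) + 1) ^ (2 * β - 2 * α)) ^ 2 ≤
      lam * (D * (C₁ * (J ^ (-(2 * α)) * (1 + J ^ (1 - b))))) := by
    refine Real.tsum_le_of_sum_range_le (fun j => by positivity) fun N => ?_
    refine le_trans ?_ (mul_le_mul_of_nonneg_left
      (mul_le_mul_of_nonneg_left (hvar J hJ hJ₀ N) hD0.le) hlam0.le)
    rw [Finset.mul_sum, Finset.mul_sum]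
    refine Finset.sum_le_sum fun j _ => ?_
    have hj0 : 0 < (j : ℝ) + 1 := by positivity
    have hx := div_one_add_sq_le (decayRatio_pos hj0) (pow_pos hm 2) (by positivity)
      (hmem j).1 (hmem j).2
    have hexp : ((j : ℝ) + 1) ^ (2 * β - 4 * α) =
        ((j : ℝ) + 1) ^ (2 * β - 2 * α) * ((j : ℝ) + 1) ^ (-(2 * α)) := by
      rw [← Real.rpow_add hj0]; congr 1; ring
    have := mul_le_mul_of_nonneg_left hx
      (show 0 ≤ lam * ((j : ℝ) + 1) ^ (-(2 * α)) by positivity)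
    refine le_trans (le_of_eq ?_) (this.trans_eq (by ring))
    rw [hexp, mul_div_assoc']
    congr 1
    field_simp
  have hB : ∑' j : ℕ, (u (j + 1)) ^ 2 /
      (1 + lam⁻¹ * (l (j + 1)) ^ 2 * ((j : ℝ) + 1) ^ (2 * β - 2 * α)) ^ 2 ≤
      C₂ * J ^ (-(2 * γ)) * U := by
    refine Real.tsum_le_of_sum_range_le (fun j => by positivity) fun N => ?_
    refine le_trans ?_ (mul_le_mul_of_nonneg_left
      (hu.sum_le_tsum (Finset.range N) fun j _ => by positivity) (by positivity))
    rw [Finset.mul_sum]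
    refine Finset.sum_le_sum fun j _ => ?_
    have hj0 : 0 < (j : ℝ) + 1 := by positivity
    have hj1 : (1 : ℝ) ≤ (j : ℝ) + 1 := by linarith [Nat.cast_nonneg (α := ℝ) j]
    have := mul_le_mul_of_nonneg_right (hbias J _ _ hJ hj1 (hmem j).1)
      (show 0 ≤ ((j : ℝ) + 1) ^ (2 * γ) * (u (j + 1)) ^ 2 by positivity)
    refine le_trans (le_of_eq ?_) this
    have hcancel : ((j : ℝ) + 1) ^ (-(2 * γ)) * ((j : ℝ) + 1) ^ (2 * γ) = 1 := by
      rw [← Real.rpow_add hj0, neg_add_cancel, Real.rpow_zero]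
    rw [div_mul_eq_mul_div, ← mul_assoc, hcancel, one_mul]
  have hV' := mul_le_mul_of_nonneg_left hV (show 0 ≤ (n * lam ^ 2)⁻¹ by positivity)
  have heq : (n * lam ^ 2)⁻¹ * (lam * (D * (C₁ * (J ^ (-(2 * α)) * (1 + J ^ (1 - b)))))) =
      D * C₁ * ((n * lam)⁻¹ * (J ^ (-(2 * α)) * (1 + J ^ (1 - b)))) := by
    field_simp
  rw [heq] at hV'
  have h1 : 0 ≤ C₂ * U * ((n * lam)⁻¹ * (J ^ (-(2 * α)) * (1 + J ^ (1 - b)))) := by positivity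
  have h2 : 0 ≤ D * C₁ * J ^ (-(2 * γ)) := by positivity
  unfold MISE
  linarith

lemma rpow_mul_one_add_rpow_le {b α J : ℝ} (hJ : 1 ≤ J) (hb : 0 < b) :
    J ^ (-(2 * α)) * (1 + J ^ (1 - b)) ≤
      2 * (J ^ b) ^ (-(if 1 ≤ b then 2 * α / b else (2 * α + b - 1) / b)) := by
  have hJ0 : 0 < J := by linarith
  rw [← Real.rpow_mul hJ0.le]
  have hpos : 0 < J ^ (-(2 * α)) := by positivity
  split_ifs with h
  · rw [show b * -(2 * α / b) = -(2 * α) by field_simp]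
    have := Real.rpow_le_one_of_one_le_of_nonpos hJ (show 1 - b ≤ 0 by linarith)
    nlinarith
  · rw [show b * -((2 * α + b - 1) / b) = -(2 * α) + (1 - b) by field_simp; ring,
      Real.rpow_add hJ0]
    have := Real.one_le_rpow hJ (show 0 ≤ 1 - b by linarith)
    nlinarith

/-- Theorem 4.1: with `κ = 2α/b` if `b ≥ 1` and `κ = (2α+b−1)/b` if `b < 1`,
`MISE(n,λ) ≤ M [(nλ)⁻¹ (ln λ^{-1/(2s)})^{-κ} + (ln λ^{-1/(2s)})^{-2γ/b}]`
for all `n > 0` and all sufficiently small `λ > 0`. -/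
theorem MISE_bound
    (s b α β γ : ℝ) (hs : 0 < s) (hb : 0 < b)
    (hα : 1 / 2 < α) (hβ : 0 ≤ β) (hγ : 0 < γ)
    (l : ℕ → ℝ) (m M : ℝ) (hm : 0 < m) (hmM : m ≤ M)
    (hl : ∀ j : ℕ, 1 ≤ j →
      m * Real.exp (-s * (j : ℝ) ^ b) ≤ l j ∧ l j ≤ M * Real.exp (-s * (j : ℝ) ^ b))
    (u : ℕ → ℝ)
    (hu : Summable (fun j : ℕ => ((j : ℝ) + 1) ^ (2 * γ) * (u (j + 1)) ^ 2)) :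
    ∃ M' lam₀ : ℝ, 0 < M' ∧ 0 < lam₀ ∧
      ∀ n lam : ℝ, 0 < n → 0 < lam → lam < lam₀ →
        MISE α β l u n lam ≤ M' *
          ((n * lam)⁻¹ * ((1 / (2 * s)) * Real.log (1 / lam)) ^
              (-(if 1 ≤ b then 2 * α / b else (2 * α + b - 1) / b))
            + ((1 / (2 * s)) * Real.log (1 / lam)) ^ (-(2 * γ) / b)) := by
  obtain ⟨C, J₀, hC, h⟩ := exists_MISE_le (α := α) (β := β) (γ := γ) hs hb (by linarith)
    hγ.le hm hl hu
  set R : ℝ := max 1 J₀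
  have hR : 0 < R := one_pos.trans_le (le_max_left _ _)
  refine ⟨2 * C, Real.exp (-(2 * s * R ^ b)), by positivity, Real.exp_pos _,
    fun n lam hn hlam hlt => ?_⟩
  set T : ℝ := 1 / (2 * s) * Real.log (1 / lam) with hT
  have hlog : Real.log (1 / lam) = -Real.log lam := by rw [one_div, Real.log_inv]
  have hRT : R ^ b ≤ T := by
    have := (Real.log_lt_iff_lt_exp hlam).2 hlt
    rw [hT, hlog, one_div_mul_eq_div, le_div_iff₀ (by positivity)]
    linarith
  have hT0 : 0 < T := (Real.rpow_pos_of_pos hR b).trans_le hRT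
  have hJb : (T ^ (1 / b)) ^ b = T := by
    rw [← Real.rpow_mul hT0.le, one_div_mul_cancel hb.ne', Real.rpow_one]
  have hRJ : R ≤ T ^ (1 / b) := by
    rw [← Real.rpow_le_rpow_iff hR.le (by positivity) hb, hJb]
    exact hRT
  have hlamT : lam = Real.exp (-(2 * s * (T ^ (1 / b)) ^ b)) := by
    rw [hJb, hT, hlog]
    conv_lhs => rw [← Real.exp_log hlam]
    congr 1
    field_simp
  have hJ1 : 1 ≤ T ^ (1 / b) := (le_max_left _ _).trans hRJ
  refine (h n lam _ hJ1 ((le_max_right _ _).trans hRJ) hn hlamT).trans ?_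
  have hvar := rpow_mul_one_add_rpow_le (α := α) hJ1 hb
  rw [hJb] at hvar
  have hbias : (T ^ (1 / b)) ^ (-(2 * γ)) = T ^ (-(2 * γ) / b) := by
    rw [← Real.rpow_mul hT0.le]; congr 1; ring
  rw [hbias]
  have h1 := mul_le_mul_of_nonneg_left hvar (show 0 ≤ C * (n * lam)⁻¹ by positivity)
  have h2 : 0 ≤ C * T ^ (-(2 * γ) / b) := by positivity
  linarith
end

section
/- Define H(λ) = Σ_{j≥1} j^{-2α} (1 + λ^{-1} l_j² j^{2β−2α})^{-1}. Then H(λ) ≍ (ln λ^{-1/(2s)})^{-(2α−1)/b} as λ → 0⁺, i.e. there exist constants 0 < m ≤ M and λ₀ > 0 such that m ((1/(2s)) ln(1/λ))^{-(2α−1)/b} ≤ H(λ) ≤ M ((1/(2s)) ln(1/λ))^{-(2α−1)/b} for all 0 < λ < λ₀. (Consequently the trace of the posterior covariance satisfies Tr(C) = (nλ)^{-1} H(λ) ≍ (nλ)^{-1} (ln λ^{-1/(2s)})^{-(2α−1)/b}; Theorem 4.2.) -/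
/-- `H(λ) = Σ_{j≥1} j^{-2α} (1 + λ⁻¹ l_j² j^{2β−2α})⁻¹`, so that the trace of the
posterior covariance is `Tr(C) = (nλ)⁻¹ H(λ)`. -/
noncomputable def traceSum (α β : ℝ) (l : ℕ → ℝ) (lam : ℝ) : ℝ :=
  ∑' j : ℕ,
    ((j : ℝ) + 1) ^ (-(2 * α)) /
      (1 + lam⁻¹ * (l (j + 1)) ^ 2 * ((j : ℝ) + 1) ^ (2 * β - 2 * α))

theorem rpow_le_const_mul_exp (a : ℝ) {s : ℝ} (hs : 0 < s) :
    ∃ K : ℝ, 0 < K ∧ ∀ t : ℝ, 1 ≤ t → t ^ a ≤ K * Real.exp (s * t) := by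
  obtain ⟨n, hn⟩ := exists_nat_ge a
  have hf : (0 : ℝ) < n.factorial := by exact_mod_cast n.factorial_pos
  refine ⟨n.factorial / s ^ n, by positivity, fun t ht => ?_⟩
  have h1 : t ^ a ≤ t ^ n := by
    rw [← Real.rpow_natCast]
    exact Real.rpow_le_rpow_of_exponent_le ht hn
  have h2 := Real.pow_div_factorial_le_exp (s * t) (by positivity) n
  rw [div_le_iff₀ hf, mul_pow] at h2
  refine h1.trans ?_
  rw [div_mul_eq_mul_div, le_div_iff₀ (by positivity)]
  linarith

theorem rpow_neg_sub_rpow_neg_bounds {p x : ℝ} (hp : 0 < p) (hx : 0 < x) :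
    p * (x + 1) ^ (-(p + 1)) ≤ x ^ (-p) - (x + 1) ^ (-p) ∧
      x ^ (-p) - (x + 1) ^ (-p) ≤ p * x ^ (-(p + 1)) := by
  have hd : ∀ y : ℝ, 0 < y → HasDerivAt (fun y : ℝ => y ^ (-p)) (-p * y ^ (-p - 1)) y :=
    fun y hy => Real.hasDerivAt_rpow_const (Or.inl hy.ne')
  obtain ⟨c, ⟨hc1, hc2⟩, hc⟩ := exists_hasDerivAt_eq_slope (fun y : ℝ => y ^ (-p))
    (fun y => -p * y ^ (-p - 1)) (show x < x + 1 by linarith)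
    (fun y hy => (hd y (hx.trans_le hy.1)).continuousAt.continuousWithinAt)
    (fun y hy => hd y (hx.trans hy.1))
  have hE : x ^ (-p) - (x + 1) ^ (-p) = p * c ^ (-(p + 1)) := by
    rw [add_sub_cancel_left, div_one] at hc
    rw [show -(p + 1) = -p - 1 by ring]
    linarith
  rw [hE]
  constructor
  · exact mul_le_mul_of_nonneg_left
      (Real.rpow_le_rpow_of_nonpos (hx.trans hc1) hc2.le (by linarith)) hp.le
  · exact mul_le_mul_of_nonneg_left
      (Real.rpow_le_rpow_of_nonpos hx hc1.le (by linarith)) hp.le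

theorem hasSum_rpow_neg_sub {p x : ℝ} (hp : 0 < p) (hx : 0 < x) :
    HasSum (fun i : ℕ => (x + i) ^ (-p) - (x + i + 1) ^ (-p)) (x ^ (-p)) := by
  have hn : ∀ i : ℕ, 0 ≤ (x + i) ^ (-p) - (x + i + 1) ^ (-p) := fun i => by
    have hxi : 0 < x + i := by positivity
    exact le_trans (by positivity) (rpow_neg_sub_rpow_neg_bounds hp hxi).1
  rw [hasSum_iff_tendsto_nat_of_nonneg hn]
  have hs : ∀ n : ℕ, ∑ i ∈ Finset.range n, ((x + i) ^ (-p) - (x + i + 1) ^ (-p))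
      = x ^ (-p) - (x + n) ^ (-p) := fun n => by
    have := Finset.sum_range_sub' (fun i : ℕ => (x + i) ^ (-p)) n
    simpa [add_assoc] using this
  simp_rw [hs]
  have ht : Filter.Tendsto (fun n : ℕ => (x + n) ^ (-p)) Filter.atTop (nhds 0) :=
    (tendsto_rpow_neg_atTop hp).comp
      (Filter.tendsto_atTop_add_const_left _ x tendsto_natCast_atTop_atTop)
  simpa using ht.const_sub (x ^ (-p))

theorem summable_add_natCast_rpow_neg {p x : ℝ} (hp : 0 < p) (hx : 0 < x) :
    Summable fun i : ℕ => (x + i) ^ (-(p + 1)) := by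
  rw [← summable_nat_add_iff 1]
  refine Summable.of_nonneg_of_le (fun i => by positivity) (fun i => ?_)
    ((hasSum_rpow_neg_sub hp hx).summable.mul_left p⁻¹)
  have h := (rpow_neg_sub_rpow_neg_bounds hp (show 0 < x + i by positivity)).1
  rw [le_inv_mul_iff₀ hp]
  simpa [add_assoc] using h

theorem rpow_neg_le_mul_tsum {p x : ℝ} (hp : 0 < p) (hx : 0 < x) :
    x ^ (-p) ≤ p * ∑' i : ℕ, (x + i) ^ (-(p + 1)) := by
  rw [← (hasSum_rpow_neg_sub hp hx).tsum_eq, ← tsum_mul_left]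
  exact (hasSum_rpow_neg_sub hp hx).summable.tsum_le_tsum
    (fun i => (rpow_neg_sub_rpow_neg_bounds hp (by positivity)).2)
    ((summable_add_natCast_rpow_neg hp hx).mul_left p)

theorem mul_tsum_le_rpow_neg {p x : ℝ} (hp : 0 < p) (hx : 0 < x) :
    p * ∑' i : ℕ, (x + 1 + i) ^ (-(p + 1)) ≤ x ^ (-p) := by
  rw [← (hasSum_rpow_neg_sub hp hx).tsum_eq, ← tsum_mul_left]
  refine ((summable_add_natCast_rpow_neg hp (by positivity)).mul_left p).tsum_le_tsum
    (fun i => ?_) (hasSum_rpow_neg_sub hp hx).summable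
  have h := (rpow_neg_sub_rpow_neg_bounds hp (show 0 < x + i by positivity)).1
  rwa [← add_right_comm x (i : ℝ) 1]

/-- The head of the series is controlled termwise by `ε`, its tail by that of `∑ j^{-(p+1)}`. -/
theorem tsum_div_one_add_le {p ε : ℝ} (hp : 0 < p) {w : ℕ → ℝ} (hw : ∀ j, 0 ≤ w j)
    {k : ℕ} (hk : 0 < k)
    (hε : ∀ j < k, ((j : ℝ) + 1) ^ (-(p + 1)) ≤ ε * w j) :
    ∑' j : ℕ, ((j : ℝ) + 1) ^ (-(p + 1)) / (1 + w j) ≤ k * ε + p⁻¹ * (k : ℝ) ^ (-p) := by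
  have hk' : (0 : ℝ) < k := by exact_mod_cast hk
  have hle : ∀ j : ℕ, ((j : ℝ) + 1) ^ (-(p + 1)) / (1 + w j) ≤ ((j : ℝ) + 1) ^ (-(p + 1)) :=
    fun j => div_le_self (by positivity) (by linarith [hw j])
  have hnn : ∀ j : ℕ, 0 ≤ ((j : ℝ) + 1) ^ (-(p + 1)) / (1 + w j) :=
    fun j => div_nonneg (by positivity) (by linarith [hw j])
  have hS0 : Summable fun j : ℕ => ((j : ℝ) + 1) ^ (-(p + 1)) := by
    simpa [add_comm] using summable_add_natCast_rpow_neg hp one_pos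
  have hS := Summable.of_nonneg_of_le hnn hle hS0
  rw [← hS.sum_add_tsum_nat_add k]
  gcongr
  · have := Finset.sum_le_card_nsmul (Finset.range k)
      (fun j : ℕ => ((j : ℝ) + 1) ^ (-(p + 1)) / (1 + w j)) ε (fun j hj => by
        have h1 := hε j (Finset.mem_range.1 hj)
        have h2 : 0 < ((j : ℝ) + 1) ^ (-(p + 1)) := by positivity
        have h3 : 0 < ε := pos_of_mul_pos_left (h2.trans_le h1) (hw j)
        rw [div_le_iff₀ (by linarith [hw j])]
        linarith)
    simpa using this
  · rw [le_inv_mul_iff₀ hp]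
    refine le_trans ?_ (mul_tsum_le_rpow_neg hp hk')
    gcongr p * ?_
    refine Summable.tsum_le_tsum (fun i => (hle _).trans_eq ?_)
      ((summable_nat_add_iff k).2 hS) (summable_add_natCast_rpow_neg hp (by positivity))
    push_cast
    congr 1
    ring

theorem le_tsum_div_one_add {p K : ℝ} (hp : 0 < p) {w : ℕ → ℝ} (hw : ∀ j, 0 ≤ w j)
    {k : ℕ} (hK : ∀ j, k ≤ j → w j ≤ K) :
    (p * (1 + K))⁻¹ * ((k : ℝ) + 1) ^ (-p) ≤
      ∑' j : ℕ, ((j : ℝ) + 1) ^ (-(p + 1)) / (1 + w j) := by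
  have hK0 : 0 ≤ K := (hw k).trans (hK k le_rfl)
  have hle : ∀ j : ℕ, ((j : ℝ) + 1) ^ (-(p + 1)) / (1 + w j) ≤ ((j : ℝ) + 1) ^ (-(p + 1)) :=
    fun j => div_le_self (by positivity) (by linarith [hw j])
  have hnn : ∀ j : ℕ, 0 ≤ ((j : ℝ) + 1) ^ (-(p + 1)) / (1 + w j) :=
    fun j => div_nonneg (by positivity) (by linarith [hw j])
  have hS0 : Summable fun j : ℕ => ((j : ℝ) + 1) ^ (-(p + 1)) := by
    simpa [add_comm] using summable_add_natCast_rpow_neg hp one_pos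
  have hS := Summable.of_nonneg_of_le hnn hle hS0
  rw [← hS.sum_add_tsum_nat_add k]
  refine le_trans ?_ (le_add_of_nonneg_left (Finset.sum_nonneg fun j _ => hnn j))
  have hk : (0 : ℝ) < (k : ℝ) + 1 := by positivity
  calc (p * (1 + K))⁻¹ * ((k : ℝ) + 1) ^ (-p)
      ≤ (p * (1 + K))⁻¹ * (p * ∑' i : ℕ, ((k : ℝ) + 1 + i) ^ (-(p + 1))) := by
        gcongr
        exact rpow_neg_le_mul_tsum hp hk
    _ = ∑' i : ℕ, (1 + K)⁻¹ * ((k : ℝ) + 1 + i) ^ (-(p + 1)) := by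
        rw [tsum_mul_left]
        field_simp
    _ ≤ _ := by
        refine Summable.tsum_le_tsum (fun i => ?_)
          ((summable_add_natCast_rpow_neg hp hk).mul_left _) ((summable_nat_add_iff k).2 hS)
        have h1 : (k : ℝ) + 1 + i = ((i + k : ℕ) : ℝ) + 1 := by push_cast; ring
        rw [h1, inv_mul_eq_div]
        exact div_le_div_of_nonneg_left (by positivity) (by linarith [hw (i + k)])
          (by linarith [hK (i + k) (Nat.le_add_left k i)])

theorem rpow_inv_mul_rpow_neg {b c L p : ℝ} (hc : 0 < c) (hL : 0 < L) :
    ((c * L) ^ b⁻¹) ^ (-p) = c ^ (-p / b) * L ^ (-p / b) := by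
  rw [← Real.rpow_mul (by positivity), Real.mul_rpow hc.le hL.le]
  congr 2 <;> ring

/-- Theorem 4.2: `H(λ) ≍ (ln λ^{-1/(2s)})^{-(2α−1)/b}` as `λ → 0⁺`, hence
`Tr(C) ≍ (nλ)⁻¹ (ln λ^{-1/(2s)})^{-(2α−1)/b}`. -/
theorem trace_posterior_covariance_rate
    (s b α β : ℝ) (hs : 0 < s) (hb : 0 < b)
    (hα : 1 / 2 < α) (hβ : 0 ≤ β)
    (l : ℕ → ℝ) (m M : ℝ) (hm : 0 < m) (hmM : m ≤ M)
    (hl : ∀ j : ℕ, 1 ≤ j →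
      m * Real.exp (-s * (j : ℝ) ^ b) ≤ l j ∧ l j ≤ M * Real.exp (-s * (j : ℝ) ^ b)) :
    ∃ m' M' lam₀ : ℝ, 0 < m' ∧ m' ≤ M' ∧ 0 < lam₀ ∧
      ∀ lam : ℝ, 0 < lam → lam < lam₀ →
        m' * ((1 / (2 * s)) * Real.log (1 / lam)) ^ (-(2 * α - 1) / b)
          ≤ traceSum α β l lam ∧
        traceSum α β l lam
          ≤ M' * ((1 / (2 * s)) * Real.log (1 / lam)) ^ (-(2 * α - 1) / b) := by
  obtain ⟨p, hpdef⟩ : ∃ p, p = 2 * α - 1 := ⟨_, rfl⟩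
  have hp : 0 < p := by linarith
  have hM : 0 < M := hm.trans_le hmM
  obtain ⟨K, hK, hKb⟩ := rpow_le_const_mul_exp ((2 * β - 2 * α) / b) hs
  obtain ⟨Q, hQ, hQb⟩ := rpow_le_const_mul_exp (b⁻¹ + p / b) hs
  have hbound : ∃ m' M' : ℝ, 0 < m' ∧ 0 < M' ∧ ∀ lam L : ℝ, 2 ≤ L → lam⁻¹ = Real.exp (2 * s * L) →
      m' * L ^ (-p / b) ≤ traceSum α β l lam ∧ traceSum α β l lam ≤ M' * L ^ (-p / b) := by
    refine ⟨(p * (1 + M ^ 2 * K))⁻¹ * (3 ^ (-p) * 2 ^ (-p / b)),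
      m⁻¹ ^ 2 * Q + p⁻¹ * (2⁻¹ ^ (-p) * 2⁻¹ ^ (-p / b)), by positivity, by positivity,
      fun lam L hL hlam => ?_⟩
    have hL0 : 0 < L := by linarith
    have hl0 : ∀ j : ℕ, 0 ≤ l (j + 1) := fun j => le_trans (by positivity) (hl (j + 1) (by omega)).1
    have hw : ∀ j : ℕ, 0 ≤ lam⁻¹ * (l (j + 1)) ^ 2 * ((j : ℝ) + 1) ^ (2 * β - 2 * α) := fun j => by
      rw [hlam]; positivity
    have hx1 : ∀ j : ℕ, (1 : ℝ) ≤ (j : ℝ) + 1 := fun j => by linarith [j.cast_nonneg (α := ℝ)]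
    have hsq : ∀ (c y : ℝ), (c * Real.exp (-s * y)) ^ 2 = c ^ 2 * Real.exp (-2 * s * y) :=
      fun c y => by rw [mul_pow, ← Real.exp_nat_mul]; congr 2; push_cast; ring
    rw [traceSum, show -(2 * α) = -(p + 1) by rw [hpdef]; ring]
    constructor
    · have hX : 1 ≤ (2 * L) ^ b⁻¹ := Real.one_le_rpow (by linarith) (by positivity)
      refine le_trans ?_ (le_tsum_div_one_add hp hw (K := M ^ 2 * K) (k := ⌈(2 * L) ^ b⁻¹⌉₊)
        fun j hj => ?_)
      · have hk : (⌈(2 * L) ^ b⁻¹⌉₊ : ℝ) + 1 ≤ 3 * (2 * L) ^ b⁻¹ := by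
          linarith [Nat.ceil_lt_add_one (zero_le_one.trans hX)]
        rw [mul_assoc, mul_assoc, ← rpow_inv_mul_rpow_neg two_pos hL0,
          ← Real.mul_rpow (by norm_num) (by positivity)]
        gcongr _ * ?_
        exact Real.rpow_le_rpow_of_nonpos (by positivity) hk (by linarith)
      · have hjx : (2 * L) ^ b⁻¹ ≤ (j : ℝ) + 1 := by
          have := (Nat.ceil_le.1 hj)
          linarith
        have hxb : 2 * L ≤ ((j : ℝ) + 1) ^ b :=
          (Real.rpow_inv_le_iff_of_pos (by positivity) (by positivity) hb).1 hjx
        have hpow : ((j : ℝ) + 1) ^ (2 * β - 2 * α)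
            ≤ K * Real.exp (s * ((j : ℝ) + 1) ^ b) := by
          have := hKb _ (Real.one_le_rpow (hx1 j) hb.le)
          rwa [← Real.rpow_mul (by positivity), mul_div_cancel₀ _ hb.ne'] at this
        have hlj : l (j + 1) ^ 2 ≤ M ^ 2 * Real.exp (-2 * s * ((j : ℝ) + 1) ^ b) := by
          rw [← hsq]
          have := (hl (j + 1) (by omega)).2
          push_cast at this
          exact pow_le_pow_left₀ (hl0 j) this 2
        calc _ ≤ Real.exp (2 * s * L) * (M ^ 2 * Real.exp (-2 * s * ((j : ℝ) + 1) ^ b)) *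
              (K * Real.exp (s * ((j : ℝ) + 1) ^ b)) := by
              rw [hlam]; gcongr
          _ = M ^ 2 * K * Real.exp (2 * s * L + -2 * s * ((j : ℝ) + 1) ^ b
              + s * ((j : ℝ) + 1) ^ b) := by
              rw [Real.exp_add, Real.exp_add]; ring
          _ ≤ M ^ 2 * K * 1 := by
              gcongr
              rw [Real.exp_le_one_iff]
              nlinarith
          _ = _ := mul_one _
    · have hY : 1 ≤ (2⁻¹ * L) ^ b⁻¹ := Real.one_le_rpow (by linarith) (by positivity)
      have hY0 := zero_le_one.trans hY
      have hk : 0 < ⌊(2⁻¹ * L) ^ b⁻¹⌋₊ := Nat.floor_pos.2 hY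
      refine (tsum_div_one_add_le hp hw (ε := m⁻¹ ^ 2 * Real.exp (-s * L)) hk
        fun j hj => ?_).trans ?_
      · have hjx : (j : ℝ) + 1 ≤ (2⁻¹ * L) ^ b⁻¹ := by
          have := (Nat.le_floor_iff hY0).1 (Nat.succ_le_of_lt hj)
          push_cast at this
          exact this
        have hxb : ((j : ℝ) + 1) ^ b ≤ 2⁻¹ * L :=
          (Real.le_rpow_inv_iff_of_pos (by positivity) (by positivity) hb).1 hjx
        have hlj : m ^ 2 * Real.exp (-2 * s * ((j : ℝ) + 1) ^ b) ≤ l (j + 1) ^ 2 := by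
          rw [← hsq]
          have := (hl (j + 1) (by omega)).1
          push_cast at this
          exact pow_le_pow_left₀ (by positivity) this 2
        have hexp : 1 ≤ Real.exp (-s * L + 2 * s * L + -2 * s * ((j : ℝ) + 1) ^ b) := by
          rw [Real.one_le_exp_iff]
          nlinarith
        calc ((j : ℝ) + 1) ^ (-(p + 1)) ≤ 1 * ((j : ℝ) + 1) ^ (2 * β - 2 * α) := by
              rw [one_mul]
              exact Real.rpow_le_rpow_of_exponent_le (hx1 j) (by linarith)
          _ ≤ Real.exp (-s * L + 2 * s * L + -2 * s * ((j : ℝ) + 1) ^ b) *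
              ((j : ℝ) + 1) ^ (2 * β - 2 * α) := by gcongr
          _ = m⁻¹ ^ 2 * Real.exp (-s * L) * (Real.exp (2 * s * L) *
              (m ^ 2 * Real.exp (-2 * s * ((j : ℝ) + 1) ^ b)) *
              ((j : ℝ) + 1) ^ (2 * β - 2 * α)) := by
              rw [Real.exp_add, Real.exp_add]; field_simp
          _ ≤ _ := by rw [hlam]; gcongr
      · rw [add_mul]
        gcongr ?_ + ?_
        · have hkL : (⌊(2⁻¹ * L) ^ b⁻¹⌋₊ : ℝ) ≤ L ^ b⁻¹ :=
            (Nat.floor_le hY0).trans (by gcongr; linarith)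
          have hq := hQb L (by linarith)
          have hq' : L ^ b⁻¹ * Real.exp (-s * L) ≤ Q * L ^ (-p / b) := by
            rw [Real.rpow_add hL0] at hq
            rw [neg_mul, Real.exp_neg, neg_div, Real.rpow_neg hL0.le, ← div_eq_mul_inv,
              ← div_eq_mul_inv, div_le_div_iff₀ (by positivity) (by positivity)]
            exact hq
          calc _ ≤ L ^ b⁻¹ * (m⁻¹ ^ 2 * Real.exp (-s * L)) := by gcongr
            _ = m⁻¹ ^ 2 * (L ^ b⁻¹ * Real.exp (-s * L)) := by ring
            _ ≤ m⁻¹ ^ 2 * (Q * L ^ (-p / b)) := by gcongr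
            _ = _ := by ring
        · have hk1 : (1 : ℝ) ≤ ⌊(2⁻¹ * L) ^ b⁻¹⌋₊ := by exact_mod_cast hk
          have hkY : 2⁻¹ * (2⁻¹ * L) ^ b⁻¹ ≤ (⌊(2⁻¹ * L) ^ b⁻¹⌋₊ : ℝ) := by
            linarith [Nat.lt_floor_add_one ((2⁻¹ * L) ^ b⁻¹)]
          rw [mul_assoc, mul_assoc, ← rpow_inv_mul_rpow_neg (by norm_num) hL0,
            ← Real.mul_rpow (by norm_num) hY0]
          gcongr _ * ?_
          exact Real.rpow_le_rpow_of_nonpos (by positivity) hkY (by linarith)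
  obtain ⟨m', M', hm', hM', h⟩ := hbound
  refine ⟨m', max m' M', Real.exp (-(4 * s)), hm', le_max_left _ _, Real.exp_pos _,
    fun lam h0 hlt => ?_⟩
  have hlog : Real.log lam < -(4 * s) := (Real.log_lt_iff_lt_exp h0).2 hlt
  have hL : 2 ≤ 1 / (2 * s) * Real.log (1 / lam) := by
    rw [one_div lam, Real.log_inv, one_div_mul_eq_div, le_div_iff₀ (by positivity)]
    linarith
  have hlam : lam⁻¹ = Real.exp (2 * s * (1 / (2 * s) * Real.log (1 / lam))) := by
    rw [← mul_assoc, mul_one_div_cancel (by positivity), one_mul, one_div,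
      Real.exp_log (by positivity)]
  obtain ⟨h1, h2⟩ := h lam _ hL hlam
  rw [← hpdef]
  refine ⟨h1, h2.trans ?_⟩
  have : 0 ≤ (1 / (2 * s) * Real.log (1 / lam)) ^ (-p / b) := Real.rpow_nonneg (by linarith) _
  gcongr
  exact le_max_right _ _
end

section
/- Let γ > 0 and u† ∈ H^γ. For n ≥ 1 and τ > 0, set λ = 1/(nτ²) and define the squared posterior contraction SPC(n,τ) = (nλ²)^{-1} Σ_{j≥1} l_j² j^{2β−4α} (1 + λ^{-1} l_j² j^{2β−2α})^{-2} + Σ_{j≥1} (u†_j)² (1 + λ^{-1} l_j² j^{2β−2α})^{-2} + (nλ)^{-1} Σ_{j≥1} j^{-2α} (1 + λ^{-1} l_j² j^{2β−2α})^{-1}. Then for any sequence of positive reals τ_n with n τ_n² → ∞, there exist a constant M > 0 and n₀ such that for all n ≥ n₀, SPC(n, τ_n) ≤ M ε_n², where ε_n = (ln(n τ_n²))^{-γ/b} + τ_n (ln(n τ_n²))^{-(α−1/2)/b}. [Theorem 4.3, general form of the contraction rate (419), stated at the level of the squared posterior contraction SPC = MISE + Tr(C).] -/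
/-- The squared posterior contraction `SPC(n,τ) = MISE + Tr(C)`, with `λ = 1/(nτ²)`:
`SPC(n,τ) = (nλ²)⁻¹ Σ_{j≥1} l_j² j^{2β−4α} (1 + λ⁻¹ l_j² j^{2β−2α})⁻²
  + Σ_{j≥1} (u†_j)² (1 + λ⁻¹ l_j² j^{2β−2α})⁻²
  + (nλ)⁻¹ Σ_{j≥1} j^{-2α} (1 + λ⁻¹ l_j² j^{2β−2α})⁻¹`. -/
noncomputable def SPC (α β : ℝ) (l u : ℕ → ℝ) (n τ : ℝ) : ℝ :=
  (n * (1 / (n * τ ^ 2)) ^ 2)⁻¹ * ∑' j : ℕ,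
    (l (j + 1)) ^ 2 * ((j : ℝ) + 1) ^ (2 * β - 4 * α) /
      (1 + (1 / (n * τ ^ 2))⁻¹ * (l (j + 1)) ^ 2 * ((j : ℝ) + 1) ^ (2 * β - 2 * α)) ^ 2
  + ∑' j : ℕ,
    (u (j + 1)) ^ 2 /
      (1 + (1 / (n * τ ^ 2))⁻¹ * (l (j + 1)) ^ 2 * ((j : ℝ) + 1) ^ (2 * β - 2 * α)) ^ 2
  + (n * (1 / (n * τ ^ 2)))⁻¹ * ∑' j : ℕ,
    ((j : ℝ) + 1) ^ (-(2 * α)) /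
      (1 + (1 / (n * τ ^ 2))⁻¹ * (l (j + 1)) ^ 2 * ((j : ℝ) + 1) ^ (2 * β - 2 * α))

/-- A polynomial bound for the filter factors of a problem with singular values bounded below by
`m * exp (-s * j ^ b)`. -/
theorem eventually_filter_factor_le {s b α β m : ℝ} (q : ℝ) (hs : 0 < s) (hb : 0 < b)
    (hα : 0 ≤ α) (hβ : 0 ≤ β) (hq : 0 ≤ q) (hm : 0 < m) {l : ℕ → ℝ}
    (hl : ∀ j : ℕ, 1 ≤ j → m * Real.exp (-s * (j : ℝ) ^ b) ≤ l j) :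
    ∃ C : ℝ, 0 < C ∧ ∀ᶠ N : ℝ in Filter.atTop, ∀ j : ℕ,
      (1 + N * l (j + 1) ^ 2 * ((j : ℝ) + 1) ^ (2 * β - 2 * α))⁻¹ ≤
        C * Real.log N ^ (-(q / b)) * ((j : ℝ) + 1) ^ q := by
  have h4s : 0 < (4 * s) ^ (q / b) := by positivity
  refine ⟨(4 * s) ^ (q / b) + 1, by positivity, ?_⟩
  have hlim := (tendsto_rpow_mul_exp_neg_mul_atTop_nhds_zero ((2 * α + q) / b) (1 / 2)
    (by norm_num)).comp Real.tendsto_log_atTop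
  have hδ : 0 < m ^ 2 * (4 * s) ^ (2 * α / b) := by positivity
  filter_upwards [hlim.eventually (gt_mem_nhds hδ), Filter.eventually_gt_atTop 1]
    with N hN hN1 j
  simp only [Function.comp] at hN
  set L := Real.log N with hL
  have hL0 : 0 < L := Real.log_pos hN1
  have hN0 : 0 < N := by linarith
  have hNL : N = Real.exp L := (Real.exp_log hN0).symm
  set x : ℝ := (j : ℝ) + 1 with hx
  have hx1 : 1 ≤ x := by simp [hx]
  have hx0 : 0 < x := by linarith
  have hLq : 0 < L ^ (-(q / b)) := by positivity
  have hy0 : 0 ≤ N * l (j + 1) ^ 2 * x ^ (2 * β - 2 * α) := by positivity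
  rcases le_or_gt (L / (4 * s)) (x ^ b) with h | h
  · have h1 : (L / (4 * s)) ^ (q / b) ≤ x ^ q := by
      calc (L / (4 * s)) ^ (q / b) ≤ (x ^ b) ^ (q / b) := by gcongr
        _ = x ^ q := by rw [← Real.rpow_mul hx0.le]; congr 1; field_simp
    rw [Real.div_rpow hL0.le (by positivity), div_le_iff₀ h4s] at h1
    calc _ ≤ (1 : ℝ) := inv_le_one_of_one_le₀ (by linarith)
      _ = L ^ (-(q / b)) * L ^ (q / b) := by rw [← Real.rpow_add hL0]; simp
      _ ≤ L ^ (-(q / b)) * (x ^ q * (4 * s) ^ (q / b)) := by gcongr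
      _ = (4 * s) ^ (q / b) * L ^ (-(q / b)) * x ^ q := by ring
      _ ≤ _ := by gcongr; linarith
  · have hlj := hl (j + 1) (by omega)
    push_cast at hlj
    rw [← hx] at hlj
    have hexp : m ^ 2 * Real.exp (L / 2) ≤ N * l (j + 1) ^ 2 := by
      calc m ^ 2 * Real.exp (L / 2) ≤ m ^ 2 * Real.exp (L + (-s * x ^ b + -s * x ^ b)) := by
            gcongr
            rw [lt_div_iff₀ (by positivity)] at h
            linarith
        _ = N * (m * Real.exp (-s * x ^ b)) ^ 2 := by
            rw [Real.exp_add, Real.exp_add, ← hNL]; ring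
        _ ≤ _ := by gcongr
    have hxα : x ^ (2 * α) ≤ L ^ (2 * α / b) / (4 * s) ^ (2 * α / b) := by
      calc x ^ (2 * α) = (x ^ b) ^ (2 * α / b) := by
            rw [← Real.rpow_mul hx0.le]; congr 1; field_simp
        _ ≤ (L / (4 * s)) ^ (2 * α / b) := by gcongr
        _ = _ := Real.div_rpow hL0.le (by positivity) _
    have hxb : (x ^ (2 * α))⁻¹ ≤ x ^ (2 * β - 2 * α) := by
      rw [← Real.rpow_neg hx0.le]
      exact Real.rpow_le_rpow_of_exponent_le hx1 (by linarith)
    have hmul : L ^ (q / b) * x ^ (2 * α) ≤ m ^ 2 * Real.exp (L / 2) := by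
      calc L ^ (q / b) * x ^ (2 * α)
          ≤ L ^ (q / b) * (L ^ (2 * α / b) / (4 * s) ^ (2 * α / b)) := by gcongr
        _ = L ^ ((2 * α + q) / b) / (4 * s) ^ (2 * α / b) := by
            rw [← mul_div_assoc, ← Real.rpow_add hL0]; congr 2; ring
        _ ≤ m ^ 2 * Real.exp (L / 2) := by
            rw [div_le_iff₀ (by positivity)]
            have := mul_le_mul_of_nonneg_right hN.le (Real.exp_pos (L / 2)).le
            rw [mul_assoc, ← Real.exp_add] at this
            ring_nf at this ⊢
            simpa using this
    have hbig : L ^ (q / b) ≤ N * l (j + 1) ^ 2 * x ^ (2 * β - 2 * α) := by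
      calc L ^ (q / b) ≤ m ^ 2 * Real.exp (L / 2) * (x ^ (2 * α))⁻¹ := by
            rw [← div_eq_mul_inv, le_div_iff₀ (by positivity)]; exact hmul
        _ ≤ _ := by gcongr
    calc _ ≤ (L ^ (q / b))⁻¹ := by
          apply inv_anti₀ (by positivity); linarith
      _ = 1 * L ^ (-(q / b)) * 1 := by rw [Real.rpow_neg hL0.le]; ring
      _ ≤ _ := by
          gcongr
          · linarith
          · exact Real.one_le_rpow hx1 hq

theorem mul_rpow_neg_le_rpow_sub_rpow {p x : ℝ} (hp : 1 < p) (hx : 0 < x) :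
    (p - 1) * (x + 1) ^ (-p) ≤ x ^ (1 - p) - (x + 1) ^ (1 - p) := by
  have hx1 : 0 < x + 1 := by linarith
  have hlog := Real.one_sub_inv_le_log_of_pos (show 0 < (x + 1) / x by positivity)
  have h : 1 + (p - 1) * (x + 1)⁻¹ ≤ ((x + 1) / x) ^ (p - 1) := by
    rw [Real.rpow_def_of_pos (by positivity)]
    refine le_trans ?_ (Real.add_one_le_exp _)
    have e : 1 - ((x + 1) / x)⁻¹ = (x + 1)⁻¹ := by field_simp; ring
    rw [e] at hlog
    nlinarith
  have e1 : ((x + 1) / x) ^ (p - 1) * (x + 1) ^ (1 - p) = x ^ (1 - p) := by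
    rw [Real.div_rpow hx1.le hx.le, div_mul_eq_mul_div, ← Real.rpow_add hx1, ← neg_sub p 1,
      Real.rpow_neg hx.le]
    simp
  have e2 : (x + 1)⁻¹ * (x + 1) ^ (1 - p) = (x + 1) ^ (-p) := by
    rw [← Real.rpow_neg_one, ← Real.rpow_add hx1]; congr 1; ring
  have := mul_le_mul_of_nonneg_right h (Real.rpow_nonneg hx1.le (1 - p))
  rw [e1, add_mul, mul_assoc, e2] at this
  linarith

theorem sum_range_rpow_neg_le {p : ℝ} (hp : 1 < p) {k : ℕ} (hk : 0 < k) (J : ℕ) :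
    ∑ i ∈ Finset.range J, (((i + k : ℕ) : ℝ) + 1) ^ (-p) ≤ (k : ℝ) ^ (1 - p) / (p - 1) := by
  have hp1 : 0 < p - 1 := by linarith
  have key : ∑ i ∈ Finset.range J, (((i + k : ℕ) : ℝ) + 1) ^ (-p) ≤
      ((k : ℝ) ^ (1 - p) - ((J + k : ℕ) : ℝ) ^ (1 - p)) / (p - 1) := by
    induction J with
    | zero => simp
    | succ J ih =>
      rw [Finset.sum_range_succ]
      have h := mul_rpow_neg_le_rpow_sub_rpow hp (x := ((J + k : ℕ) : ℝ)) (by positivity)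
      rw [le_div_iff₀ hp1] at ih ⊢
      have e : ((J + 1 + k : ℕ) : ℝ) = ((J + k : ℕ) : ℝ) + 1 := by push_cast; ring
      rw [e]
      linarith
  refine key.trans ?_
  gcongr
  have : 0 ≤ ((J + k : ℕ) : ℝ) ^ (1 - p) := by positivity
  linarith

/-- A series dominated both by a constant multiple of `K ^ (-p)` and by `(j + 1) ^ (-p)` is at most
a constant multiple of `K ^ (1 - p)`. -/
theorem tsum_le_of_le_rpow_neg {p C K : ℝ} (hp : 1 < p) (hC : 0 ≤ C) (hK : 1 ≤ K) {f : ℕ → ℝ}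
    (hf0 : ∀ j, 0 ≤ f j) (hfK : ∀ j, f j ≤ C * K ^ (-p))
    (hf : ∀ j : ℕ, f j ≤ ((j : ℝ) + 1) ^ (-p)) :
    Summable f ∧ ∑' j, f j ≤ (2 * C + (p - 1)⁻¹) * K ^ (1 - p) := by
  have hp1 : 0 < p - 1 := by linarith
  have hK0 : 0 < K := by linarith
  have hsum : Summable f := by
    refine Summable.of_nonneg_of_le hf0 hf ?_
    have := (summable_nat_add_iff 1).2 (Real.summable_nat_rpow.2 (show -p < -1 by linarith))
    simpa using this
  refine ⟨hsum, ?_⟩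
  set k := ⌈K⌉₊ with hk
  have hkK : K ≤ k := Nat.le_ceil K
  have hk2 : (k : ℝ) ≤ 2 * K := by
    have := Nat.ceil_lt_add_one hK0.le
    rw [← hk] at this
    linarith
  have hk0 : 0 < k := Nat.ceil_pos.2 hK0
  rw [← hsum.sum_add_tsum_nat_add k]
  have h1 : ∑ i ∈ Finset.range k, f i ≤ 2 * C * K ^ (1 - p) := by
    calc ∑ i ∈ Finset.range k, f i ≤ ∑ i ∈ Finset.range k, C * K ^ (-p) :=
          Finset.sum_le_sum fun i _ => hfK i
      _ = k * (C * K ^ (-p)) := by simp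
      _ ≤ 2 * K * (C * K ^ (-p)) := by gcongr
      _ = 2 * C * K ^ (1 - p) := by
          rw [sub_eq_add_neg, Real.rpow_add hK0, Real.rpow_one]; ring
  have h2 : ∑' i, f (i + k) ≤ (p - 1)⁻¹ * K ^ (1 - p) := by
    refine Real.tsum_le_of_sum_range_le (fun i => hf0 _) fun J => ?_
    calc ∑ i ∈ Finset.range J, f (i + k)
        ≤ ∑ i ∈ Finset.range J, (((i + k : ℕ) : ℝ) + 1) ^ (-p) :=
          Finset.sum_le_sum fun i _ => hf _
      _ ≤ (k : ℝ) ^ (1 - p) / (p - 1) := sum_range_rpow_neg_le hp hk0 J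
      _ ≤ K ^ (1 - p) / (p - 1) := by
          gcongr ?_ / _
          exact Real.rpow_le_rpow_of_nonpos hK0 hkK (by linarith)
      _ = _ := by rw [div_eq_inv_mul]
  linarith

/-- The squared posterior contraction in terms of the filter parameter `N = nτ²`. -/
theorem SPC_le {α β n τ : ℝ} {l u : ℕ → ℝ} (hn : 0 < n) (hτ : 0 < τ)
    (hsum : Summable fun j : ℕ => ((j : ℝ) + 1) ^ (-(2 * α)) /
      (1 + n * τ ^ 2 * l (j + 1) ^ 2 * ((j : ℝ) + 1) ^ (2 * β - 2 * α))) :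
    SPC α β l u n τ ≤
      ∑' j : ℕ, u (j + 1) ^ 2 /
        (1 + n * τ ^ 2 * l (j + 1) ^ 2 * ((j : ℝ) + 1) ^ (2 * β - 2 * α)) ^ 2
      + 2 * τ ^ 2 * ∑' j : ℕ, ((j : ℝ) + 1) ^ (-(2 * α)) /
        (1 + n * τ ^ 2 * l (j + 1) ^ 2 * ((j : ℝ) + 1) ^ (2 * β - 2 * α)) := by
  unfold SPC
  simp only [one_div, inv_inv]
  have e1 : (n * (n * τ ^ 2)⁻¹ ^ 2)⁻¹ = τ ^ 2 * (n * τ ^ 2) := by field_simp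
  have e2 : (n * (n * τ ^ 2)⁻¹)⁻¹ = τ ^ 2 := by field_simp
  rw [e1, e2]
  set N := n * τ ^ 2 with hN
  have hN0 : 0 < N := by positivity
  have h : N * ∑' j : ℕ, l (j + 1) ^ 2 * ((j : ℝ) + 1) ^ (2 * β - 4 * α) /
        (1 + N * l (j + 1) ^ 2 * ((j : ℝ) + 1) ^ (2 * β - 2 * α)) ^ 2 ≤
      ∑' j : ℕ, ((j : ℝ) + 1) ^ (-(2 * α)) /
        (1 + N * l (j + 1) ^ 2 * ((j : ℝ) + 1) ^ (2 * β - 2 * α)) := by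
    rw [← tsum_mul_left]
    have hle : ∀ j : ℕ, N * (l (j + 1) ^ 2 * ((j : ℝ) + 1) ^ (2 * β - 4 * α) /
        (1 + N * l (j + 1) ^ 2 * ((j : ℝ) + 1) ^ (2 * β - 2 * α)) ^ 2) ≤
        ((j : ℝ) + 1) ^ (-(2 * α)) /
        (1 + N * l (j + 1) ^ 2 * ((j : ℝ) + 1) ^ (2 * β - 2 * α)) := by
      intro j
      have hj : (0 : ℝ) < (j : ℝ) + 1 := by positivity
      have e : ((j : ℝ) + 1) ^ (2 * β - 4 * α) =
          ((j : ℝ) + 1) ^ (2 * β - 2 * α) * ((j : ℝ) + 1) ^ (-(2 * α)) := by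
        rw [← Real.rpow_add hj]; congr 1; ring
      rw [e]
      set y := ((j : ℝ) + 1) ^ (2 * β - 2 * α)
      set z := ((j : ℝ) + 1) ^ (-(2 * α))
      have hy : 0 < y := by positivity
      have hz : 0 < z := by positivity
      have hw : 0 ≤ N * l (j + 1) ^ 2 * y := by positivity
      rw [← mul_div_assoc, div_le_div_iff₀ (by positivity) (by positivity)]
      have : 0 ≤ z * (1 + N * l (j + 1) ^ 2 * y) := by positivity
      nlinarith
    exact (hsum.of_nonneg_of_le (fun j => by positivity) hle).tsum_le_tsum hle hsum
  have := mul_le_mul_of_nonneg_left h (sq_nonneg τ)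
  linarith

/-- Theorem 4.3 (general form): if `n τ_n² → ∞` then
`SPC(n, τ_n) ≤ M ε_n²` for all large `n`, where
`ε_n = (ln(n τ_n²))^{-γ/b} + τ_n (ln(n τ_n²))^{-(α−1/2)/b}`. -/
theorem squared_posterior_contraction_rate
    (s b α β γ : ℝ) (hs : 0 < s) (hb : 0 < b)
    (hα : 1 / 2 < α) (hβ : 0 ≤ β) (hγ : 0 < γ)
    (l : ℕ → ℝ) (m M : ℝ) (hm : 0 < m) (hmM : m ≤ M)
    (hl : ∀ j : ℕ, 1 ≤ j →
      m * Real.exp (-s * (j : ℝ) ^ b) ≤ l j ∧ l j ≤ M * Real.exp (-s * (j : ℝ) ^ b))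
    (u : ℕ → ℝ)
    (hu : Summable (fun j : ℕ => ((j : ℝ) + 1) ^ (2 * γ) * (u (j + 1)) ^ 2))
    (τn : ℕ → ℝ) (hτn : ∀ n, 0 < τn n)
    (htend : Filter.Tendsto (fun n : ℕ => (n : ℝ) * (τn n) ^ 2) Filter.atTop Filter.atTop) :
    ∃ M' : ℝ, 0 < M' ∧ ∃ n₀ : ℕ, ∀ n : ℕ, n₀ ≤ n →
      SPC α β l u n (τn n) ≤ M' *
        ((Real.log ((n : ℝ) * (τn n) ^ 2)) ^ (-(γ / b))
          + τn n * (Real.log ((n : ℝ) * (τn n) ^ 2)) ^ (-((α - 1 / 2) / b))) ^ 2 := by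
  obtain ⟨C₁, hC₁, h₁⟩ := eventually_filter_factor_le (α := α) γ hs hb (by linarith) hβ hγ.le hm
    fun j hj => (hl j hj).1
  obtain ⟨C₂, hC₂, h₂⟩ := eventually_filter_factor_le (α := α) (2 * α) hs hb (by linarith) hβ
    (by linarith) hm fun j hj => (hl j hj).1
  set S := ∑' j : ℕ, ((j : ℝ) + 1) ^ (2 * γ) * (u (j + 1)) ^ 2 with hS
  have hS0 : 0 ≤ S := tsum_nonneg fun j => by positivity
  have hD0 : 0 < 2 * C₂ + (2 * α - 1)⁻¹ := by
    have : 0 < 2 * α - 1 := by linarith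
    positivity
  refine ⟨C₁ ^ 2 * S + 2 * (2 * C₂ + (2 * α - 1)⁻¹), by positivity, ?_⟩
  have hlog : ∀ᶠ N : ℝ in Filter.atTop, 1 ≤ Real.log N :=
    Real.tendsto_log_atTop.eventually_ge_atTop 1
  obtain ⟨n₀, hn₀⟩ := Filter.eventually_atTop.1 (htend.eventually
    (h₁.and (h₂.and (hlog.and (Filter.eventually_gt_atTop 0)))))
  refine ⟨n₀, fun n hn => ?_⟩
  obtain ⟨g₁, g₂, hL1, hN0⟩ := hn₀ n hn
  have hτ := hτn n
  have hnpos : (0 : ℝ) < n := pos_of_mul_pos_left hN0 (sq_nonneg _)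
  set N := (n : ℝ) * τn n ^ 2 with hN
  set L := Real.log N with hL
  have hL0 : 0 < L := by linarith
  have hx0 : ∀ j : ℕ, 0 < 1 + N * l (j + 1) ^ 2 * ((j : ℝ) + 1) ^ (2 * β - 2 * α) :=
    fun j => by positivity
  obtain ⟨hsum, hT⟩ := tsum_le_of_le_rpow_neg (p := 2 * α) (C := C₂) (K := L ^ (1 / b))
    (f := fun j : ℕ => ((j : ℝ) + 1) ^ (-(2 * α)) /
      (1 + N * l (j + 1) ^ 2 * ((j : ℝ) + 1) ^ (2 * β - 2 * α)))
    (by linarith) hC₂.le (Real.one_le_rpow hL1 (by positivity)) (fun j => by positivity)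
    (fun j => by
      have hj : (0 : ℝ) < (j : ℝ) + 1 := by positivity
      calc _ ≤ ((j : ℝ) + 1) ^ (-(2 * α)) *
            (C₂ * L ^ (-(2 * α / b)) * ((j : ℝ) + 1) ^ (2 * α)) := by
            rw [div_eq_mul_inv]; gcongr; exact g₂ j
        _ = C₂ * L ^ (-(2 * α / b)) *
            (((j : ℝ) + 1) ^ (-(2 * α)) * ((j : ℝ) + 1) ^ (2 * α)) := by ring
        _ = C₂ * L ^ (-(2 * α / b)) := by rw [← Real.rpow_add hj]; simp
        _ = C₂ * (L ^ (1 / b)) ^ (-(2 * α)) := by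
            rw [← Real.rpow_mul hL0.le]; congr 2; ring)
    (fun j => div_le_self (by positivity) (by
      have : 0 ≤ N * l (j + 1) ^ 2 * ((j : ℝ) + 1) ^ (2 * β - 2 * α) := by positivity
      linarith))
  have hB : ∑' j : ℕ, u (j + 1) ^ 2 /
      (1 + N * l (j + 1) ^ 2 * ((j : ℝ) + 1) ^ (2 * β - 2 * α)) ^ 2 ≤
      C₁ ^ 2 * S * (L ^ (-(γ / b))) ^ 2 := by
    have hle : ∀ j : ℕ, u (j + 1) ^ 2 /
        (1 + N * l (j + 1) ^ 2 * ((j : ℝ) + 1) ^ (2 * β - 2 * α)) ^ 2 ≤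
        (C₁ * L ^ (-(γ / b))) ^ 2 * (((j : ℝ) + 1) ^ (2 * γ) * u (j + 1) ^ 2) := by
      intro j
      have hj : (0 : ℝ) < (j : ℝ) + 1 := by positivity
      have hi := inv_nonneg.2 (hx0 j).le
      calc _ = u (j + 1) ^ 2 *
            (1 + N * l (j + 1) ^ 2 * ((j : ℝ) + 1) ^ (2 * β - 2 * α))⁻¹ ^ 2 := by
            rw [inv_pow, div_eq_mul_inv]
        _ ≤ u (j + 1) ^ 2 * (C₁ * L ^ (-(γ / b)) * ((j : ℝ) + 1) ^ γ) ^ 2 := by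
            gcongr; exact g₁ j
        _ = _ := by rw [two_mul γ, Real.rpow_add hj]; ring
    calc _ ≤ ∑' j : ℕ,
          (C₁ * L ^ (-(γ / b))) ^ 2 * (((j : ℝ) + 1) ^ (2 * γ) * u (j + 1) ^ 2) :=
          ((hu.mul_left _).of_nonneg_of_le (fun j => by positivity) hle).tsum_le_tsum hle
            (hu.mul_left _)
      _ = _ := by rw [tsum_mul_left, ← hS]; ring
  have hK : (L ^ (1 / b)) ^ (1 - 2 * α) = (L ^ (-((α - 1 / 2) / b))) ^ 2 := by
    rw [← Real.rpow_mul hL0.le, ← Real.rpow_natCast, ← Real.rpow_mul hL0.le]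
    congr 1; push_cast; ring
  rw [hK] at hT
  refine (SPC_le hnpos hτ hsum).trans ?_
  have hA0 : 0 < L ^ (-(γ / b)) := by positivity
  have hE0 : 0 < L ^ (-((α - 1 / 2) / b)) := by positivity
  set A := L ^ (-(γ / b))
  set E := L ^ (-((α - 1 / 2) / b))
  set D := 2 * C₂ + (2 * α - 1)⁻¹
  have hτT := mul_le_mul_of_nonneg_left hT (show 0 ≤ 2 * τn n ^ 2 by positivity)
  calc _ ≤ C₁ ^ 2 * S * A ^ 2 + 2 * D * (τn n * E) ^ 2 := by linarith
    _ ≤ C₁ ^ 2 * S * (A + τn n * E) ^ 2 + 2 * D * (A + τn n * E) ^ 2 := by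
        have : 0 < τn n * E := by positivity
        gcongr <;> linarith
    _ = _ := by ring
end

section
/- Let γ > 0 and u† ∈ H^γ, and take the fixed scaling τ = 1, so λ = 1/n. Then there exist a constant M > 0 and n₀ such that for all n ≥ n₀, SPC(n, 1) ≤ M (ln n)^{-2·min(γ, α−1/2)/b}, i.e. the posterior contracts about u† at rate (ln n)^{-min(γ, α−1/2)/b}. [Theorem 4.3, case τ(n) ≡ 1 of (420).] -/
open Filter Topology

/-- The decrement of `x ↦ x ^ (-p)` over a unit interval dominates its derivative at the right
endpoint. -/
lemma mul_rpow_le_rpow_sub_one_sub_rpow {p x : ℝ} (hp : 0 < p) (hx : 1 < x) :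
    p * x ^ (-(p + 1)) ≤ (x - 1) ^ (-p) - x ^ (-p) := by
  have hx0 : 0 < x := by linarith
  have hy : 0 < 1 - x⁻¹ := sub_pos.2 (inv_lt_one_of_one_lt₀ hx)
  have hlog : Real.log (1 - x⁻¹) ≤ -x⁻¹ := by
    have := Real.log_le_sub_one_of_pos hy
    linarith
  have hbern : 1 + p * x⁻¹ ≤ (1 - x⁻¹) ^ (-p) := by
    rw [Real.rpow_def_of_pos hy]
    have := Real.add_one_le_exp (Real.log (1 - x⁻¹) * -p)
    nlinarith
  have hfac : (x - 1) ^ (-p) = x ^ (-p) * (1 - x⁻¹) ^ (-p) := by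
    rw [← Real.mul_rpow hx0.le hy.le]
    congr 1
    field_simp
  have hpow : x ^ (-(p + 1)) = x ^ (-p) * x⁻¹ := by
    rw [neg_add, Real.rpow_add hx0, Real.rpow_neg_one]
  have hxp : 0 < x ^ (-p) := Real.rpow_pos_of_pos hx0 _
  rw [hfac, hpow]
  nlinarith [mul_le_mul_of_nonneg_left hbern hxp.le]

/-- Tail bound for the `p`-series. -/
lemma tsum_nat_add_rpow_neg_le {p : ℝ} (hp : 0 < p) {N : ℕ} (hN : 1 ≤ N) :
    ∑' j : ℕ, (((j + N : ℕ) : ℝ) + 1) ^ (-(p + 1)) ≤ (N : ℝ) ^ (-p) / p := by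
  have hN' : (1 : ℝ) ≤ N := by exact_mod_cast hN
  refine Real.tsum_le_of_sum_range_le (fun j => by positivity) fun k => ?_
  rw [le_div_iff₀ hp]
  have key : (∑ j ∈ Finset.range k, (((j + N : ℕ) : ℝ) + 1) ^ (-(p + 1))) * p
      ≤ (N : ℝ) ^ (-p) - ((k : ℝ) + N) ^ (-p) := by
    induction k with
    | zero => simp
    | succ k ih =>
      rw [Finset.sum_range_succ, add_mul]
      have h := mul_rpow_le_rpow_sub_one_sub_rpow hp
        (x := ((k + N : ℕ) : ℝ) + 1) (by push_cast; linarith [Nat.cast_nonneg (α := ℝ) k])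
      have e1 : ((k + N : ℕ) : ℝ) + 1 - 1 = (k : ℝ) + N := by push_cast; ring
      have e2 : ((k + 1 : ℕ) : ℝ) + N = ((k + N : ℕ) : ℝ) + 1 := by push_cast; ring
      rw [e1] at h
      rw [e2]
      linarith
  have : 0 ≤ ((k : ℝ) + N) ^ (-p) := by positivity
  linarith

/-- Splitting a damped series at `N`: the head is damped by `ε`, the tail is kept. -/
lemma tsum_mul_le_mul_tsum_add_tsum_nat_add {f w : ℕ → ℝ} {ε : ℝ} {N : ℕ} (hf0 : ∀ j, 0 ≤ f j)
    (hf : Summable f) (hε : 0 ≤ ε) (hw0 : ∀ j, 0 ≤ w j) (hw1 : ∀ j, w j ≤ 1)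
    (hw : ∀ j < N, w j ≤ ε) :
    ∑' j, f j * w j ≤ ε * ∑' j, f j + ∑' j, f (j + N) := by
  have hle : ∀ j, f j * w j ≤ f j := fun j => mul_le_of_le_one_right (hf0 j) (hw1 j)
  have hs : Summable fun j => f j * w j :=
    Summable.of_nonneg_of_le (fun j => mul_nonneg (hf0 j) (hw0 j)) hle hf
  rw [← hs.sum_add_tsum_nat_add N]
  refine add_le_add ?_ ?_
  · calc ∑ j ∈ Finset.range N, f j * w j ≤ ∑ j ∈ Finset.range N, ε * f j := by
          refine Finset.sum_le_sum fun j hj => ?_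
          rw [mul_comm]
          exact mul_le_mul_of_nonneg_right (hw j (Finset.mem_range.1 hj)) (hf0 j)
      _ = ε * ∑ j ∈ Finset.range N, f j := by rw [Finset.mul_sum]
      _ ≤ ε * ∑' j, f j :=
          mul_le_mul_of_nonneg_left (hf.sum_le_tsum _ fun j _ => hf0 j) hε
  · exact Summable.tsum_le_tsum (fun j => hle _) ((summable_nat_add_iff N).2 hs)
      ((summable_nat_add_iff N).2 hf)

/-- A series weighted by `(j + 1) ^ q` controls the tails of the unweighted one. -/
lemma tsum_nat_add_le_rpow_neg_mul_tsum {v : ℕ → ℝ} {q : ℝ} (hq : 0 ≤ q) (hv : ∀ j, 0 ≤ v j)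
    (hs : Summable fun j : ℕ => ((j : ℝ) + 1) ^ q * v j) {N : ℕ} (hN : 1 ≤ N) :
    ∑' j, v (j + N) ≤ (N : ℝ) ^ (-q) * ∑' j : ℕ, ((j : ℝ) + 1) ^ q * v j := by
  have hN' : (0 : ℝ) < N := by exact_mod_cast hN
  have hNq : (0 : ℝ) < (N : ℝ) ^ q := Real.rpow_pos_of_pos hN' _
  have hsN := (summable_nat_add_iff N).2 hs
  have hpt : ∀ j : ℕ, v (j + N) ≤ (N : ℝ) ^ (-q) * ((((j + N : ℕ) : ℝ) + 1) ^ q * v (j + N)) := by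
    intro j
    rw [Real.rpow_neg hN'.le, ← div_eq_inv_mul, le_div_iff₀ hNq, mul_comm]
    refine mul_le_mul_of_nonneg_right (Real.rpow_le_rpow hN'.le ?_ hq) (hv _)
    push_cast
    linarith [Nat.cast_nonneg (α := ℝ) j]
  have hR := hsN.mul_left ((N : ℝ) ^ (-q))
  calc ∑' j, v (j + N)
      ≤ ∑' j : ℕ, (N : ℝ) ^ (-q) * ((((j + N : ℕ) : ℝ) + 1) ^ q * v (j + N)) :=
        Summable.tsum_le_tsum hpt (Summable.of_nonneg_of_le (fun j => hv _) hpt hR) hR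
    _ = (N : ℝ) ^ (-q) * ∑' j : ℕ, (((j + N : ℕ) : ℝ) + 1) ^ q * v (j + N) := tsum_mul_left
    _ ≤ _ := by
        refine mul_le_mul_of_nonneg_left ?_ (by positivity)
        rw [← hs.sum_add_tsum_nat_add N]
        refine le_add_of_nonneg_left (Finset.sum_nonneg fun j _ => ?_)
        exact mul_nonneg (by positivity) (hv j)

/-- For unit scaling the variance term is dominated by the trace of the posterior covariance. -/
lemma SPC_one_le {α β : ℝ} (hα : 1 / 2 < α) (l u : ℕ → ℝ) {n : ℝ} (hn : 0 < n)
    (hu : Summable fun j => u (j + 1) ^ 2) :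
    SPC α β l u n 1 ≤
      2 * ∑' j : ℕ, ((j : ℝ) + 1) ^ (-(2 * α)) *
        (1 + n * l (j + 1) ^ 2 * ((j : ℝ) + 1) ^ (2 * β - 2 * α))⁻¹
      + ∑' j : ℕ, u (j + 1) ^ 2 *
        (1 + n * l (j + 1) ^ 2 * ((j : ℝ) + 1) ^ (2 * β - 2 * α))⁻¹ := by
  have hsum : Summable fun j : ℕ => ((j : ℝ) + 1) ^ (-(2 * α)) := by
    have := (summable_nat_add_iff 1).2 (Real.summable_nat_rpow.2 (show -(2 * α) < -1 by linarith))
    simpa using this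
  set a : ℕ → ℝ := fun j => n * l (j + 1) ^ 2 * ((j : ℝ) + 1) ^ (2 * β - 2 * α) with ha
  have ha0 : ∀ j, 0 ≤ a j := fun j => by positivity
  have hinv1 : ∀ j, (1 + a j)⁻¹ ≤ 1 := fun j => inv_le_one_of_one_le₀ (by linarith [ha0 j])
  have hinv0 : ∀ j, 0 ≤ (1 + a j)⁻¹ := fun j => inv_nonneg.2 (by linarith [ha0 j])
  have hsA : Summable fun j : ℕ => ((j : ℝ) + 1) ^ (-(2 * α)) * (1 + a j)⁻¹ :=
    Summable.of_nonneg_of_le (fun j => mul_nonneg (by positivity) (hinv0 j))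
      (fun j => mul_le_of_le_one_right (by positivity) (hinv1 j)) hsum
  have hsU : Summable fun j : ℕ => u (j + 1) ^ 2 * (1 + a j)⁻¹ :=
    Summable.of_nonneg_of_le (fun j => mul_nonneg (sq_nonneg _) (hinv0 j))
      (fun j => mul_le_of_le_one_right (sq_nonneg _) (hinv1 j)) hu
  have hpt1 : ∀ j : ℕ, n * (l (j + 1) ^ 2 * ((j : ℝ) + 1) ^ (2 * β - 4 * α) / (1 + a j) ^ 2)
      ≤ ((j : ℝ) + 1) ^ (-(2 * α)) * (1 + a j)⁻¹ := by
    intro j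
    have hx : (0 : ℝ) < (j : ℝ) + 1 := by positivity
    have hpos : 0 < 1 + a j := by linarith [ha0 j]
    have e : ((j : ℝ) + 1) ^ (2 * β - 4 * α)
        = ((j : ℝ) + 1) ^ (-(2 * α)) * ((j : ℝ) + 1) ^ (2 * β - 2 * α) := by
      rw [← Real.rpow_add hx]; congr 1; ring
    have e2 : n * (l (j + 1) ^ 2 * ((j : ℝ) + 1) ^ (2 * β - 4 * α) / (1 + a j) ^ 2)
        = (((j : ℝ) + 1) ^ (-(2 * α)) * (1 + a j)⁻¹) * (a j / (1 + a j)) := by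
      have : a j = n * l (j + 1) ^ 2 * ((j : ℝ) + 1) ^ (2 * β - 2 * α) := rfl
      rw [e]
      field_simp
      rw [this]
      ring_nf
    rw [e2]
    refine mul_le_of_le_one_right (mul_nonneg (by positivity) (hinv0 j)) ?_
    rw [div_le_one hpos]
    linarith
  have hpt2 : ∀ j : ℕ, u (j + 1) ^ 2 / (1 + a j) ^ 2 ≤ u (j + 1) ^ 2 * (1 + a j)⁻¹ := by
    intro j
    rw [div_eq_mul_inv]
    refine mul_le_mul_of_nonneg_left ?_ (sq_nonneg _)
    rw [sq, mul_inv]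
    exact mul_le_of_le_one_right (hinv0 j) (hinv1 j)
  have h1 : n * ∑' j : ℕ, l (j + 1) ^ 2 * ((j : ℝ) + 1) ^ (2 * β - 4 * α) / (1 + a j) ^ 2
      ≤ ∑' j : ℕ, ((j : ℝ) + 1) ^ (-(2 * α)) * (1 + a j)⁻¹ := by
    rw [← tsum_mul_left]
    exact Summable.tsum_le_tsum hpt1
      (Summable.of_nonneg_of_le (fun j => by positivity) hpt1 hsA) hsA
  have h2 : ∑' j : ℕ, u (j + 1) ^ 2 / (1 + a j) ^ 2 ≤ ∑' j : ℕ, u (j + 1) ^ 2 * (1 + a j)⁻¹ :=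
    Summable.tsum_le_tsum hpt2
      (Summable.of_nonneg_of_le (fun j => by positivity) hpt2 hsU) hsU
  have c1 : (n * (1 / (n * 1 ^ 2)) ^ 2)⁻¹ = n := by field_simp
  have c2 : (1 / (n * 1 ^ 2))⁻¹ = n := by field_simp
  have c3 : (n * (1 / (n * 1 ^ 2)))⁻¹ = 1 := by field_simp
  unfold SPC
  rw [c1, c2, c3, one_mul]
  simp only [ha, div_eq_mul_inv] at h1 h2 ⊢
  linarith

/-- Theorem 4.3, case `τ(n) ≡ 1` of (420): the posterior contracts about `u†`
at rate `(ln n)^{-min(γ, α−1/2)/b}`, i.e.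
`SPC(n,1) ≤ M (ln n)^{-2 min(γ, α−1/2)/b}` for all large `n`. -/
theorem squared_posterior_contraction_fixed_tau
    (s b α β γ : ℝ) (hs : 0 < s) (hb : 0 < b)
    (hα : 1 / 2 < α) (hβ : 0 ≤ β) (hγ : 0 < γ)
    (l : ℕ → ℝ) (m M : ℝ) (hm : 0 < m) (hmM : m ≤ M)
    (hl : ∀ j : ℕ, 1 ≤ j →
      m * Real.exp (-s * (j : ℝ) ^ b) ≤ l j ∧ l j ≤ M * Real.exp (-s * (j : ℝ) ^ b))
    (u : ℕ → ℝ)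
    (hu : Summable (fun j : ℕ => ((j : ℝ) + 1) ^ (2 * γ) * (u (j + 1)) ^ 2)) :
    ∃ M' : ℝ, 0 < M' ∧ ∃ n₀ : ℕ, ∀ n : ℕ, n₀ ≤ n →
      SPC α β l u n 1 ≤ M' *
        (Real.log (n : ℝ)) ^ (-(2 * min γ (α - 1 / 2)) / b) := by
  have hγ2 : (0 : ℝ) ≤ 2 * γ := by linarith
  set q : ℝ := 2 * min γ (α - 1 / 2) with hq
  have hq0 : 0 < q := mul_pos two_pos (lt_min hγ (by linarith))
  have hqγ : q ≤ 2 * γ := by linarith [min_le_left γ (α - 1 / 2)]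
  have hqα : q ≤ 2 * α - 1 := by linarith [min_le_right γ (α - 1 / 2)]
  have hsA : Summable fun j : ℕ => ((j : ℝ) + 1) ^ (-(2 * α)) := by
    have := (summable_nat_add_iff 1).2 (Real.summable_nat_rpow.2 (show -(2 * α) < -1 by linarith))
    simpa using this
  have hsU : Summable fun j : ℕ => u (j + 1) ^ 2 :=
    Summable.of_nonneg_of_le (fun j => sq_nonneg _)
      (fun j => le_mul_of_one_le_left (sq_nonneg _)
        (Real.one_le_rpow (by linarith [Nat.cast_nonneg (α := ℝ) j]) hγ2)) hu
  set A : ℝ := ∑' j : ℕ, ((j : ℝ) + 1) ^ (-(2 * α)) with hA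
  set U : ℝ := ∑' j : ℕ, u (j + 1) ^ 2 with hU
  set V : ℝ := ∑' j : ℕ, ((j : ℝ) + 1) ^ (2 * γ) * u (j + 1) ^ 2 with hV
  have hA0 : 0 ≤ A := tsum_nonneg fun j => by positivity
  have hU0 : 0 ≤ U := tsum_nonneg fun j => by positivity
  have hV0 : 0 ≤ V := tsum_nonneg fun j => by positivity
  have hp : 0 < 2 * α - 1 := by linarith
  -- `N = ⌊J⌋` with `J = (ln n / (4 s)) ^ (1 / b)` is the truncation index.
  set c : ℝ := (4 * s)⁻¹ with hc
  have hc0 : 0 < c := by positivity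
  set D : ℝ := (c ^ (1 / b) / 2) ^ (-q) with hD
  have hD0 : 0 < D := by positivity
  set E : ℝ := (c ^ (1 / b)) ^ (2 * α) / m ^ 2 with hE
  have hE0 : 0 < E := by positivity
  have hloglim : Tendsto (fun n : ℕ => Real.log (n : ℝ)) atTop atTop :=
    Real.tendsto_log_atTop.comp tendsto_natCast_atTop_atTop
  have hlim := (tendsto_rpow_mul_exp_neg_mul_atTop_nhds_zero
    ((2 * α + q) / b) (1 / 2) (by norm_num)).comp hloglim
  have hev1 := hlim.eventually (gt_mem_nhds (zero_lt_one' ℝ))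
  have hJlim : Tendsto (fun n : ℕ => (c * Real.log (n : ℝ)) ^ (1 / b)) atTop atTop :=
    (tendsto_rpow_atTop (by positivity)).comp (hloglim.const_mul_atTop hc0)
  obtain ⟨n₀, hn₀⟩ := eventually_atTop.1
    (hev1.and ((hJlim.eventually_ge_atTop 1).and (hloglim.eventually_ge_atTop 1)))
  refine ⟨2 * (E * A + D / (2 * α - 1)) + (E * U + D * V), by positivity, max n₀ 1,
    fun n hn => ?_⟩
  obtain ⟨hexp, hJ1, hK1⟩ := hn₀ n (le_of_max_le_left hn)
  have hn0 : (0 : ℝ) < n := by exact_mod_cast (le_of_max_le_right hn)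
  simp only [Function.comp_apply] at hexp
  set K : ℝ := Real.log (n : ℝ) with hK
  have hK0 : 0 < K := by linarith
  set J : ℝ := (c * K) ^ (1 / b) with hJ
  have hJ0 : 0 < J := by linarith
  have hJb : J ^ b = c * K := by
    rw [hJ, ← Real.rpow_mul (by positivity), one_div_mul_cancel hb.ne', Real.rpow_one]
  have hJK : J = c ^ (1 / b) * K ^ (1 / b) := Real.mul_rpow hc0.le hK0.le
  set N : ℕ := ⌊J⌋₊ with hN
  have hN1 : 1 ≤ N := Nat.le_floor (by simpa using hJ1)
  have hN1' : (1 : ℝ) ≤ N := by exact_mod_cast hN1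
  have hNJ : (N : ℝ) ≤ J := Nat.floor_le hJ0.le
  have hJN : J / 2 ≤ N := by
    have := Nat.lt_floor_add_one J
    linarith
  have hNq : (N : ℝ) ^ (-q) ≤ D * K ^ (-q / b) := by
    calc (N : ℝ) ^ (-q) ≤ (J / 2) ^ (-q) :=
          Real.rpow_le_rpow_of_nonpos (by positivity) hJN (by linarith)
      _ = D * K ^ (-q / b) := by
          rw [hD, hJK, mul_div_right_comm, Real.mul_rpow (by positivity) (by positivity),
            ← Real.rpow_mul hK0.le]
          congr 2
          ring
  have hNr : ∀ r, q ≤ r → (N : ℝ) ^ (-r) ≤ D * K ^ (-q / b) := fun r hr =>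
    (Real.rpow_le_rpow_of_exponent_le hN1' (by linarith)).trans hNq
  set ε : ℝ := Real.exp (-(1 / 2) * K) * J ^ (2 * α) / m ^ 2 with hε
  have hε0 : 0 < ε := by positivity
  have hεK : ε ≤ E * K ^ (-q / b) := by
    have e1 : J ^ (2 * α) = (c ^ (1 / b)) ^ (2 * α) * K ^ (2 * α / b) := by
      rw [hJK, Real.mul_rpow (by positivity) (by positivity), ← Real.rpow_mul hK0.le]
      congr 2
      ring
    have e2 : K ^ (2 * α / b) = K ^ ((2 * α + q) / b) * K ^ (-q / b) := by
      rw [← Real.rpow_add hK0]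
      congr 1
      ring
    have e3 : ε = E * K ^ (-q / b) * (K ^ ((2 * α + q) / b) * Real.exp (-(1 / 2) * K)) := by
      rw [hε, hE, e1, e2]
      ring
    rw [e3]
    exact mul_le_of_le_one_right (by positivity) hexp.le
  set w : ℕ → ℝ := fun j =>
    (1 + n * l (j + 1) ^ 2 * ((j : ℝ) + 1) ^ (2 * β - 2 * α))⁻¹ with hw
  have hw0 : ∀ j, 0 ≤ w j := fun j => by positivity
  have hw1 : ∀ j, w j ≤ 1 := fun j => inv_le_one_of_one_le₀ (le_add_of_nonneg_right (by positivity))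
  have hwε : ∀ j < N, w j ≤ ε := by
    intro j hj
    have hx1 : (1 : ℝ) ≤ (j : ℝ) + 1 := by linarith [Nat.cast_nonneg (α := ℝ) j]
    have hx0 : (0 : ℝ) < (j : ℝ) + 1 := by linarith
    have hxJ : (j : ℝ) + 1 ≤ J := le_trans (by exact_mod_cast hj) hNJ
    have hxb : ((j : ℝ) + 1) ^ b ≤ c * K := hJb ▸ Real.rpow_le_rpow hx0.le hxJ hb.le
    have hlj : m * Real.exp (-(1 / 4) * K) ≤ l (j + 1) := by
      refine le_trans ?_ (hl (j + 1) (Nat.le_add_left 1 j)).1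
      refine mul_le_mul_of_nonneg_left (Real.exp_le_exp.2 ?_) hm.le
      push_cast
      have : s * ((j : ℝ) + 1) ^ b ≤ s * (c * K) := mul_le_mul_of_nonneg_left hxb hs.le
      have e : s * (c * K) = 1 / 4 * K := by rw [hc]; field_simp
      linarith
    have hlj2 : m ^ 2 * Real.exp (-(1 / 2) * K) ≤ l (j + 1) ^ 2 := by
      have h := pow_le_pow_left₀ (by positivity) hlj 2
      have e : ((2 : ℕ) : ℝ) * (-(1 / 4) * K) = -(1 / 2) * K := by push_cast; ring
      rwa [mul_pow, ← Real.exp_nat_mul, e] at h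
    have hpow : J ^ (-(2 * α)) ≤ ((j : ℝ) + 1) ^ (2 * β - 2 * α) :=
      (Real.rpow_le_rpow_of_nonpos hx0 hxJ (by linarith)).trans
        (Real.rpow_le_rpow_of_exponent_le hx1 (by linarith))
    have hnK : (n : ℝ) = Real.exp (1 / 2 * K) * Real.exp (1 / 2 * K) := by
      rw [← Real.exp_add, ← add_mul, add_halves, one_mul, hK, Real.exp_log hn0]
    have hεinv : ε⁻¹ = n * (m ^ 2 * Real.exp (-(1 / 2) * K)) * J ^ (-(2 * α)) := by
      rw [hε, hnK, Real.rpow_neg hJ0.le, neg_mul, Real.exp_neg]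
      field_simp
    have hle : ε⁻¹ ≤ 1 + n * l (j + 1) ^ 2 * ((j : ℝ) + 1) ^ (2 * β - 2 * α) := by
      rw [hεinv]
      refine le_trans ?_ (le_add_of_nonneg_left zero_le_one)
      gcongr
    exact inv_le_of_inv_le₀ hε0 hle
  have hT : ∑' j : ℕ, ((j : ℝ) + 1) ^ (-(2 * α)) * w j
      ≤ (E * A + D / (2 * α - 1)) * K ^ (-q / b) := by
    have h1 := tsum_mul_le_mul_tsum_add_tsum_nat_add (fun j => by positivity) hsA hε0.le
      hw0 hw1 hwε
    have h2 := tsum_nat_add_rpow_neg_le hp hN1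
    rw [sub_add_cancel] at h2
    have h3 : (N : ℝ) ^ (-(2 * α - 1)) / (2 * α - 1) ≤ D * K ^ (-q / b) / (2 * α - 1) :=
      div_le_div_of_nonneg_right (hNr _ hqα) hp.le
    have h4 := mul_le_mul_of_nonneg_right hεK hA0
    calc _ ≤ _ := h1
      _ ≤ E * K ^ (-q / b) * A + D * K ^ (-q / b) / (2 * α - 1) :=
          add_le_add h4 (h2.trans h3)
      _ = _ := by ring
  have hB : ∑' j : ℕ, u (j + 1) ^ 2 * w j ≤ (E * U + D * V) * K ^ (-q / b) := by
    have h1 := tsum_mul_le_mul_tsum_add_tsum_nat_add (fun j => sq_nonneg (u (j + 1))) hsU hε0.le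
      hw0 hw1 hwε
    have h2 := tsum_nat_add_le_rpow_neg_mul_tsum hγ2 (fun j => sq_nonneg (u (j + 1))) hu hN1
    have h3 := mul_le_mul_of_nonneg_right (hNr _ hqγ) hV0
    have h4 := mul_le_mul_of_nonneg_right hεK hU0
    calc _ ≤ _ := h1
      _ ≤ E * K ^ (-q / b) * U + D * K ^ (-q / b) * V := add_le_add h4 (h2.trans h3)
      _ = _ := by ring
  calc SPC α β l u n 1 ≤ _ := SPC_one_le hα l u hn0 hsU
    _ ≤ 2 * ((E * A + D / (2 * α - 1)) * K ^ (-q / b)) + (E * U + D * V) * K ^ (-q / b) :=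
        add_le_add (mul_le_mul_of_nonneg_left hT two_pos.le) hB
    _ = _ := by ring
end

section
/- Let γ > 0 and u† ∈ H^γ, let σ ∈ (0, 1/2), and let (τ_n) be a sequence of positive reals satisfying c₁ n^{-1/2+σ} ≤ τ_n ≤ c₂ (ln n)^{(α−γ−1/2)/b} for all large n (for some constants c₁, c₂ > 0). Then there exist a constant M > 0 and n₀ such that for all n ≥ n₀, SPC(n, τ_n) ≤ M (ln n)^{-2γ/b}, i.e. the posterior contracts about u† at the rate (ln n)^{-γ/b}, which is the minimax rate. [Theorem 4.3, second case of (420).] -/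
/-- Telescoping bound used for the tail of a `p`-series. -/
lemma rpow_neg_sub_rpow_neg_ge {p y : ℝ} (hp : 0 < p) (hy : 0 < y) :
    p * (y + 1) ^ (-(p + 1)) ≤ y ^ (-p) - (y + 1) ^ (-p) := by
  have hy1 : 0 < y + 1 := by linarith
  have hlog : 1 / (y + 1) ≤ Real.log ((y + 1) / y) := by
    have h := Real.one_sub_inv_le_log_of_pos (div_pos hy1 hy)
    have e : 1 - ((y + 1) / y)⁻¹ = 1 / (y + 1) := by
      field_simp
      ring
    rwa [e] at h
  have hbern : 1 + p * (1 / (y + 1)) ≤ ((y + 1) / y) ^ p := by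
    rw [Real.rpow_def_of_pos (div_pos hy1 hy)]
    have h := Real.add_one_le_exp (Real.log ((y + 1) / y) * p)
    have h' := mul_le_mul_of_nonneg_left hlog hp.le
    linarith
  have e1 : y ^ (-p) = (y + 1) ^ (-p) * ((y + 1) / y) ^ p := by
    rw [Real.div_rpow hy1.le hy.le, Real.rpow_neg hy.le, Real.rpow_neg hy1.le]
    have := (Real.rpow_pos_of_pos hy1 p).ne'
    field_simp
  have e2 : (y + 1) ^ (-(p + 1)) = (y + 1) ^ (-p) * (1 / (y + 1)) := by
    rw [neg_add, Real.rpow_add hy1, Real.rpow_neg_one, one_div]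
  rw [e1, e2]
  have h := mul_le_mul_of_nonneg_left hbern (Real.rpow_pos_of_pos hy1 (-p)).le
  linarith

lemma sum_range_shifted_rpow_le {p J : ℝ} (hp : 0 < p) (hJ : 0 < J) (n : ℕ) :
    ∑ j ∈ Finset.range n, ((j : ℝ) + 1 + J) ^ (-(p + 1)) ≤ J ^ (-p) / p := by
  have key : p * ∑ j ∈ Finset.range n, ((j : ℝ) + 1 + J) ^ (-(p + 1))
      ≤ J ^ (-p) - ((n : ℝ) + J) ^ (-p) := by
    induction n with
    | zero => simp
    | succ k ih =>
      rw [Finset.sum_range_succ, mul_add]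
      have h := rpow_neg_sub_rpow_neg_ge hp (y := (k : ℝ) + J) (by positivity)
      have e : (k : ℝ) + J + 1 = (k : ℝ) + 1 + J := by ring
      rw [e] at h
      push_cast
      linarith
  rw [le_div_iff₀ hp]
  have : 0 ≤ ((n : ℝ) + J) ^ (-p) := by positivity
  linarith

lemma summable_shifted_rpow {p J : ℝ} (hp : 0 < p) (hJ : 0 < J) :
    Summable (fun j : ℕ => ((j : ℝ) + 1 + J) ^ (-(p + 1))) :=
  summable_of_sum_range_le (fun j => by positivity) (sum_range_shifted_rpow_le hp hJ)

lemma tsum_shifted_rpow_le {p J : ℝ} (hp : 0 < p) (hJ : 0 < J) :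
    ∑' j : ℕ, ((j : ℝ) + 1 + J) ^ (-(p + 1)) ≤ J ^ (-p) / p :=
  Real.tsum_le_of_sum_range_le (fun j => by positivity) (sum_range_shifted_rpow_le hp hJ)

/-- Damping below the cutoff `q * J` together with decay above it: bias version. -/
lemma inv_one_add_sq_le {α γ q J E k x : ℝ} (hα : 0 < α) (hγ : 0 < γ) (hq : 0 < q) (hJ : 0 < J)
    (hk : 1 ≤ k) (hx : 0 ≤ x) (hE : q ^ (2 * α) * J ^ (2 * α + 2 * γ) ≤ E)
    (h : k ≤ q * J → E ≤ x * k ^ (2 * α)) :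
    1 / (1 + x) ^ 2 ≤ (1 + q ^ (-(2 * γ))) * J ^ (-(2 * γ)) * k ^ (2 * γ) := by
  have hk0 : 0 < k := by linarith
  have hkγ : 1 ≤ k ^ (2 * γ) := Real.one_le_rpow hk (by positivity)
  have hqg : 0 < q ^ (-(2 * γ)) := by positivity
  have hJg : 0 < J ^ (-(2 * γ)) := by positivity
  rcases le_total k (q * J) with hle | hle
  · have hEx := h hle
    have hE0 : 0 < E := lt_of_lt_of_le (by positivity) hE
    have hkα : k ^ (2 * α) ≤ q ^ (2 * α) * J ^ (2 * α) := by
      rw [← Real.mul_rpow hq.le hJ.le]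
      exact Real.rpow_le_rpow hk0.le hle (by positivity)
    have hbig : J ^ (2 * γ) ≤ x := by
      have h1 : q ^ (2 * α) * J ^ (2 * α) * J ^ (2 * γ) ≤ x * (q ^ (2 * α) * J ^ (2 * α)) := by
        calc q ^ (2 * α) * J ^ (2 * α) * J ^ (2 * γ)
            = q ^ (2 * α) * J ^ (2 * α + 2 * γ) := by rw [Real.rpow_add hJ]; ring
          _ ≤ x * k ^ (2 * α) := hE.trans hEx
          _ ≤ _ := mul_le_mul_of_nonneg_left hkα hx
      have h2 : 0 < q ^ (2 * α) * J ^ (2 * α) := by positivity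
      rw [mul_comm x] at h1
      exact le_of_mul_le_mul_left h1 h2
    have hJp : 0 < J ^ (2 * γ) := by positivity
    have h3 : 1 / (1 + x) ^ 2 ≤ J ^ (-(2 * γ)) := by
      rw [Real.rpow_neg hJ.le, ← one_div]
      exact one_div_le_one_div_of_le hJp (by nlinarith)
    calc 1 / (1 + x) ^ 2 ≤ 1 * J ^ (-(2 * γ)) * 1 := by linarith
      _ ≤ _ := by gcongr; linarith
  · have h1 : 1 / (1 + x) ^ 2 ≤ 1 := by
      rw [div_le_one (by positivity)]; nlinarith
    have h2 : (q * J) ^ (2 * γ) ≤ k ^ (2 * γ) :=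
      Real.rpow_le_rpow (by positivity) hle (by positivity)
    have h3 : q ^ (-(2 * γ)) * J ^ (-(2 * γ)) * (q * J) ^ (2 * γ) = 1 := by
      rw [← Real.mul_rpow hq.le hJ.le, ← Real.rpow_add (by positivity)]
      simp
    calc 1 / (1 + x) ^ 2 ≤ q ^ (-(2 * γ)) * J ^ (-(2 * γ)) * (q * J) ^ (2 * γ) := by
          rw [h3]; exact h1
      _ ≤ _ := by gcongr; linarith

/-- Damping below the cutoff `q * J` together with decay above it: variance version. -/
lemma rpow_div_one_add_le {α q J E k x : ℝ} (hα : 0 < α) (hq : 0 < q) (hJ : 0 < J)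
    (hk : 1 ≤ k) (hx : 0 ≤ x) (hE : ((1 + q) * J) ^ (2 * α) ≤ E)
    (h : k ≤ q * J → E ≤ x * k ^ (2 * α)) :
    k ^ (-(2 * α)) / (1 + x) ≤ (1 + (1 + 1 / q) ^ (2 * α)) * (k + J) ^ (-(2 * α)) := by
  have hk0 : 0 < k := by linarith
  have hkJ : 0 < k + J := by positivity
  have hp : 0 < (k + J) ^ (2 * α) := by positivity
  have hkp : 0 < k ^ (2 * α) := by positivity
  have hQ : 0 < (1 + 1 / q) ^ (2 * α) := by positivity
  rw [Real.rpow_neg hk0.le, Real.rpow_neg hkJ.le, ← div_eq_mul_inv, inv_eq_one_div, div_div,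
    div_le_div_iff₀ (by positivity) hp, one_mul]
  rcases le_total k (q * J) with hle | hle
  · have h1 : (k + J) ^ (2 * α) ≤ ((1 + q) * J) ^ (2 * α) :=
      Real.rpow_le_rpow hkJ.le (by linarith) (by positivity)
    have h2 : (k + J) ^ (2 * α) ≤ k ^ (2 * α) * (1 + x) := by
      have := h hle
      linarith
    have h3 : 0 ≤ (1 + 1 / q) ^ (2 * α) * (k ^ (2 * α) * (1 + x)) := by positivity
    linarith
  · have h1 : (k + J) ^ (2 * α) ≤ ((1 + 1 / q) * k) ^ (2 * α) := by
      refine Real.rpow_le_rpow hkJ.le ?_ (by positivity)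
      have : J ≤ 1 / q * k := by
        rw [one_div, inv_mul_eq_div, le_div_iff₀ hq]; linarith
      linarith
    rw [Real.mul_rpow (by positivity) hk0.le] at h1
    have h2 : 0 ≤ k ^ (2 * α) * (1 + x) := by positivity
    have h3 : 0 ≤ (1 + 1 / q) ^ (2 * α) * k ^ (2 * α) * x := by positivity
    linarith

/-- Nonasymptotic bound for `SPC` in terms of an effective dimension `J`. -/
lemma SPC_le_of_cutoff {α β γ q J E n τ : ℝ} {l u : ℕ → ℝ} (hα : 1 / 2 < α) (hγ : 0 < γ)
    (hn : 0 < n) (hτ : 0 < τ) (hq : 0 < q) (hJ : 0 < J)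
    (hu : Summable (fun j : ℕ => ((j : ℝ) + 1) ^ (2 * γ) * (u (j + 1)) ^ 2))
    (hE₁ : q ^ (2 * α) * J ^ (2 * α + 2 * γ) ≤ E) (hE₂ : ((1 + q) * J) ^ (2 * α) ≤ E)
    (h : ∀ j : ℕ, (j : ℝ) + 1 ≤ q * J →
      E ≤ n * τ ^ 2 * (l (j + 1)) ^ 2 * ((j : ℝ) + 1) ^ (2 * β - 2 * α)
        * ((j : ℝ) + 1) ^ (2 * α)) :
    SPC α β l u n τ ≤
      2 * (τ ^ 2 * ((1 + (1 + 1 / q) ^ (2 * α)) * (J ^ (-(2 * α - 1)) / (2 * α - 1))))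
      + (1 + q ^ (-(2 * γ))) * J ^ (-(2 * γ))
        * ∑' j : ℕ, ((j : ℝ) + 1) ^ (2 * γ) * (u (j + 1)) ^ 2 := by
  have hp : 0 < 2 * α - 1 := by linarith
  have hα0 : 0 < α := by linarith
  have hN : (1 / (n * τ ^ 2))⁻¹ = n * τ ^ 2 := by rw [one_div, inv_inv]
  have hc1 : (n * (1 / (n * τ ^ 2)) ^ 2)⁻¹ = n * τ ^ 2 * τ ^ 2 := by field_simp
  have hc3 : (n * (1 / (n * τ ^ 2)))⁻¹ = τ ^ 2 := by field_simp
  unfold SPC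
  rw [hN, hc1, hc3]
  set x : ℕ → ℝ := fun j => n * τ ^ 2 * (l (j + 1)) ^ 2 * ((j : ℝ) + 1) ^ (2 * β - 2 * α) with hxdef
  have hx : ∀ j, 0 ≤ x j := fun j => by simp only [hxdef]; positivity
  have hk : ∀ j : ℕ, (1 : ℝ) ≤ (j : ℝ) + 1 := fun j => by
    have : (0 : ℝ) ≤ j := j.cast_nonneg
    linarith
  have hexp : -(2 * α) = -((2 * α - 1) + 1) := by ring
  have hsumJ : Summable (fun j : ℕ => ((j : ℝ) + 1 + J) ^ (-(2 * α))) := by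
    rw [hexp]; exact summable_shifted_rpow hp hJ
  have htsumJ : ∑' j : ℕ, ((j : ℝ) + 1 + J) ^ (-(2 * α)) ≤ J ^ (-(2 * α - 1)) / (2 * α - 1) := by
    rw [hexp]; exact tsum_shifted_rpow_le hp hJ
  have hvar : ∀ j : ℕ, ((j : ℝ) + 1) ^ (-(2 * α)) / (1 + x j)
      ≤ (1 + (1 + 1 / q) ^ (2 * α)) * ((j : ℝ) + 1 + J) ^ (-(2 * α)) := fun j =>
    rpow_div_one_add_le hα0 hq hJ (hk j) (hx j) hE₂ (h j)
  have hvar_sum : Summable (fun j : ℕ => ((j : ℝ) + 1) ^ (-(2 * α)) / (1 + x j)) :=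
    Summable.of_nonneg_of_le (fun j => by have := hx j; positivity) hvar (hsumJ.mul_left _)
  have hvar_tsum : ∑' j : ℕ, ((j : ℝ) + 1) ^ (-(2 * α)) / (1 + x j)
      ≤ (1 + (1 + 1 / q) ^ (2 * α)) * (J ^ (-(2 * α - 1)) / (2 * α - 1)) := by
    refine (hvar_sum.tsum_le_tsum hvar (hsumJ.mul_left _)).trans ?_
    rw [tsum_mul_left]
    exact mul_le_mul_of_nonneg_left htsumJ (by positivity)
  have hT3 := mul_le_mul_of_nonneg_left hvar_tsum (sq_nonneg τ)
  have hT1 : n * τ ^ 2 * τ ^ 2 * ∑' j : ℕ, (l (j + 1)) ^ 2 * ((j : ℝ) + 1) ^ (2 * β - 4 * α) /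
      (1 + x j) ^ 2 ≤ τ ^ 2 * ∑' j : ℕ, ((j : ℝ) + 1) ^ (-(2 * α)) / (1 + x j) := by
    rw [← tsum_mul_left, ← tsum_mul_left]
    have hle : ∀ j : ℕ, n * τ ^ 2 * τ ^ 2 * ((l (j + 1)) ^ 2 * ((j : ℝ) + 1) ^ (2 * β - 4 * α) /
        (1 + x j) ^ 2) ≤ τ ^ 2 * (((j : ℝ) + 1) ^ (-(2 * α)) / (1 + x j)) := by
      intro j
      have hk0 : 0 < (j : ℝ) + 1 := by linarith [hk j]
      have hxj := hx j
      have e : 2 * β - 4 * α = (2 * β - 2 * α) + -(2 * α) := by ring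
      have e1 : n * τ ^ 2 * τ ^ 2 * ((l (j + 1)) ^ 2 * ((j : ℝ) + 1) ^ (2 * β - 4 * α) /
          (1 + x j) ^ 2) = τ ^ 2 * (((j : ℝ) + 1) ^ (-(2 * α)) / (1 + x j))
            * (x j / (1 + x j)) := by
        rw [e, Real.rpow_add hk0]
        have : (1 + x j) ≠ 0 := by positivity
        have hxj' : n * τ ^ 2 * (l (j + 1)) ^ 2 * ((j : ℝ) + 1) ^ (2 * β - 2 * α) = x j := rfl
        calc _ = τ ^ 2 * ((j : ℝ) + 1) ^ (-(2 * α))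
              * (n * τ ^ 2 * (l (j + 1)) ^ 2 * ((j : ℝ) + 1) ^ (2 * β - 2 * α))
              / (1 + x j) ^ 2 := by ring
          _ = τ ^ 2 * ((j : ℝ) + 1) ^ (-(2 * α)) * x j / (1 + x j) ^ 2 := by rw [hxj']
          _ = _ := by field_simp
      rw [e1]
      refine mul_le_of_le_one_right (by positivity) ?_
      rw [div_le_one (by positivity)]
      linarith
    exact (Summable.of_nonneg_of_le (fun j => by positivity) hle
      (hvar_sum.mul_left _)).tsum_le_tsum hle (hvar_sum.mul_left _)
  have hbias : ∀ j : ℕ, (u (j + 1)) ^ 2 / (1 + x j) ^ 2 ≤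
      (1 + q ^ (-(2 * γ))) * J ^ (-(2 * γ)) * (((j : ℝ) + 1) ^ (2 * γ) * (u (j + 1)) ^ 2) := by
    intro j
    have h1 := mul_le_mul_of_nonneg_right
      (inv_one_add_sq_le hα0 hγ hq hJ (hk j) (hx j) hE₁ (h j)) (sq_nonneg (u (j + 1)))
    rw [one_div_mul_eq_div] at h1
    linarith
  have hT2 : ∑' j : ℕ, (u (j + 1)) ^ 2 / (1 + x j) ^ 2 ≤ (1 + q ^ (-(2 * γ))) * J ^ (-(2 * γ))
      * ∑' j : ℕ, ((j : ℝ) + 1) ^ (2 * γ) * (u (j + 1)) ^ 2 := by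
    rw [← tsum_mul_left]
    exact (Summable.of_nonneg_of_le (fun j => by positivity) hbias
      (hu.mul_left _)).tsum_le_tsum hbias (hu.mul_left _)
  linarith

lemma eventually_mul_log_rpow_le (C A : ℝ) {σ : ℝ} (hσ : 0 < σ) :
    ∀ᶠ n : ℕ in Filter.atTop, C * Real.log (n : ℝ) ^ A ≤ (n : ℝ) ^ σ := by
  have h := ((isLittleO_log_rpow_rpow_atTop A hσ).const_mul_left C).bound one_pos
  filter_upwards [tendsto_natCast_atTop_atTop.eventually h] with n hn
  rw [one_mul, Real.norm_of_nonneg (Real.rpow_nonneg n.cast_nonneg σ)] at hn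
  exact (Real.le_norm_self _).trans hn


/-- Theorem 4.3, second case of (420): if
`c₁ n^{-1/2+σ} ≤ τ_n ≤ c₂ (ln n)^{(α−γ−1/2)/b}` for all large `n`, then the
posterior contracts about `u†` at the minimax rate `(ln n)^{-γ/b}`, i.e.
`SPC(n,τ_n) ≤ M (ln n)^{-2γ/b}` for all large `n`. -/
theorem squared_posterior_contraction_minimax
    (s b α β γ σ : ℝ) (hs : 0 < s) (hb : 0 < b)
    (hα : 1 / 2 < α) (hβ : 0 ≤ β) (hγ : 0 < γ)
    (hσ : 0 < σ) (hσ' : σ < 1 / 2)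
    (l : ℕ → ℝ) (m M : ℝ) (hm : 0 < m) (hmM : m ≤ M)
    (hl : ∀ j : ℕ, 1 ≤ j →
      m * Real.exp (-s * (j : ℝ) ^ b) ≤ l j ∧ l j ≤ M * Real.exp (-s * (j : ℝ) ^ b))
    (u : ℕ → ℝ)
    (hu : Summable (fun j : ℕ => ((j : ℝ) + 1) ^ (2 * γ) * (u (j + 1)) ^ 2))
    (τn : ℕ → ℝ) (hτn : ∀ n, 0 < τn n)
    (c₁ c₂ : ℝ) (hc₁ : 0 < c₁) (hc₂ : 0 < c₂)
    (hτbounds : ∃ n₁ : ℕ, ∀ n : ℕ, n₁ ≤ n →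
      c₁ * (n : ℝ) ^ (-(1 / 2) + σ) ≤ τn n ∧
      τn n ≤ c₂ * (Real.log (n : ℝ)) ^ ((α - γ - 1 / 2) / b)) :
    ∃ M' : ℝ, 0 < M' ∧ ∃ n₀ : ℕ, ∀ n : ℕ, n₀ ≤ n →
      SPC α β l u n (τn n) ≤ M' * (Real.log (n : ℝ)) ^ (-(2 * γ) / b) := by
  obtain ⟨n₁, hn₁⟩ := hτbounds
  set q : ℝ := (σ / (2 * s)) ^ (1 / b) with hq_def
  have hq : 0 < q := by positivity
  set c : ℝ := c₁ ^ 2 * m ^ 2 with hc_def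
  have hc : 0 < c := by positivity
  set S : ℝ := ∑' j : ℕ, ((j : ℝ) + 1) ^ (2 * γ) * (u (j + 1)) ^ 2
  have hS : 0 ≤ S := tsum_nonneg fun j => by positivity
  have hp : 0 < 2 * α - 1 := by linarith
  refine ⟨2 * (c₂ ^ 2 * ((1 + (1 + 1 / q) ^ (2 * α)) / (2 * α - 1)))
    + (1 + q ^ (-(2 * γ))) * S, by positivity, ?_⟩
  rw [← Filter.eventually_atTop]
  filter_upwards [Filter.eventually_ge_atTop n₁, Filter.eventually_ge_atTop 2,
    eventually_mul_log_rpow_le (c⁻¹ * q ^ (2 * α)) ((1 / b) * (2 * α + 2 * γ)) hσ,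
    eventually_mul_log_rpow_le (c⁻¹ * (1 + q) ^ (2 * α)) ((1 / b) * (2 * α)) hσ]
    with n hn hn2 hlog₁ hlog₂
  obtain ⟨hτ₁, hτ₂⟩ := hn₁ n hn
  have hτ := hτn n
  have hn1 : (1 : ℝ) < n := by exact_mod_cast hn2
  have hn0 : (0 : ℝ) < n := by linarith
  have hL : 0 < Real.log n := Real.log_pos hn1
  set L := Real.log (n : ℝ) with hL_def
  have hLJ : ∀ a : ℝ, (L ^ (1 / b)) ^ a = L ^ ((1 / b) * a) := fun a =>
    (Real.rpow_mul hL.le _ _).symm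
  set J : ℝ := L ^ (1 / b) with hJ_def
  have hJ : 0 < J := by positivity
  have hE₁ : q ^ (2 * α) * J ^ (2 * α + 2 * γ) ≤ c * (n : ℝ) ^ σ := by
    rw [hLJ, ← inv_mul_le_iff₀ hc, ← mul_assoc]
    exact hlog₁
  have hE₂ : ((1 + q) * J) ^ (2 * α) ≤ c * (n : ℝ) ^ σ := by
    rw [Real.mul_rpow (by positivity) hJ.le, hLJ, ← inv_mul_le_iff₀ hc, ← mul_assoc]
    exact hlog₂
  have hqJ : (q * J) ^ b = σ / (2 * s) * L := by
    rw [hq_def, hJ_def, ← Real.mul_rpow (by positivity) hL.le,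
      ← Real.rpow_mul (by positivity), one_div_mul_cancel hb.ne', Real.rpow_one]
  have hprior : c₁ ^ 2 * (n : ℝ) ^ (2 * σ) ≤ n * τn n ^ 2 := by
    have h1 : (c₁ * (n : ℝ) ^ (-(1 / 2) + σ)) ^ 2 ≤ τn n ^ 2 :=
      pow_le_pow_left₀ (by positivity) hτ₁ 2
    have h2 : (n : ℝ) ^ (2 * σ) = n * ((n : ℝ) ^ (-(1 / 2) + σ)) ^ 2 := by
      rw [← Real.rpow_natCast, ← Real.rpow_mul hn0.le]
      nth_rewrite 2 [← Real.rpow_one (n : ℝ)]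
      rw [← Real.rpow_add hn0]
      congr 1
      push_cast
      ring
    rw [h2]
    calc c₁ ^ 2 * (n * ((n : ℝ) ^ (-(1 / 2) + σ)) ^ 2)
        = n * (c₁ * (n : ℝ) ^ (-(1 / 2) + σ)) ^ 2 := by ring
      _ ≤ _ := mul_le_mul_of_nonneg_left h1 hn0.le
  have hdamp : ∀ j : ℕ, (j : ℝ) + 1 ≤ q * J →
      c * (n : ℝ) ^ σ ≤ n * τn n ^ 2 * (l (j + 1)) ^ 2 * ((j : ℝ) + 1) ^ (2 * β - 2 * α)
        * ((j : ℝ) + 1) ^ (2 * α) := by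
    intro j hj
    have hk0 : 0 < (j : ℝ) + 1 := by positivity
    have hk1 : 1 ≤ (j : ℝ) + 1 := by linarith [(Nat.cast_nonneg j : (0 : ℝ) ≤ j)]
    have hkb : ((j : ℝ) + 1) ^ b ≤ σ / (2 * s) * L :=
      (Real.rpow_le_rpow hk0.le hj hb.le).trans_eq hqJ
    have hexp : (n : ℝ) ^ (-σ) ≤ (Real.exp (-s * ((j : ℝ) + 1) ^ b)) ^ 2 := by
      rw [Real.rpow_def_of_pos hn0, ← Real.exp_nat_mul, Real.exp_le_exp]
      have h1 := mul_le_mul_of_nonneg_left hkb (by positivity : 0 ≤ 2 * s)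
      have h2 : 2 * s * (σ / (2 * s) * L) = σ * L := by field_simp
      push_cast
      linarith
    have hlj := (hl (j + 1) (by omega)).1
    push_cast at hlj
    have hl2 : m ^ 2 * (n : ℝ) ^ (-σ) ≤ (l (j + 1)) ^ 2 := by
      have h1 := pow_le_pow_left₀ (by positivity) hlj 2
      rw [mul_pow] at h1
      exact (mul_le_mul_of_nonneg_left hexp (sq_nonneg m)).trans h1
    have hkβ : 1 ≤ ((j : ℝ) + 1) ^ (2 * β - 2 * α) * ((j : ℝ) + 1) ^ (2 * α) := by
      rw [← Real.rpow_add hk0, sub_add_cancel]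
      exact Real.one_le_rpow hk1 (by positivity)
    rw [mul_assoc _ (((j : ℝ) + 1) ^ (2 * β - 2 * α))]
    have hsplit : (n : ℝ) ^ σ = (n : ℝ) ^ (2 * σ) * (n : ℝ) ^ (-σ) := by
      rw [← Real.rpow_add hn0]
      congr 1
      ring
    calc c * (n : ℝ) ^ σ
        = (c₁ ^ 2 * (n : ℝ) ^ (2 * σ)) * (m ^ 2 * (n : ℝ) ^ (-σ)) := by
          rw [hsplit, hc_def]; ring
      _ ≤ n * τn n ^ 2 * (l (j + 1)) ^ 2 := by gcongr
      _ ≤ _ := le_mul_of_one_le_right (by positivity) hkβ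
  refine (SPC_le_of_cutoff hα hγ hn0 hτ hq hJ hu hE₁ hE₂ hdamp).trans ?_
  have hJγ : J ^ (-(2 * γ)) = L ^ (-(2 * γ) / b) := by
    rw [hLJ, one_div_mul_eq_div]
  have hτJ : τn n ^ 2 * J ^ (-(2 * α - 1)) ≤ c₂ ^ 2 * J ^ (-(2 * γ)) := by
    have h1 : τn n ^ 2 ≤ (c₂ * J ^ (α - γ - 1 / 2)) ^ 2 := by
      rw [hLJ, one_div_mul_eq_div]
      exact pow_le_pow_left₀ hτ.le hτ₂ 2
    have h2 : J ^ (-(2 * γ)) = (J ^ (α - γ - 1 / 2)) ^ 2 * J ^ (-(2 * α - 1)) := by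
      rw [← Real.rpow_natCast, ← Real.rpow_mul hJ.le, ← Real.rpow_add hJ]
      congr 1
      push_cast
      ring
    rw [h2, ← mul_assoc, ← mul_pow]
    exact mul_le_mul_of_nonneg_right h1 (by positivity)
  rw [← hJγ]
  have h3 : τn n ^ 2 * ((1 + (1 + 1 / q) ^ (2 * α)) * (J ^ (-(2 * α - 1)) / (2 * α - 1)))
      ≤ c₂ ^ 2 * ((1 + (1 + 1 / q) ^ (2 * α)) / (2 * α - 1)) * J ^ (-(2 * γ)) := by
    have h4 := mul_le_mul_of_nonneg_left hτJ
      (by positivity : 0 ≤ (1 + (1 + 1 / q) ^ (2 * α)) / (2 * α - 1))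
    calc _ = (1 + (1 + 1 / q) ^ (2 * α)) / (2 * α - 1)
          * (τn n ^ 2 * J ^ (-(2 * α - 1))) := by ring
      _ ≤ _ := h4
      _ = _ := by ring
  linarith
end

section
/- Let a, b > 0 and t ∈ ℝ. There exists λ₀ > 0 such that for every λ ∈ (0, λ₀) the equation λ^{-1} exp(−a x^b) x^t = 1 has a unique solution J_λ in the set {x ≥ 1}, and J_λ ∼ (ln λ^{-1/a})^{1/b} as λ → 0⁺, i.e. J_λ / ((1/a) ln(1/λ))^{1/b} → 1 as λ → 0⁺. [Lemma 4.4.] -/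
/-- Logarithmic form of the crossover equation. -/
lemma crossover_eq_iff (a b t : ℝ) {lam x : ℝ} (hlam : 0 < lam) (hx : 0 < x) :
    lam⁻¹ * Real.exp (-a * x ^ b) * x ^ t = 1 ↔
      a * Real.exp (b * Real.log x) - t * Real.log x = Real.log (1 / lam) := by
  have hl : lam⁻¹ = Real.exp (Real.log (1 / lam)) := by
    rw [Real.exp_log (by positivity), one_div]
  rw [hl, Real.rpow_def_of_pos hx, Real.rpow_def_of_pos hx, ← Real.exp_add, ← Real.exp_add,
    Real.exp_eq_one_iff, mul_comm (Real.log x) b, mul_comm (Real.log x) t]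
  constructor <;> intro h <;> linarith

/-- A level above its value at `0` is attained at most once on `[0, ∞)` by the strictly convex
function `y ↦ a * exp (b * y) - t * y`. -/
lemma not_lt_of_exp_sub_linear_eq {a b t L y z : ℝ} (ha : 0 < a) (hb : 0 < b) (hL : a < L)
    (hy : 0 ≤ y) (hy' : a * Real.exp (b * y) - t * y = L)
    (hz' : a * Real.exp (b * z) - t * z = L) : ¬ y < z := by
  intro hyz
  have hy0 : 0 < y := by
    rcases hy.eq_or_lt with h | h
    · subst h
      simp at hy'
      linarith
    · exact h
  have hz0 : 0 < z := hy0.trans hyz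
  have hs : 0 < y / z := by positivity
  have hs1 : y / z < 1 := (div_lt_one hz0).2 hyz
  have hsz : y / z * z = y := div_mul_cancel₀ y hz0.ne'
  have hne : (0 : ℝ) ≠ b * z := (mul_pos hb hz0).ne
  have key := strictConvexOn_exp.2 (Set.mem_univ (0 : ℝ)) (Set.mem_univ (b * z)) hne
    (sub_pos.2 hs1) hs (by ring)
  simp only [smul_eq_mul, mul_zero, zero_add, Real.exp_zero, mul_one] at key
  rw [show y / z * (b * z) = b * y by rw [← hsz]; field_simp] at key
  have key2 := mul_lt_mul_of_pos_left key ha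
  have h1 : (1 - y / z) * a < (1 - y / z) * L := mul_lt_mul_of_pos_left hL (sub_pos.2 hs1)
  have h2 : y / z * (a * Real.exp (b * z)) = y / z * L + t * y := by
    rw [← hz']
    linear_combination t * hsz
  nlinarith

open Filter in
/-- Every level above its value at `0` is attained on `[0, ∞)` by `y ↦ a * exp (b * y) - t * y`. -/
lemma exists_exp_sub_linear_eq {a b : ℝ} (t : ℝ) {L : ℝ} (ha : 0 < a) (hb : 0 < b) (hL : a < L) :
    ∃ y, 0 ≤ y ∧ a * Real.exp (b * y) - t * y = L := by
  have hlim : Tendsto (fun y : ℝ => y * (a * (Real.exp (b * y) / y ^ (1 : ℝ)) - t))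
      atTop atTop := by
    refine tendsto_id.atTop_mul_atTop₀ ?_
    exact tendsto_atTop_add_const_right _ _
      ((tendsto_exp_mul_div_rpow_atTop 1 b hb).const_mul_atTop ha)
  obtain ⟨z, hzL, hz⟩ := ((hlim.eventually_ge_atTop L).and (eventually_gt_atTop 0)).exists
  have hzL' : L ≤ a * Real.exp (b * z) - t * z := by
    refine hzL.trans_eq ?_
    rw [Real.rpow_one]
    field_simp
  have hc : ContinuousOn (fun y : ℝ => a * Real.exp (b * y) - t * y) (Set.Icc 0 z) := by
    fun_prop
  obtain ⟨y, hy, hyL⟩ := intermediate_value_Icc hz.le hc ⟨by simpa using hL.le, hzL'⟩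
  exact ⟨y, hy.1, hyL⟩

open Filter Topology in
/-- If `a * exp (b * y) - t * y = L` with `y ≥ 0` and `L → ∞`, then `exp (b * y) ∼ L / a`. -/
lemma tendsto_exp_div_of_exp_sub_linear_eq {ι : Type*} {l : Filter ι} {a b t : ℝ} {y L : ι → ℝ}
    (ha : 0 < a) (hb : 0 < b) (hy : ∀ᶠ i in l, 0 ≤ y i)
    (h : ∀ᶠ i in l, a * Real.exp (b * y i) - t * y i = L i) (hL : Tendsto L l atTop) :
    Tendsto (fun i => Real.exp (b * y i) / ((1 / a) * L i)) l (𝓝 1) := by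
  have hyt : Tendsto y l atTop := by
    have hC : 0 < a + |t| / b := by positivity
    have hbd : ∀ᶠ i in l, L i / (a + |t| / b) ≤ Real.exp (b * y i) := by
      filter_upwards [hy, h] with i h0 hi
      rw [div_le_iff₀ hC, ← hi]
      have h1 : b * y i ≤ Real.exp (b * y i) := by
        linarith [Real.add_one_le_exp (b * y i)]
      have h2 : |t| / b * (b * y i) ≤ |t| / b * Real.exp (b * y i) := by gcongr
      have h3 : |t| / b * (b * y i) = |t| * y i := by field_simp
      have h4 : -t * y i ≤ |t| * y i := mul_le_mul_of_nonneg_right (neg_le_abs t) h0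
      linarith
    have hexp : Tendsto (fun i => Real.exp (b * y i)) l atTop :=
      tendsto_atTop_mono' l hbd (hL.atTop_div_const hC)
    rw [Real.tendsto_exp_comp_atTop] at hexp
    exact (tendsto_const_mul_atTop_of_pos hb).1 hexp
  have hsmall : Tendsto (fun i => y i / Real.exp (b * y i)) l (𝓝 0) := by
    have := (tendsto_exp_mul_div_rpow_atTop 1 b hb).inv_tendsto_atTop.comp hyt
    refine this.congr fun i => ?_
    simp
  have hmain : Tendsto (fun i => (1 - t / a * (y i / Real.exp (b * y i)))⁻¹) l (𝓝 1) := by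
    have := (tendsto_const_nhds (x := (1 : ℝ))).sub (hsmall.const_mul (t / a))
    simpa using this.inv₀ (by simp)
  refine hmain.congr' ?_
  filter_upwards [h] with i hi
  rw [← hi, ← inv_div]
  have := (Real.exp_pos (b * y i)).ne'
  field_simp

/-- Lemma 4.4: for all sufficiently small `λ > 0` the equation
`λ⁻¹ exp(−a x^b) x^t = 1` has a unique solution `J_λ` in `{x ≥ 1}`, and
`J_λ ∼ (ln λ^{-1/a})^{1/b}` as `λ → 0⁺`. -/
theorem unique_crossover_asymptotics (a b t : ℝ) (ha : 0 < a) (hb : 0 < b) :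
    ∃ lam₀ : ℝ, 0 < lam₀ ∧ ∃ J : ℝ → ℝ,
      (∀ lam : ℝ, 0 < lam → lam < lam₀ →
        1 ≤ J lam ∧
        lam⁻¹ * Real.exp (-a * (J lam) ^ b) * (J lam) ^ t = 1 ∧
        ∀ x : ℝ, 1 ≤ x → lam⁻¹ * Real.exp (-a * x ^ b) * x ^ t = 1 → x = J lam) ∧
      Filter.Tendsto
        (fun lam : ℝ => J lam / (((1 / a) * Real.log (1 / lam)) ^ (1 / b)))
        (nhdsWithin 0 (Set.Ioi 0)) (nhds 1) := by
  have hlevel : ∀ lam : ℝ, 0 < lam → lam < Real.exp (-a) → a < Real.log (1 / lam) := by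
    intro lam h0 h1
    rw [one_div, Real.log_inv]
    linarith [(Real.log_lt_iff_lt_exp h0).2 h1]
  have hex : ∀ lam : ℝ, ∃ y : ℝ, 0 < lam → lam < Real.exp (-a) →
      0 ≤ y ∧ a * Real.exp (b * y) - t * y = Real.log (1 / lam) := by
    intro lam
    by_cases h : 0 < lam ∧ lam < Real.exp (-a)
    · obtain ⟨y, hy⟩ := exists_exp_sub_linear_eq t ha hb (hlevel lam h.1 h.2)
      exact ⟨y, fun _ _ => hy⟩
    · exact ⟨0, fun h0 h1 => absurd ⟨h0, h1⟩ h⟩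
  choose y hy using hex
  refine ⟨Real.exp (-a), Real.exp_pos _, fun lam => Real.exp (y lam), ?_, ?_⟩
  · intro lam h0 h1
    obtain ⟨hy0, hyL⟩ := hy lam h0 h1
    refine ⟨Real.one_le_exp hy0, ?_, fun x hx hxL => ?_⟩
    · rw [crossover_eq_iff a b t h0 (Real.exp_pos _), Real.log_exp]
      exact hyL
    · have hx0 : 0 < x := zero_lt_one.trans_le hx
      rw [crossover_eq_iff a b t h0 hx0] at hxL
      have hL := hlevel lam h0 h1
      change x = Real.exp (y lam)
      rw [← le_antisymm
        (not_lt.1 (not_lt_of_exp_sub_linear_eq ha hb hL hy0 hyL hxL))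
        (not_lt.1 (not_lt_of_exp_sub_linear_eq ha hb hL (Real.log_nonneg hx) hxL hyL)),
        Real.exp_log hx0]
  · have hev : ∀ᶠ lam : ℝ in nhdsWithin 0 (Set.Ioi 0), 0 < lam ∧ lam < Real.exp (-a) :=
      Ioo_mem_nhdsGT (Real.exp_pos _)
    have hL : Filter.Tendsto (fun lam : ℝ => Real.log (1 / lam))
        (nhdsWithin 0 (Set.Ioi 0)) Filter.atTop := by
      simp only [one_div]
      exact Real.tendsto_log_atTop.comp tendsto_inv_nhdsGT_zero
    have hlim := tendsto_exp_div_of_exp_sub_linear_eq ha hb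
      (hev.mono fun lam h => (hy lam h.1 h.2).1) (hev.mono fun lam h => (hy lam h.1 h.2).2) hL
    have hpow := hlim.rpow_const (p := 1 / b) (Or.inl one_ne_zero)
    rw [Real.one_rpow] at hpow
    refine hpow.congr' ?_
    filter_upwards [hev] with lam h
    have hpos : 0 < Real.log (1 / lam) := ha.trans (hlevel lam h.1 h.2)
    rw [Real.div_rpow (Real.exp_pos _).le (by positivity), ← Real.exp_mul]
    congr 2
    field_simp
end

section
/- Let a > 0, b > 0 and c ∈ ℝ. Then ∫₁^J exp(a x^b) x^c dx ∼ (1/(ab)) exp(a J^b) J^{c−b+1} as J → ∞, i.e. the ratio of the left-hand side to the right-hand side tends to 1 as J → ∞. [Lemma 4.5.] -/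
open Filter Topology in
/-- **L'Hôpital's rule** at infinity, for a denominator that tends to infinity. -/
theorem tendsto_div_atTop_of_hasDerivAt {f g f' g' : ℝ → ℝ} {l : ℝ}
    (hf : ∀ᶠ x in atTop, HasDerivAt f (f' x) x)
    (hg : ∀ᶠ x in atTop, HasDerivAt g (g' x) x)
    (hg' : ∀ᶠ x in atTop, 0 < g' x) (hgtop : Tendsto g atTop atTop)
    (hlim : Tendsto (fun x => f' x / g' x) atTop (𝓝 l)) :
    Tendsto (fun x => f x / g x) atTop (𝓝 l) := by
  rw [Metric.tendsto_nhds] at hlim ⊢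
  intro ε hε
  obtain ⟨X, hX⟩ := eventually_atTop.1 (hf.and (hg.and (hg'.and (hlim (ε / 2) (half_pos hε)))))
  have hderiv : ∀ x, X ≤ x → HasDerivAt (fun y => f y - l * g y) (f' x - l * g' x) x :=
    fun x hx => (hX x hx).1.sub ((hX x hx).2.1.const_mul l)
  have hbound : ∀ x, X ≤ x → ‖f' x - l * g' x‖ ≤ ε / 2 * g' x := by
    intro x hx
    obtain ⟨-, -, hpos, hdist⟩ := hX x hx
    rw [Real.dist_eq, div_sub' hpos.ne', abs_div, abs_of_pos hpos, div_lt_iff₀ hpos,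
      mul_comm (g' x)] at hdist
    exact hdist.le
  set C := ‖f X - l * g X‖ - ε / 2 * g X with hC
  have hmain : ∀ x, X ≤ x → ‖f x - l * g x‖ ≤ C + ε / 2 * g x := by
    intro x hx
    refine image_norm_le_of_norm_deriv_right_le_deriv_boundary'
      (f := fun y => f y - l * g y) (f' := fun y => f' y - l * g' y)
      (B := fun y => C + ε / 2 * g y) (B' := fun y => ε / 2 * g' y)
      (fun y hy => (hderiv y hy.1).continuousAt.continuousWithinAt)
      (fun y hy => (hderiv y hy.1).hasDerivWithinAt) (by simp [hC])
      (fun y hy => (((hX y hy.1).2.1.const_mul _).const_add C).continuousAt.continuousWithinAt)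
      (fun y hy => (((hX y hy.1).2.1.const_mul _).const_add C).hasDerivWithinAt)
      (fun y hy => hbound y hy.1) (Set.right_mem_Icc.2 hx)
  filter_upwards [eventually_ge_atTop X, hgtop.eventually_gt_atTop 0,
    hgtop.eventually_gt_atTop (C / (ε / 2))] with x hx hpos hlarge
  rw [div_lt_iff₀ (half_pos hε)] at hlarge
  rw [Real.dist_eq, div_sub' hpos.ne', abs_div, abs_of_pos hpos, div_lt_iff₀ hpos,
    mul_comm (g x)]
  have := hmain x hx
  rw [Real.norm_eq_abs] at this
  linarith

open Filter in
theorem tendsto_exp_mul_rpow_mul_rpow_atTop {a b : ℝ} (ha : 0 < a) (hb : 0 < b) (s : ℝ) :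
    Tendsto (fun x : ℝ => Real.exp (a * x ^ b) * x ^ s) atTop atTop := by
  refine ((tendsto_exp_mul_div_rpow_atTop (-s / b) a ha).comp (tendsto_rpow_atTop hb)).congr' ?_
  filter_upwards [eventually_gt_atTop 0] with x hx
  simp only [Function.comp_apply]
  rw [← Real.rpow_mul hx.le, mul_div_cancel₀ _ hb.ne', Real.rpow_neg hx.le, div_inv_eq_mul]

theorem hasDerivAt_exp_mul_rpow_mul_rpow {a b : ℝ} (ha : a ≠ 0) (hb : b ≠ 0) (c : ℝ) {x : ℝ}
    (hx : 0 < x) :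
    HasDerivAt (fun y : ℝ => (1 / (a * b)) * Real.exp (a * y ^ b) * y ^ (c - b + 1))
      (Real.exp (a * x ^ b) * x ^ c * (1 + (c - b + 1) / (a * b) * x ^ (-b))) x := by
  have h := ((((Real.hasDerivAt_rpow_const (p := b) (Or.inl hx.ne')).const_mul a).exp.const_mul
    (1 / (a * b))).mul (Real.hasDerivAt_rpow_const (p := c - b + 1) (Or.inl hx.ne')))
  refine h.congr_deriv ?_
  have h₁ : x ^ c = x ^ (b - 1) * x ^ (c - b + 1) := by
    rw [← Real.rpow_add hx]; ring_nf
  have h₂ : x ^ (c - b + 1 - 1) = x ^ c * x ^ (-b) := by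
    rw [← Real.rpow_add hx]; ring_nf
  rw [h₂, mul_add, mul_one]
  congr 1
  · rw [h₁]; field_simp
  · ring

open Filter Topology in
/-- Lemma 4.5: for `a, b > 0` and `c ∈ ℝ`,
`∫₁^J exp(a x^b) x^c dx ∼ (1/(ab)) exp(a J^b) J^{c−b+1}` as `J → ∞`. -/
theorem growing_integral_asymptotics (a b c : ℝ) (ha : 0 < a) (hb : 0 < b) :
    Filter.Tendsto
      (fun J : ℝ =>
        (∫ x in (1 : ℝ)..J, Real.exp (a * x ^ b) * x ^ c) /
          ((1 / (a * b)) * Real.exp (a * J ^ b) * J ^ (c - b + 1)))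
      Filter.atTop (nhds 1) := by
  have hcont : ContinuousOn (fun x : ℝ => Real.exp (a * x ^ b) * x ^ c) (Set.Ioi 0) := by
    intro x hx
    have hx' : x ≠ 0 := (Set.mem_Ioi.1 hx).ne'
    exact (((Real.continuousAt_rpow_const x b (Or.inl hx')).const_mul a).rexp.mul
      (Real.continuousAt_rpow_const x c (Or.inl hx'))).continuousWithinAt
  have hone : Tendsto (fun x : ℝ => 1 + (c - b + 1) / (a * b) * x ^ (-b)) atTop (𝓝 1) := by
    simpa using ((tendsto_rpow_neg_atTop hb).const_mul ((c - b + 1) / (a * b))).const_add 1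
  have hpos : ∀ᶠ x : ℝ in atTop, 0 < 1 + (c - b + 1) / (a * b) * x ^ (-b) :=
    hone.eventually_const_lt one_pos
  refine tendsto_div_atTop_of_hasDerivAt
    (f' := fun x => Real.exp (a * x ^ b) * x ^ c)
    (g' := fun x => Real.exp (a * x ^ b) * x ^ c * (1 + (c - b + 1) / (a * b) * x ^ (-b)))
    ?_ ?_ ?_ ?_ ?_
  · filter_upwards [eventually_ge_atTop 1] with x hx
    have hx₀ : (0 : ℝ) < x := one_pos.trans_le hx
    refine intervalIntegral.integral_hasDerivAt_right ?_
      (hcont.stronglyMeasurableAtFilter isOpen_Ioi x hx₀)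
      (hcont.continuousAt (Ioi_mem_nhds hx₀))
    refine (hcont.mono fun y hy => ?_).intervalIntegrable
    rw [Set.uIcc_of_le hx] at hy
    exact one_pos.trans_le hy.1
  · filter_upwards [eventually_gt_atTop 0] with x hx
    exact hasDerivAt_exp_mul_rpow_mul_rpow ha.ne' hb.ne' c hx
  · filter_upwards [eventually_gt_atTop 0, hpos] with x hx hpos
    positivity
  · simp only [mul_assoc (1 / (a * b))]
    exact (tendsto_exp_mul_rpow_mul_rpow_atTop ha hb _).const_mul_atTop (by positivity)
  · have hinv := hone.inv₀ one_ne_zero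
    rw [inv_one] at hinv
    refine hinv.congr' ?_
    filter_upwards [eventually_gt_atTop 0, hpos] with x hx hpos
    have : Real.exp (a * x ^ b) * x ^ c ≠ 0 := by positivity
    rw [div_mul_cancel_left₀ this]
end

section
/- Let a > 0 and c ∈ ℝ. (i) If b ≥ 1, then Σ_{j=1}^{J} exp(a j^b) j^c ≍ exp(a J^b) J^c as J → ∞ over positive integers J, i.e. there exist constants 0 < m ≤ M and J₀ such that m exp(a J^b) J^c ≤ Σ_{j=1}^{J} exp(a j^b) j^c ≤ M exp(a J^b) J^c for all integers J ≥ J₀. (ii) If 0 < b < 1, then there exist M > 0 and J₀ such that Σ_{j=1}^{J} exp(a j^b) j^c ≤ M exp(a J^b) J^{c−b+1} for all integers J ≥ J₀. [Growing-sum estimates (new1)/(new2) in the proof of Theorem 4.1, with a = 2s and c = −2β.] -/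
/-- A partial sum is dominated by `F` when the increments of `F` eventually dominate the summands. -/
theorem exists_sum_Icc_le_mul_of_increment {f F : ℕ → ℝ} {ε : ℝ} (hε : 0 < ε)
    (hf : ∀ n, 0 ≤ f n) (hF : ∀ n, 1 ≤ n → 0 < F n) {N : ℕ} (hN : 1 ≤ N)
    (h : ∀ n, N ≤ n → F n + ε * f (n + 1) ≤ F (n + 1)) :
    ∃ M : ℝ, 0 < M ∧ ∀ J : ℕ, N ≤ J → ∑ j ∈ Finset.Icc 1 J, f j ≤ M * F J := by
  refine ⟨max (1 / ε) ((∑ j ∈ Finset.Icc 1 N, f j) / F N), lt_max_of_lt_left (by positivity), ?_⟩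
  set M := max (1 / ε) ((∑ j ∈ Finset.Icc 1 N, f j) / F N)
  intro J hJ
  induction J, hJ using Nat.le_induction with
  | base => exact (div_le_iff₀ (hF N hN)).1 (le_max_right _ _)
  | succ n hn ih =>
    rw [Finset.sum_Icc_succ_top (by omega)]
    have h1 : f (n + 1) ≤ (1 / ε) * (F (n + 1) - F n) := by
      rw [one_div, ← div_eq_inv_mul, le_div_iff₀ hε]
      linarith [h n hn]
    have h2 : 0 ≤ F (n + 1) - F n := by
      have := mul_nonneg hε.le (hf (n + 1))
      linarith [h n hn]
    have h3 : (1 / ε) * (F (n + 1) - F n) ≤ M * (F (n + 1) - F n) :=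
      mul_le_mul_of_nonneg_right (le_max_left _ _) h2
    linarith

theorem rpow_le_rpow_add_one_mul_exp (e : ℝ) {y : ℝ} (hy : 1 ≤ y) :
    y ^ e ≤ (y + 1) ^ e * Real.exp (2 * |e| / (y + 1)) := by
  have hy0 : 0 < y := by linarith
  have hx0 : 0 < y + 1 := by linarith
  rw [Real.rpow_def_of_pos hy0, Real.rpow_def_of_pos hx0, ← Real.exp_add, Real.exp_le_exp]
  have h0 : Real.log y ≤ Real.log (y + 1) := Real.log_le_log hy0 (by linarith)
  have h1 : Real.log (y + 1) - Real.log y ≤ 2 / (y + 1) := by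
    rw [← Real.log_div hx0.ne' hy0.ne']
    refine (Real.log_le_sub_one_of_pos (by positivity)).trans ?_
    rw [div_sub_one hy0.ne', div_le_div_iff₀ hy0 hx0]
    linarith
  have h2 : (Real.log (y + 1) - Real.log y) * (-e) ≤ 2 / (y + 1) * |e| :=
    (mul_le_mul_of_nonneg_left (neg_le_abs e) (by linarith)).trans
      (mul_le_mul_of_nonneg_right h1 (abs_nonneg e))
  have h3 : 2 * |e| / (y + 1) = 2 / (y + 1) * |e| := by ring
  linarith

theorem exp_neg_le_one_sub_div {t K : ℝ} (ht : 0 ≤ t) (htK : t ≤ K) :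
    Real.exp (-t) ≤ 1 - t / (1 + K) := by
  have h1 : Real.exp (-t) ≤ 1 / (1 + t) := by
    rw [Real.exp_neg, ← one_div]
    exact one_div_le_one_div_of_le (by linarith) (by linarith [Real.add_one_le_exp t])
  have h2 : t / (1 + K) ≤ t / (1 + t) := by gcongr
  have h3 : 1 / (1 + t) = 1 - t / (1 + t) := by
    field_simp
    ring
  linarith

/-- If the increments of `x ^ b` are at least `d * x ^ (d - 1)` with `0 < d ≤ 1`, then
`∑ exp (a j ^ b) j ^ c ≲ exp (a J ^ b) J ^ (c - d + 1)`. -/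
theorem exists_sum_exp_rpow_mul_rpow_le {a b d : ℝ} (c : ℝ) (ha : 0 < a) (hd : 0 < d) (hd1 : d ≤ 1)
    (h : ∀ y : ℝ, 1 ≤ y → y ^ b + d * (y + 1) ^ (d - 1) ≤ (y + 1) ^ b) :
    ∃ M : ℝ, 0 < M ∧ ∃ J₀ : ℕ, ∀ J : ℕ, J₀ ≤ J →
      ∑ j ∈ Finset.Icc 1 J, Real.exp (a * (j : ℝ) ^ b) * (j : ℝ) ^ c
        ≤ M * Real.exp (a * (J : ℝ) ^ b) * (J : ℝ) ^ (c - d + 1) := by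
  set e := c - d + 1 with he
  set K := a * d / 2 with hK
  have hK0 : 0 < K := by positivity
  have hlim : Filter.Tendsto (fun n : ℕ => (n : ℝ) ^ d) Filter.atTop Filter.atTop :=
    (tendsto_rpow_atTop hd).comp tendsto_natCast_atTop_atTop
  obtain ⟨N, hN⟩ := Filter.eventually_atTop.1 (hlim.eventually_ge_atTop (2 * |e| / K))
  have key : ∀ n : ℕ, max N 1 ≤ n →
      Real.exp (a * (n : ℝ) ^ b) * (n : ℝ) ^ e
        + K / (1 + K) * (Real.exp (a * ((n + 1 : ℕ) : ℝ) ^ b) * ((n + 1 : ℕ) : ℝ) ^ c)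
        ≤ Real.exp (a * ((n + 1 : ℕ) : ℝ) ^ b) * ((n + 1 : ℕ) : ℝ) ^ e := by
    intro n hn
    have hy : (1 : ℝ) ≤ n := by exact_mod_cast (le_max_right N 1).trans hn
    have hbig : 2 * |e| / K ≤ ((n : ℝ) + 1) ^ d := by
      exact_mod_cast hN (n + 1) (by have := (le_max_left N 1).trans hn; omega)
    push_cast
    generalize (n : ℝ) = y at hy hbig
    have hx0 : 0 < y + 1 := by linarith
    set t := K * (y + 1) ^ (d - 1) with ht
    have ht0 : 0 ≤ t := by positivity
    have htK : t ≤ K := mul_le_of_le_one_right hK0.le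
      (Real.rpow_le_one_of_one_le_of_nonpos (by linarith) (by linarith))
    have hcorr : 2 * |e| / (y + 1) ≤ t := by
      rw [ht, Real.rpow_sub_one hx0.ne', ← mul_div_assoc]
      exact div_le_div_of_nonneg_right ((div_le_iff₀' hK0).1 hbig) hx0.le
    have hexp : a * y ^ b + 2 * |e| / (y + 1) ≤ a * (y + 1) ^ b + -t := by
      have h1 := mul_le_mul_of_nonneg_left (h y hy) ha.le
      have h2 : a * (d * (y + 1) ^ (d - 1)) = 2 * t := by rw [ht, hK]; ring
      linarith
    have hpow : t * (y + 1) ^ e = K * (y + 1) ^ c := by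
      rw [ht, mul_assoc, ← Real.rpow_add hx0, he]
      ring_nf
    have hstep : Real.exp (a * y ^ b) * y ^ e
        ≤ Real.exp (a * (y + 1) ^ b) * (y + 1) ^ e * (1 - t / (1 + K)) := calc
      _ ≤ Real.exp (a * y ^ b) * ((y + 1) ^ e * Real.exp (2 * |e| / (y + 1))) := by
        gcongr
        exact rpow_le_rpow_add_one_mul_exp e hy
      _ = Real.exp (a * y ^ b + 2 * |e| / (y + 1)) * (y + 1) ^ e := by rw [Real.exp_add]; ring
      _ ≤ Real.exp (a * (y + 1) ^ b + -t) * (y + 1) ^ e := by gcongr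
      _ = Real.exp (a * (y + 1) ^ b) * (y + 1) ^ e * Real.exp (-t) := by rw [Real.exp_add]; ring
      _ ≤ _ := by
        gcongr
        exact exp_neg_le_one_sub_div ht0 htK
    have hlast : Real.exp (a * (y + 1) ^ b) * (y + 1) ^ e * (1 - t / (1 + K))
        = Real.exp (a * (y + 1) ^ b) * (y + 1) ^ e
          - K / (1 + K) * (Real.exp (a * (y + 1) ^ b) * (y + 1) ^ c) := by
      linear_combination (-Real.exp (a * (y + 1) ^ b) / (1 + K)) * hpow
    linarith
  obtain ⟨M, hM0, hM⟩ := exists_sum_Icc_le_mul_of_increment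
    (f := fun j : ℕ => Real.exp (a * (j : ℝ) ^ b) * (j : ℝ) ^ c)
    (F := fun j : ℕ => Real.exp (a * (j : ℝ) ^ b) * (j : ℝ) ^ e)
    (ε := K / (1 + K)) (N := max N 1) (by positivity)
    (fun n => by positivity) (fun n hn => by positivity) (le_max_right _ _) key
  exact ⟨M, hM0, max N 1, fun J hJ => by simpa only [mul_assoc] using hM J hJ⟩

theorem rpow_add_one_le_rpow_add_one {b : ℝ} (hb : 1 ≤ b) {y : ℝ} (hy : 0 ≤ y) :
    y ^ b + 1 ≤ (y + 1) ^ b := by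
  simpa using Real.add_rpow_le_rpow_add hy zero_le_one hb

theorem rpow_add_mul_rpow_sub_one_le {b : ℝ} (hb : 0 ≤ b) (hb1 : b ≤ 1) {y : ℝ} (hy : 0 ≤ y) :
    y ^ b + b * (y + 1) ^ (b - 1) ≤ (y + 1) ^ b := by
  have hx0 : 0 < y + 1 := by linarith
  have h1 : (1 + -(1 / (y + 1))) ^ b ≤ 1 + b * -(1 / (y + 1)) := by
    refine rpow_one_add_le_one_add_mul_self ?_ hb hb1
    rw [neg_le_neg_iff, div_le_one hx0]
    linarith
  have h2 : 1 + -(1 / (y + 1)) = y / (y + 1) := by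
    field_simp
    ring
  rw [h2, Real.div_rpow hy hx0.le, div_le_iff₀ (by positivity)] at h1
  rw [Real.rpow_sub_one hx0.ne']
  calc _ ≤ (1 + b * -(1 / (y + 1))) * (y + 1) ^ b + b * ((y + 1) ^ b / (y + 1)) := by gcongr
    _ = _ := by ring

/-- Growing-sum estimates (new1)/(new2) in the proof of Theorem 4.1:
(i) if `b ≥ 1` then `Σ_{j=1}^J exp(a j^b) j^c ≍ exp(a J^b) J^c` as `J → ∞`;
(ii) if `0 < b < 1` then `Σ_{j=1}^J exp(a j^b) j^c ≲ exp(a J^b) J^{c−b+1}`. -/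
theorem growing_sum_estimates (a b c : ℝ) (ha : 0 < a) (hb : 0 < b) :
    (1 ≤ b → ∃ m M : ℝ, 0 < m ∧ m ≤ M ∧ ∃ J₀ : ℕ, ∀ J : ℕ, J₀ ≤ J →
      m * Real.exp (a * (J : ℝ) ^ b) * (J : ℝ) ^ c
        ≤ ∑ j ∈ Finset.Icc 1 J, Real.exp (a * (j : ℝ) ^ b) * (j : ℝ) ^ c ∧
      ∑ j ∈ Finset.Icc 1 J, Real.exp (a * (j : ℝ) ^ b) * (j : ℝ) ^ c
        ≤ M * Real.exp (a * (J : ℝ) ^ b) * (J : ℝ) ^ c) ∧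
    (b < 1 → ∃ M : ℝ, 0 < M ∧ ∃ J₀ : ℕ, ∀ J : ℕ, J₀ ≤ J →
      ∑ j ∈ Finset.Icc 1 J, Real.exp (a * (j : ℝ) ^ b) * (j : ℝ) ^ c
        ≤ M * Real.exp (a * (J : ℝ) ^ b) * (J : ℝ) ^ (c - b + 1)) := by
  constructor
  · intro hb1
    obtain ⟨M, hM0, J₀, hM⟩ := exists_sum_exp_rpow_mul_rpow_le (b := b) (d := 1) c ha one_pos le_rfl
      fun y hy => by simpa using rpow_add_one_le_rpow_add_one hb1 (zero_le_one.trans hy)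
    refine ⟨1, max 1 M, one_pos, le_max_left _ _, max J₀ 1, fun J hJ => ⟨?_, ?_⟩⟩
    · rw [one_mul]
      exact Finset.single_le_sum
        (f := fun j : ℕ => Real.exp (a * (j : ℝ) ^ b) * (j : ℝ) ^ c)
        (fun j _ => by positivity)
        (Finset.mem_Icc.2 ⟨(le_max_right _ _).trans hJ, le_rfl⟩)
    · refine (hM J ((le_max_left _ _).trans hJ)).trans ?_
      rw [sub_add_cancel]
      gcongr
      exact le_max_right _ _
  · intro hb1
    exact exists_sum_exp_rpow_mul_rpow_le c ha hb hb1.le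
      fun y hy => rpow_add_mul_rpow_sub_one_le hb.le hb1.le (zero_le_one.trans hy)
end
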